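/- There exists a constant C > 0 with the following property (stability of odd-fractional anyonic matter). Let μ be an odd integer and ν a positive integer with gcd(|μ|, ν) = 1, and set α := μ/ν. Let m > 0, Z ≥ 1, N ≥ 1, K ≥ 1, let R_1, …, R_K ∈ ℝ² be distinct points, and let ψ : (ℝ²)^N → ℂ be smooth, symmetric, normalized (∫|ψ|² = 1), with support disjoint from the diagonal set Δ = {x : x_j = x_k for some j ≠ k}. Then ∫_{(ℝ²)^N} [ (1/(2m))·∑_{j=1}^N ‖D_j ψ‖² + V_C(x, R)·|ψ|² ] dx ≥ −C·ν²·m·Z²·(K + N), where V_C(x, R) := ∑_{1≤j<k≤N} 1/|x_j − x_k| − ∑_{j=1}^N ∑_{k=1}^K Z/|x_j − R_k| + ∑_{1≤j<k≤K} Z²/|R_j − R_k|. -/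

import Mathlib

open MeasureTheory

/-- The `i`-th component of the Aharonov–Bohm magnetic potential
`A_j(x) = α ∑_{k ≠ j} (x_j - x_k)^⊥/|x_j - x_k|²` felt by the `j`-th anyon. -/
noncomputable def anyonA (α : ℝ) {n : ℕ} (x : Fin n → EuclideanSpace ℝ (Fin 2))
    (j : Fin n) (i : Fin 2) : ℝ :=
  α * ∑ k ∈ Finset.univ.filter (fun k => k ≠ j),
    (if i = 0 then -(x j 1 - x k 1) else x j 0 - x k 0) / ‖x j - x k‖ ^ 2

/-- The `i`-th component of the anyonic magnetic derivative
`D_jψ = -i∇_{x_j}ψ + A_j ψ`. -/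
noncomputable def anyonD (α : ℝ) {n : ℕ} (ψ : (Fin n → EuclideanSpace ℝ (Fin 2)) → ℂ)
    (x : Fin n → EuclideanSpace ℝ (Fin 2)) (j : Fin n) (i : Fin 2) : ℂ :=
  (-Complex.I) * fderiv ℝ ψ x (Pi.single j (EuclideanSpace.single i (1 : ℝ)))
    + (anyonA α x j i : ℂ) * ψ x

/-- The Euclidean plane. -/
abbrev Plane := EuclideanSpace ℝ (Fin 2)

/-! ### Electrostatics -/

lemma setIntegral_Ioi_lt_mul_lt {a b : ℝ} (ha : 0 ≤ a) (hb : 0 ≤ b) :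
    IntegrableOn (fun t => (if t < a then (1 : ℝ) else 0) * (if t < b then 1 else 0))
        (Set.Ioi 0) ∧
      ∫ t in Set.Ioi (0 : ℝ), (if t < a then (1 : ℝ) else 0) * (if t < b then 1 else 0)
        = min a b := by
  have h : (fun t => (if t < a then (1 : ℝ) else 0) * (if t < b then 1 else 0))
      = (Set.Iio (min a b)).indicator fun _ => (1 : ℝ) := by
    funext t
    simp only [Set.indicator, Set.mem_Iio, lt_min_iff]
    split_ifs <;> simp_all
  have hs : Set.Iio (min a b) ∩ Set.Ioi 0 = Set.Ioo 0 (min a b) := by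
    ext t; simp [and_comm]
  rw [h]
  constructor
  · rw [IntegrableOn, integrable_indicator_iff measurableSet_Iio, IntegrableOn,
      Measure.restrict_restrict measurableSet_Iio, hs]
    exact integrableOn_const (by simp)
  · rw [integral_indicator measurableSet_Iio, setIntegral_const, Measure.real,
      Measure.restrict_apply measurableSet_Iio, hs]
    rw [Real.volume_Ioo, sub_zero, ENNReal.toReal_ofReal (le_min ha hb), smul_eq_mul, mul_one]

lemma integral_linear_combination_le {X : Type*} [MeasurableSpace X] {μ : Measure X}
    {f₁ f₂ f₃ g₁ g₂ : X → ℝ} {a₁ a₂ a₃ b₁ b₂ : ℝ} (h₁ : Integrable f₁ μ) (h₂ : Integrable f₂ μ)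
    (h₃ : Integrable f₃ μ) (k₁ : Integrable g₁ μ) (k₂ : Integrable g₂ μ)
    (h : ∀ᵐ t ∂μ, b₁ * g₁ t + b₂ * g₂ t ≤ a₁ * f₁ t - a₂ * f₂ t + a₃ * f₃ t) :
    b₁ * ∫ t, g₁ t ∂μ + b₂ * ∫ t, g₂ t ∂μ
      ≤ a₁ * ∫ t, f₁ t ∂μ - a₂ * ∫ t, f₂ t ∂μ + a₃ * ∫ t, f₃ t ∂μ := by
  have j₁ := h₁.const_mul a₁
  have j₂ := h₂.const_mul a₂
  have j₃ := h₃.const_mul a₃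
  have l₁ := k₁.const_mul b₁
  have l₂ := k₂.const_mul b₂
  simp only [← integral_const_mul]
  have e₁ := integral_sub j₁ j₂
  have e₂ := integral_add (j₁.sub j₂) j₃
  have e₃ := integral_add l₁ l₂
  simp only [Pi.sub_apply] at e₂
  rw [← e₁, ← e₂, ← e₃]
  exact integral_mono_ae (l₁.add l₂) ((j₁.sub j₂).add j₃) h

/-- The Coulomb energy of charges which are all located in a common ball. -/
lemma coulomb_count_ge {Z n p c e : ℝ} (hZ : 0 ≤ Z) (hn : n * (n - 1) ≥ 0) (hn0 : 0 ≤ n)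
    (hp : p = 0 ∨ 1 ≤ p) (hc : 1 ≤ p → c = 1) (hc0 : 0 ≤ c) (he : e ≤ p - 1 ∨ e = 0) :
    1 / 2 * (n * n - n) - Z * (n * p) + 1 / 2 * Z ^ 2 * (p * p - p)
      ≥ -(Z + 1 / 2) * (n * c) + 1 / 2 * Z ^ 2 * e := by
  rcases hp with rfl | hp
  · have he' : e ≤ 0 := by rcases he with h | h <;> linarith
    nlinarith [mul_nonneg hn0 hc0, mul_nonneg hZ (mul_nonneg hn0 hc0), sq_nonneg Z]
  · rw [hc hp]
    have he' : e ≤ p - 1 := by rcases he with h | h <;> linarith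
    nlinarith [sq_nonneg (n - Z * (p - 1)), sq_nonneg Z,
      mul_le_mul_of_nonneg_left he' (sq_nonneg Z)]

lemma sum_min_ge {ι κ : Type*} [Fintype ι] [DecidableEq ι] [DecidableEq κ] (P : Finset κ)
    (a : ι → ℝ) (b : κ → ℝ) {Z B h : ℝ} (hZ : 0 ≤ Z) (ha : ∀ j, 0 ≤ a j) (hb : ∀ p, 0 ≤ b p)
    (hB0 : 0 ≤ B) (hB : ∀ p ∈ P, b p ≤ B) (hh0 : 0 ≤ h)
    (hh : 0 < h → ∃ p ∈ P, ∃ q ∈ P, p ≠ q ∧ h ≤ b p ∧ h ≤ b q) :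
    1 / 2 * ∑ j, ∑ k ∈ {j}ᶜ, min (a j) (a k) - Z * ∑ j, ∑ p ∈ P, min (a j) (b p)
        + 1 / 2 * Z ^ 2 * ∑ p ∈ P, ∑ q ∈ P.erase p, min (b p) (b q)
      ≥ -(Z + 1 / 2) * ∑ j, min (a j) B + 1 / 2 * Z ^ 2 * h := by
  classical
  set χ : ℝ → ℝ → ℝ := fun a t => if t < a then (1 : ℝ) else 0 with hχ
  have hmin : ∀ {a b : ℝ}, 0 ≤ a → 0 ≤ b → min a b = ∫ t in Set.Ioi (0 : ℝ), χ a t * χ b t :=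
    fun ha hb => (setIntegral_Ioi_lt_mul_lt ha hb).2.symm
  have h_int : ∀ {a b : ℝ}, 0 ≤ a → 0 ≤ b →
      Integrable (fun t => χ a t * χ b t) (volume.restrict (Set.Ioi (0 : ℝ))) :=
    fun ha hb => (setIntegral_Ioi_lt_mul_lt ha hb).1
  have h1 : ∑ j, ∑ k ∈ {j}ᶜ, min (a j) (a k)
      = ∫ t in Set.Ioi (0 : ℝ), ∑ j, ∑ k ∈ {j}ᶜ, χ (a j) t * χ (a k) t := by
    rw [integral_finsetSum _ fun j _ => integrable_finsetSum _ fun k _ => h_int (ha j) (ha k)]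
    refine Finset.sum_congr rfl fun j _ => ?_
    rw [integral_finsetSum _ fun k _ => h_int (ha j) (ha k)]
    exact Finset.sum_congr rfl fun k _ => hmin (ha j) (ha k)
  have h2 : ∑ j, ∑ p ∈ P, min (a j) (b p)
      = ∫ t in Set.Ioi (0 : ℝ), ∑ j, ∑ p ∈ P, χ (a j) t * χ (b p) t := by
    rw [integral_finsetSum _ fun j _ => integrable_finsetSum _ fun k _ => h_int (ha j) (hb k)]
    refine Finset.sum_congr rfl fun j _ => ?_
    rw [integral_finsetSum _ fun k _ => h_int (ha j) (hb k)]
    exact Finset.sum_congr rfl fun k _ => hmin (ha j) (hb k)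
  have h3 : ∑ p ∈ P, ∑ q ∈ P.erase p, min (b p) (b q)
      = ∫ t in Set.Ioi (0 : ℝ), ∑ p ∈ P, ∑ q ∈ P.erase p, χ (b p) t * χ (b q) t := by
    rw [integral_finsetSum _ fun j _ => integrable_finsetSum _ fun k _ => h_int (hb j) (hb k)]
    refine Finset.sum_congr rfl fun j _ => ?_
    rw [integral_finsetSum _ fun k _ => h_int (hb j) (hb k)]
    exact Finset.sum_congr rfl fun k _ => hmin (hb j) (hb k)
  have h4 : ∑ j, min (a j) B = ∫ t in Set.Ioi (0 : ℝ), ∑ j, χ (a j) t * χ B t := by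
    rw [integral_finsetSum _ fun j _ => h_int (ha j) hB0]
    exact Finset.sum_congr rfl fun j _ => hmin (ha j) hB0
  have h5 : h = ∫ t in Set.Ioi (0 : ℝ), χ h t * χ h t := by rw [← hmin hh0 hh0, min_self]
  have i1 : Integrable (fun t => ∑ j, ∑ k ∈ {j}ᶜ, χ (a j) t * χ (a k) t)
      (volume.restrict (Set.Ioi (0 : ℝ))) :=
    integrable_finsetSum _ fun j _ => integrable_finsetSum _ fun k _ => h_int (ha j) (ha k)
  have i2 : Integrable (fun t => ∑ j, ∑ p ∈ P, χ (a j) t * χ (b p) t)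
      (volume.restrict (Set.Ioi (0 : ℝ))) :=
    integrable_finsetSum _ fun j _ => integrable_finsetSum _ fun k _ => h_int (ha j) (hb k)
  have i3 : Integrable (fun t => ∑ p ∈ P, ∑ q ∈ P.erase p, χ (b p) t * χ (b q) t)
      (volume.restrict (Set.Ioi (0 : ℝ))) :=
    integrable_finsetSum _ fun j _ => integrable_finsetSum _ fun k _ => h_int (hb j) (hb k)
  have i4 : Integrable (fun t => ∑ j, χ (a j) t * χ B t)
      (volume.restrict (Set.Ioi (0 : ℝ))) :=
    integrable_finsetSum _ fun j _ => h_int (ha j) hB0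
  have i5 := h_int hh0 hh0
  rw [h1, h2, h3, h4]
  conv_rhs => rw [h5]
  refine integral_linear_combination_le i1 i2 i3 i4 i5 ?_
  refine (ae_restrict_iff' measurableSet_Ioi).2 (Filter.Eventually.of_forall fun t ht => ?_)
  have ht0 : 0 < t := ht
  have hsq : ∀ a, χ a t * χ a t = χ a t := fun a => by simp [hχ]
  set n : ℝ := ∑ j, χ (a j) t with hn
  set p : ℝ := ∑ q ∈ P, χ (b q) t with hp
  have e1 : ∑ j, ∑ k ∈ {j}ᶜ, χ (a j) t * χ (a k) t = n * n - n := by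
    have : ∀ j, ∑ k ∈ {j}ᶜ, χ (a j) t * χ (a k) t = χ (a j) t * n - χ (a j) t := fun j => by
      rw [Finset.compl_singleton, Finset.sum_erase_eq_sub (Finset.mem_univ j), hsq, hn,
        Finset.mul_sum]
    rw [Finset.sum_congr rfl fun j _ => this j, Finset.sum_sub_distrib, ← Finset.sum_mul]
  have e2 : ∑ j, ∑ q ∈ P, χ (a j) t * χ (b q) t = n * p := by
    rw [hn, hp, Finset.sum_mul_sum]
  have e3 : ∑ q ∈ P, ∑ r ∈ P.erase q, χ (b q) t * χ (b r) t = p * p - p := by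
    have : ∀ q ∈ P, ∑ r ∈ P.erase q, χ (b q) t * χ (b r) t = χ (b q) t * p - χ (b q) t :=
      fun q hq => by rw [Finset.sum_erase_eq_sub hq, hsq, hp, Finset.mul_sum]
    rw [Finset.sum_congr rfl this, Finset.sum_sub_distrib, ← Finset.sum_mul]
  have e4 : ∑ j, χ (a j) t * χ B t = n * χ B t := by rw [hn, Finset.sum_mul]
  have hnc : n = ((Finset.univ.filter fun j => t < a j).card : ℝ) := by simp [hn, hχ]
  have hpc : p = ((P.filter fun q => t < b q).card : ℝ) := by simp [hp, hχ]
  rw [e1, e2, e3, e4, hsq]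
  refine coulomb_count_ge hZ ?_ ?_ ?_ ?_ ?_ ?_
  · rw [hnc]
    rcases Nat.eq_zero_or_pos (Finset.univ.filter fun j => t < a j).card with h0 | h0
    · simp [h0]
    · have : (1 : ℝ) ≤ ((Finset.univ.filter fun j => t < a j).card : ℝ) := by exact_mod_cast h0
      exact mul_nonneg (by linarith) (by linarith)
  · rw [hnc]; exact Nat.cast_nonneg _
  · rw [hpc]
    rcases Nat.eq_zero_or_pos (P.filter fun q => t < b q).card with h0 | h0
    · left; simp [h0]
    · right; exact_mod_cast h0
  · intro h1p
    rw [hpc] at h1p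
    have : 0 < (P.filter fun q => t < b q).card := by
      have : (0 : ℝ) < ((P.filter fun q => t < b q).card : ℝ) := by linarith
      exact_mod_cast this
    obtain ⟨q, hq⟩ := Finset.card_pos.1 this
    rw [Finset.mem_filter] at hq
    simp only [hχ]
    rw [if_pos (hq.2.trans_le (hB q hq.1))]
  · simp only [hχ]; split_ifs <;> norm_num
  · by_cases hth : t < h
    · left
      obtain ⟨q, hq, r, hr, hqr, h1, h2⟩ := hh (ht0.trans hth)
      have : 1 < (P.filter fun q => t < b q).card :=
        Finset.one_lt_card.2 ⟨q, Finset.mem_filter.2 ⟨hq, hth.trans_le h1⟩, r,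
          Finset.mem_filter.2 ⟨hr, hth.trans_le h2⟩, hqr⟩
      have : (2 : ℝ) ≤ ((P.filter fun q => t < b q).card : ℝ) := by exact_mod_cast this
      simp only [hχ]
      rw [if_pos hth, hpc]; linarith
    · right; exact if_neg hth

lemma integrable_inv_one_add_norm_cube :
    Integrable fun z : Plane => ((1 + ‖z‖) ^ 3)⁻¹ := by
  have h := integrable_one_add_norm (E := Plane) (μ := volume) (r := 3) (by simp; norm_num)
  refine h.congr (Filter.Eventually.of_forall fun z => ?_)
  have : (0 : ℝ) ≤ 1 + ‖z‖ := by positivity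
  simp only
  rw [Real.rpow_neg this]
  norm_cast

lemma integral_comp_similarity (f : Plane → ℝ) (x : Plane) (d : ℝ) :
    ∫ z, f (d⁻¹ • (z - x)) = d ^ 2 * ∫ z, f z := by
  rw [integral_sub_right_eq_self (fun z => f (d⁻¹ • z)) x, Measure.integral_comp_inv_smul]
  simp

lemma integrable_comp_similarity {f : Plane → ℝ} (hf : Integrable f) (x : Plane) {d : ℝ}
    (hd : 0 < d) : Integrable fun z => f (d⁻¹ • (z - x)) :=
  (hf.comp_smul (inv_ne_zero hd.ne')).comp_sub_right x

lemma inv_add_norm_sub_cube_eq (x z : Plane) {d : ℝ} (hd : 0 < d) :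
    ((d + ‖z - x‖) ^ 3)⁻¹ = (d ^ 3)⁻¹ * ((1 + ‖d⁻¹ • (z - x)‖) ^ 3)⁻¹ := by
  rw [norm_smul, norm_inv, Real.norm_of_nonneg hd.le, ← mul_inv, ← mul_pow]
  congr 2
  field_simp

lemma integrable_inv_add_norm_sub_cube (x : Plane) {d : ℝ} (hd : 0 < d) :
    Integrable fun z => ((d + ‖z - x‖) ^ 3)⁻¹ := by
  simp only [inv_add_norm_sub_cube_eq x _ hd]
  exact (integrable_comp_similarity integrable_inv_one_add_norm_cube x hd).const_mul _

lemma integral_inv_add_norm_sub_cube (x : Plane) {d : ℝ} (hd : 0 < d) :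
    ∫ z, ((d + ‖z - x‖) ^ 3)⁻¹ = (∫ z : Plane, ((1 + ‖z‖) ^ 3)⁻¹) / d := by
  simp only [inv_add_norm_sub_cube_eq x _ hd]
  rw [integral_const_mul, integral_comp_similarity (fun z => ((1 + ‖z‖) ^ 3)⁻¹) x d]
  field_simp

/-- The inverse third power of the distance to `x`. -/
noncomputable def cubeKernel (x z : Plane) : ℝ := (‖z - x‖ ^ 3)⁻¹

lemma cubeKernel_nonneg (x z : Plane) : 0 ≤ cubeKernel x z := by
  unfold cubeKernel; positivity

lemma measurable_cubeKernel (x : Plane) : Measurable (cubeKernel x) := by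
  unfold cubeKernel; fun_prop

lemma min_cubeKernel_le {a t d : ℝ} {x z : Plane} (ht : ‖z - x‖ = t) (hd : 0 < d)
    (ha : t < d / 2 → a ≤ ((d - t) ^ 3)⁻¹) :
    min (cubeKernel x z) a ≤ 27 * ((d + t) ^ 3)⁻¹ := by
  have ht0 : 0 ≤ t := ht ▸ norm_nonneg _
  have key : ∀ s, (d + t) / 3 ≤ s → (s ^ 3)⁻¹ ≤ 27 * ((d + t) ^ 3)⁻¹ := fun s hs => by
    have h1 : 0 < (d + t) / 3 := by positivity
    calc (s ^ 3)⁻¹ ≤ (((d + t) / 3) ^ 3)⁻¹ := by gcongr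
      _ = 27 * ((d + t) ^ 3)⁻¹ := by field_simp; norm_num
  by_cases h : t < d / 2
  · exact (min_le_right _ _).trans ((ha h).trans (key _ (by linarith)))
  · refine (min_le_left _ _).trans ?_
    rw [cubeKernel, ht]
    exact key _ (by linarith)

lemma min_cubeKernel_cubeKernel_le {x y : Plane} (h : x ≠ y) (z : Plane) :
    min (cubeKernel x z) (cubeKernel y z) ≤ 27 * ((‖x - y‖ + ‖z - x‖) ^ 3)⁻¹ := by
  have hd : 0 < ‖x - y‖ := norm_pos_iff.2 (sub_ne_zero.2 h)
  refine min_cubeKernel_le rfl hd fun ht => ?_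
  have h1 : ‖x - y‖ ≤ ‖z - x‖ + ‖z - y‖ := by
    rw [norm_sub_rev z x]; simpa using norm_add_le (x - z) (z - y)
  have h2 : 0 < ‖x - y‖ - ‖z - x‖ := by linarith
  unfold cubeKernel
  gcongr
  linarith

lemma integrable_min_cubeKernel {x y : Plane} (h : x ≠ y) :
    Integrable fun z => min (cubeKernel x z) (cubeKernel y z) := by
  refine Integrable.mono' ((integrable_inv_add_norm_sub_cube x
    (norm_pos_iff.2 (sub_ne_zero.2 h))).const_mul 27)
    ((measurable_cubeKernel x).min (measurable_cubeKernel y)).aestronglyMeasurable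
    (Filter.Eventually.of_forall fun z => ?_)
  rw [Real.norm_of_nonneg (le_min (cubeKernel_nonneg x z) (cubeKernel_nonneg y z))]
  exact min_cubeKernel_cubeKernel_le h z

/-- Superposition of balls yielding the Coulomb potential. -/
lemma exists_coulomb_eq_integral_min_cubeKernel :
    ∃ κ : ℝ, 0 < κ ∧ ∀ x y : Plane, x ≠ y →
      1 / ‖x - y‖ = κ * ∫ z, min (cubeKernel x z) (cubeKernel y z) := by
  set e : Plane := EuclideanSpace.single 0 1 with he
  have hne : ‖e‖ = 1 := by simp [he]
  have he0 : (0 : Plane) ≠ e := fun h => by rw [← h] at hne; simp at hne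
  set J := ∫ z, min (cubeKernel 0 z) (cubeKernel e z) with hJ
  have hJpos : 0 < J := by
    rw [hJ, integral_pos_iff_support_of_nonneg
      (fun z => le_min (cubeKernel_nonneg _ z) (cubeKernel_nonneg _ z))
      (integrable_min_cubeKernel he0)]
    refine lt_of_lt_of_le ?_ (measure_mono (s := ({0, e} : Set Plane)ᶜ) ?_)
    · refine (isOpen_compl_iff.2 (Set.Finite.isClosed (by simp))).measure_pos _ ?_
      refine ⟨(2 : ℝ) • e, ?_⟩
      simp only [Set.mem_compl_iff, Set.mem_insert_iff, Set.mem_singleton_iff, not_or]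
      constructor
      · simpa using he0.symm
      · intro h
        have : ‖(2 : ℝ) • e‖ = ‖e‖ := by rw [h]
        rw [norm_smul, hne] at this
        norm_num at this
    · intro z hz
      simp only [Set.mem_compl_iff, Set.mem_insert_iff, Set.mem_singleton_iff, not_or] at hz
      have h1 : 0 < ‖z - 0‖ := norm_pos_iff.2 (by simpa using hz.1)
      have h2 : 0 < ‖z - e‖ := norm_pos_iff.2 (sub_ne_zero.2 hz.2)
      have : 0 < min (cubeKernel 0 z) (cubeKernel e z) := by
        unfold cubeKernel; exact lt_min (by positivity) (by positivity)
      exact this.ne'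
  refine ⟨J⁻¹, inv_pos.2 hJpos, fun x y hxy => ?_⟩
  have hd : 0 < ‖x - y‖ := norm_pos_iff.2 (sub_ne_zero.2 hxy)
  set d := ‖x - y‖ with hdd
  set v : Plane := d⁻¹ • (y - x) with hv
  have hvn : ‖e‖ = ‖v‖ := by
    rw [hne, hv, norm_smul, norm_sub_rev y x, ← hdd, norm_inv, Real.norm_of_nonneg hd.le,
      inv_mul_cancel₀ hd.ne']
  set T := (ℝ ∙ (e - v))ᗮ.reflection with hT
  have hTe : T e = v := Submodule.reflection_sub hvn
  have hJv : ∫ z, min (cubeKernel 0 z) (cubeKernel v z) = J := by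
    rw [hJ, ← (T.measurePreserving).integral_comp T.toHomeomorph.measurableEmbedding
      (fun z => min (cubeKernel 0 z) (cubeKernel v z))]
    congr 1
    funext z
    simp only [cubeKernel]
    rw [← hTe, ← map_sub, T.norm_map, sub_zero, sub_zero, T.norm_map]
  have key : ∀ z, min (cubeKernel x z) (cubeKernel y z)
      = (d ^ 3)⁻¹ * min (cubeKernel 0 (d⁻¹ • (z - x))) (cubeKernel v (d⁻¹ • (z - x))) := by
    intro z
    rw [mul_min_of_nonneg _ _ (by positivity)]
    have h1 : z - x = d • (d⁻¹ • (z - x) - 0) := by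
      rw [sub_zero, smul_smul, mul_inv_cancel₀ hd.ne', one_smul]
    have h2 : z - y = d • (d⁻¹ • (z - x) - v) := by
      rw [hv, ← smul_sub, smul_smul, mul_inv_cancel₀ hd.ne', one_smul]; abel
    have h3 : ∀ w : Plane, (‖d • w‖ ^ 3)⁻¹ = (d ^ 3)⁻¹ * (‖w‖ ^ 3)⁻¹ := fun w => by
      rw [norm_smul, Real.norm_of_nonneg hd.le, mul_pow, mul_inv]
    unfold cubeKernel
    conv_lhs => rw [h1, h2, h3, h3]
  simp only [key]
  rw [integral_const_mul,
    integral_comp_similarity (fun z => min (cubeKernel 0 z) (cubeKernel v z)) x d, hJv]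
  field_simp

lemma integrable_of_le_cubeKernel (P : Finset Plane) {h : Plane → ℝ}
    (hm : AEStronglyMeasurable h) (h0 : ∀ z, 0 ≤ h z)
    (hh : ∀ z ∉ P, 0 < h z →
      ∃ p ∈ P, ∃ q ∈ P, p ≠ q ∧ h z ≤ cubeKernel p z ∧ h z ≤ cubeKernel q z) :
    Integrable h := by
  classical
  have h_int : Integrable fun z => ∑ p ∈ P, ∑ q ∈ P.erase p,
      min (cubeKernel p z) (cubeKernel q z) :=
    integrable_finsetSum _ fun p _ => integrable_finsetSum _ fun q hq =>
      integrable_min_cubeKernel (Finset.ne_of_mem_erase hq).symm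
  refine h_int.mono' hm ?_
  have hP : ∀ᵐ z : Plane, z ∉ P := by
    have := P.finite_toSet.measure_zero (volume : Measure Plane)
    exact measure_eq_zero_iff_ae_notMem.1 this
  filter_upwards [hP] with z hz
  rw [Real.norm_of_nonneg (h0 z)]
  have hnn : ∀ p q, 0 ≤ min (cubeKernel p z) (cubeKernel q z) := fun p q =>
    le_min (cubeKernel_nonneg p z) (cubeKernel_nonneg q z)
  rcases (h0 z).eq_or_lt with hz0 | hz0
  · rw [← hz0]
    exact Finset.sum_nonneg fun p _ => Finset.sum_nonneg fun q _ => hnn p q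
  · obtain ⟨p, hp, q, hq, hpq, h1, h2⟩ := hh z hz hz0
    calc h z ≤ min (cubeKernel p z) (cubeKernel q z) := le_min h1 h2
      _ ≤ ∑ q ∈ P.erase p, min (cubeKernel p z) (cubeKernel q z) :=
        Finset.single_le_sum (f := fun q => min (cubeKernel p z) (cubeKernel q z))
          (fun q _ => hnn p q) (Finset.mem_erase.2 ⟨hpq.symm, hq⟩)
      _ ≤ _ := Finset.single_le_sum
          (f := fun p => ∑ q ∈ P.erase p, min (cubeKernel p z) (cubeKernel q z))
          (fun p _ => Finset.sum_nonneg fun q _ => hnn p q) hp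

lemma min_cubeKernel_infDist_le (P : Finset Plane) {x : Plane} (hx : x ∉ P)
    (hP : P.Nonempty) (z : Plane) :
    min (cubeKernel x z) ((Metric.infDist z P ^ 3)⁻¹)
      ≤ 27 * ((Metric.infDist x P + ‖z - x‖) ^ 3)⁻¹ := by
  have hd : 0 < Metric.infDist x (P : Set Plane) :=
    (P.finite_toSet.isClosed.notMem_iff_infDist_pos (by simpa using hP)).1 (by simpa using hx)
  refine min_cubeKernel_le rfl hd fun ht => ?_
  have h1 : Metric.infDist x (P : Set Plane) ≤ Metric.infDist z P + ‖z - x‖ := by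
    rw [← dist_eq_norm, dist_comm]; exact Metric.infDist_le_infDist_add_dist
  have h2 : 0 < Metric.infDist x (P : Set Plane) - ‖z - x‖ := by
    linarith [norm_nonneg (z - x)]
  gcongr
  linarith

open scoped Classical in
/-- The Coulomb energy is controlled by the attraction to the nearest nucleus, with a positive
remainder involving the distance to the second nearest nucleus. -/
lemma exists_coulomb_ge :
    ∃ C c : ℝ, 0 < C ∧ 0 < c ∧ ∀ (P : Finset Plane) (Z : ℝ), 1 ≤ Z → ∀ (N : ℕ)
      (x : Fin N → Plane), Function.Injective x → (∀ j, x j ∉ P) →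
      ∀ h : Plane → ℝ, Integrable h → (∀ z, 0 ≤ h z) →
      (∀ z ∉ P, 0 < h z →
        ∃ p ∈ P, ∃ q ∈ P, p ≠ q ∧ h z ≤ cubeKernel p z ∧ h z ≤ cubeKernel q z) →
      1 / 2 * ∑ j, ∑ k ∈ {j}ᶜ, 1 / ‖x j - x k‖ - Z * ∑ j, ∑ p ∈ P, 1 / ‖x j - p‖
        + 1 / 2 * Z ^ 2 * ∑ p ∈ P, ∑ q ∈ P.erase p, 1 / ‖p - q‖
      ≥ -(C * Z * ∑ j, 1 / Metric.infDist (x j) P) + c * Z ^ 2 * ∫ z, h z := by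
  obtain ⟨κ, hκ, hJ⟩ := exists_coulomb_eq_integral_min_cubeKernel
  set G := ∫ z : Plane, ((1 + ‖z‖) ^ 3)⁻¹ with hG
  have hG0 : 0 ≤ G := integral_nonneg fun z => by positivity
  refine ⟨κ * (2 * (27 * G)) + 1, κ / 2, by positivity, by positivity, ?_⟩
  intro P Z hZ N x hx hxP h h_int h0 hh
  have hxne : ∀ j, ∀ k ∈ ({j}ᶜ : Finset (Fin N)), x j ≠ x k := fun j k hk hjk =>
    (by simpa using hk : k ≠ j) (hx hjk).symm
  have hxp : ∀ j, ∀ p ∈ P, x j ≠ p := fun j p hp h => hxP j (h ▸ hp)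
  have hpq : ∀ p, ∀ q ∈ P.erase p, p ≠ q := fun p q hq => (Finset.ne_of_mem_erase hq).symm
  have i1 : Integrable fun z => ∑ j, ∑ k ∈ {j}ᶜ, min (cubeKernel (x j) z) (cubeKernel (x k) z) :=
    integrable_finsetSum _ fun j _ => integrable_finsetSum _ fun k hk =>
      integrable_min_cubeKernel (hxne j k hk)
  have i2 : Integrable fun z => ∑ j, ∑ p ∈ P, min (cubeKernel (x j) z) (cubeKernel p z) :=
    integrable_finsetSum _ fun j _ => integrable_finsetSum _ fun k hk =>
      integrable_min_cubeKernel (hxp j k hk)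
  have i3 : Integrable fun z => ∑ p ∈ P, ∑ q ∈ P.erase p,
      min (cubeKernel p z) (cubeKernel q z) :=
    integrable_finsetSum _ fun j _ => integrable_finsetSum _ fun k hk =>
      integrable_min_cubeKernel (hpq j k hk)
  have e1 : ∑ j, ∑ k ∈ {j}ᶜ, 1 / ‖x j - x k‖
      = κ * ∫ z, ∑ j, ∑ k ∈ {j}ᶜ, min (cubeKernel (x j) z) (cubeKernel (x k) z) := by
    rw [integral_finsetSum _ fun j _ => integrable_finsetSum _ fun k hk =>
      integrable_min_cubeKernel (hxne j k hk), Finset.mul_sum]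
    refine Finset.sum_congr rfl fun j _ => ?_
    rw [integral_finsetSum _ fun k hk => integrable_min_cubeKernel (hxne j k hk),
      Finset.mul_sum]
    exact Finset.sum_congr rfl fun k hk => hJ _ _ (hxne j k hk)
  have e2 : ∑ j, ∑ p ∈ P, 1 / ‖x j - p‖
      = κ * ∫ z, ∑ j, ∑ p ∈ P, min (cubeKernel (x j) z) (cubeKernel p z) := by
    rw [integral_finsetSum _ fun j _ => integrable_finsetSum _ fun k hk =>
      integrable_min_cubeKernel (hxp j k hk), Finset.mul_sum]
    refine Finset.sum_congr rfl fun j _ => ?_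
    rw [integral_finsetSum _ fun k hk => integrable_min_cubeKernel (hxp j k hk),
      Finset.mul_sum]
    exact Finset.sum_congr rfl fun k hk => hJ _ _ (hxp j k hk)
  have e3 : ∑ p ∈ P, ∑ q ∈ P.erase p, 1 / ‖p - q‖
      = κ * ∫ z, ∑ p ∈ P, ∑ q ∈ P.erase p, min (cubeKernel p z) (cubeKernel q z) := by
    rw [integral_finsetSum _ fun j _ => integrable_finsetSum _ fun k hk =>
      integrable_min_cubeKernel (hpq j k hk), Finset.mul_sum]
    refine Finset.sum_congr rfl fun j _ => ?_
    rw [integral_finsetSum _ fun k hk => integrable_min_cubeKernel (hpq j k hk),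
      Finset.mul_sum]
    exact Finset.sum_congr rfl fun k hk => hJ _ _ (hpq j k hk)
  have hB0 : ∀ z, 0 ≤ (Metric.infDist z (P : Set Plane) ^ 3)⁻¹ := fun z =>
    inv_nonneg.2 (pow_nonneg Metric.infDist_nonneg _)
  have i4' : ∀ j, Integrable (fun z => min (cubeKernel (x j) z) ((Metric.infDist z P ^ 3)⁻¹)) ∧
      ∫ z, min (cubeKernel (x j) z) ((Metric.infDist z P ^ 3)⁻¹)
        ≤ 27 * G * (1 / Metric.infDist (x j) P) := by
    intro j
    rcases P.eq_empty_or_nonempty with rfl | hP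
    · have : ∀ z, min (cubeKernel (x j) z) 0 = 0 := fun z => min_eq_right (cubeKernel_nonneg _ _)
      simp [this]
    · have hd : 0 < Metric.infDist (x j) (P : Set Plane) :=
        (P.finite_toSet.isClosed.notMem_iff_infDist_pos (by simpa using hP)).1
          (by simpa using hxP j)
      have hI := (integrable_inv_add_norm_sub_cube (x j) hd).const_mul 27
      have hI' : Integrable
          (fun z => min (cubeKernel (x j) z) ((Metric.infDist z P ^ 3)⁻¹)) := by
        refine hI.mono' ?_ (Filter.Eventually.of_forall fun z => ?_)
        · refine Measurable.aestronglyMeasurable ?_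
          exact (measurable_cubeKernel _).min
            (((Metric.continuous_infDist_pt _).measurable.pow_const 3).inv)
        · rw [Real.norm_of_nonneg (le_min (cubeKernel_nonneg _ z) (hB0 z))]
          exact min_cubeKernel_infDist_le P (hxP j) hP z
      refine ⟨hI', ?_⟩
      calc _ ≤ ∫ z, 27 * ((Metric.infDist (x j) P + ‖z - x j‖) ^ 3)⁻¹ :=
            integral_mono hI' hI fun z => min_cubeKernel_infDist_le P (hxP j) hP z
        _ = 27 * G * (1 / Metric.infDist (x j) P) := by
            rw [integral_const_mul, integral_inv_add_norm_sub_cube _ hd, ← hG]; ring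
  have i4 : Integrable fun z => ∑ j, min (cubeKernel (x j) z) ((Metric.infDist z P ^ 3)⁻¹) :=
    integrable_finsetSum _ fun j _ => (i4' j).1
  have e4 : ∫ z, ∑ j, min (cubeKernel (x j) z) ((Metric.infDist z P ^ 3)⁻¹)
      ≤ 27 * G * ∑ j, 1 / Metric.infDist (x j) P := by
    rw [integral_finsetSum _ fun j _ => (i4' j).1, Finset.mul_sum]
    exact Finset.sum_le_sum fun j _ => (i4' j).2
  have hPae : ∀ᵐ z : Plane, z ∉ P :=
    measure_eq_zero_iff_ae_notMem.1 (P.finite_toSet.measure_zero (volume : Measure Plane))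
  have main := integral_linear_combination_le (a₁ := 1 / 2) (a₂ := Z) (a₃ := 1 / 2 * Z ^ 2)
    (b₁ := -(Z + 1 / 2)) (b₂ := 1 / 2 * Z ^ 2) i1 i2 i3 i4 h_int (by
      filter_upwards [hPae] with z hz
      refine sum_min_ge P (fun j => cubeKernel (x j) z) (fun p => cubeKernel p z) (by linarith)
        (fun j => cubeKernel_nonneg _ _) (fun p => cubeKernel_nonneg _ _) (hB0 z) ?_ (h0 z)
        (hh z hz)
      intro p hp
      have hpos : 0 < Metric.infDist z (P : Set Plane) :=
        (P.finite_toSet.isClosed.notMem_iff_infDist_pos ⟨p, hp⟩).1 (by simpa using hz)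
      have : Metric.infDist z (P : Set Plane) ≤ ‖z - p‖ := by
        rw [← dist_eq_norm]; exact Metric.infDist_le_dist_of_mem (by simpa using hp)
      unfold cubeKernel
      gcongr)
  rw [e1, e2, e3]
  set S := ∑ j, 1 / Metric.infDist (x j) (P : Set Plane)
  have hS : 0 ≤ S := Finset.sum_nonneg fun j _ => one_div_nonneg.2 Metric.infDist_nonneg
  set Y := ∫ z, ∑ j, min (cubeKernel (x j) z) ((Metric.infDist z P ^ 3)⁻¹)
  have hY : (Z + 1 / 2) * Y ≤ 2 * Z * (27 * G * S) := by
    have : (Z + 1 / 2) * Y ≤ (Z + 1 / 2) * (27 * G * S) :=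
      mul_le_mul_of_nonneg_left e4 (by linarith)
    nlinarith [mul_nonneg (mul_nonneg (by norm_num : (0 : ℝ) ≤ 27) hG0) hS]
  have hm := mul_le_mul_of_nonneg_left main hκ.le
  have hY' := mul_le_mul_of_nonneg_left hY hκ.le
  have hZS : 0 ≤ Z * S := mul_nonneg (by linarith) hS
  nlinarith [hm, hY', hZS]

/-! ### Counting particles at a variable length scale -/

lemma measureReal_ball_plane (x : Plane) {r : ℝ} (hr : 0 ≤ r) :
    volume.real (Metric.ball x r) = Real.pi * r ^ 2 := by
  rw [Measure.real, EuclideanSpace.volume_ball_fin_two, ENNReal.toReal_mul, ENNReal.toReal_pow,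
    ENNReal.toReal_ofReal hr]
  simp [mul_comm, Real.pi_nonneg]

/-- A positive length scale in the plane, bounded by `b` and slowly varying. -/
structure IsLengthScale (ℓ : Plane → ℝ) (b : ℝ) : Prop where
  pos : ∀ x, 0 < ℓ x
  le : ∀ x, ℓ x ≤ b
  lip : ∀ x y, ℓ x ≤ ℓ y + ‖x - y‖ / 10

namespace IsLengthScale

variable {ℓ : Plane → ℝ} {b : ℝ}

lemma continuous (h : IsLengthScale ℓ b) : Continuous ℓ := by
  refine (LipschitzWith.of_le_add_mul (1 / 10) fun x y => ?_).continuous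
  have := h.lip x y
  rw [dist_eq_norm]
  push_cast
  linarith

lemma bound_pos (h : IsLengthScale ℓ b) : 0 < b := (h.pos 0).trans_le (h.le 0)

/-- The part of `ℓ⁻³` seen from `x` in balls of radius `c ℓ`. -/
noncomputable def window (ℓ : Plane → ℝ) (c : ℝ) (x z : Plane) : ℝ :=
  if ‖x - z‖ < c * ℓ z then (ℓ z ^ 3)⁻¹ else 0

lemma measurable_window (h : IsLengthScale ℓ b) (c : ℝ) (x : Plane) :
    Measurable (window ℓ c x) := by
  have := h.continuous.measurable
  refine Measurable.ite (measurableSet_lt ?_ ?_) ?_ ?_ <;> fun_prop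

lemma window_nonneg (h : IsLengthScale ℓ b) (c : ℝ) (x z : Plane) : 0 ≤ window ℓ c x z := by
  have := h.pos z
  unfold window; split_ifs <;> positivity

lemma window_seven_le (h : IsLengthScale ℓ b) (x z : Plane) :
    window ℓ 7 x z ≤ (Metric.ball x (24 * ℓ x)).indicator (fun _ => 5 / ℓ x ^ 3) z := by
  have hx := h.pos x
  have hz := h.pos z
  unfold window
  split_ifs with hlt
  · have h1 := h.lip x z
    have h2 := h.lip z x
    rw [norm_sub_rev] at h2
    have hmem : z ∈ Metric.ball x (24 * ℓ x) := by
      rw [Metric.mem_ball, dist_comm, dist_eq_norm]; linarith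
    rw [Set.indicator_of_mem hmem]
    have h3 : (10 / 17) * ℓ x ≤ ℓ z := by linarith
    calc (ℓ z ^ 3)⁻¹ ≤ (((10 / 17) * ℓ x) ^ 3)⁻¹ := by gcongr
      _ = (17 / 10) ^ 3 / ℓ x ^ 3 := by field_simp
      _ ≤ 5 / ℓ x ^ 3 := by gcongr; norm_num
  · exact Set.indicator_nonneg (fun _ _ => by positivity) _

lemma window_one_le_seven (h : IsLengthScale ℓ b) (x z : Plane) :
    window ℓ 1 x z ≤ window ℓ 7 x z := by
  have hz := h.pos z
  unfold window
  split_ifs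
  · exact le_rfl
  · linarith
  · positivity
  · exact le_rfl

lemma integrable_ball_indicator (x : Plane) (r c : ℝ) :
    Integrable ((Metric.ball x r).indicator fun _ => c) :=
  (integrableOn_const (measure_ball_lt_top.ne)).integrable_indicator Metric.isOpen_ball.measurableSet

lemma integrable_window_seven (h : IsLengthScale ℓ b) (x : Plane) :
    Integrable (window ℓ 7 x) := by
  refine (integrable_ball_indicator x (24 * ℓ x) (5 / ℓ x ^ 3)).mono'
    (h.measurable_window 7 x).aestronglyMeasurable (Filter.Eventually.of_forall fun z => ?_)
  rw [Real.norm_of_nonneg (h.window_nonneg 7 x z)]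
  exact h.window_seven_le x z

lemma integrable_window_one (h : IsLengthScale ℓ b) (x : Plane) :
    Integrable (window ℓ 1 x) := by
  refine (h.integrable_window_seven x).mono'
    (h.measurable_window 1 x).aestronglyMeasurable (Filter.Eventually.of_forall fun z => ?_)
  rw [Real.norm_of_nonneg (h.window_nonneg 1 x z)]
  exact h.window_one_le_seven x z

lemma integral_window_seven_le (h : IsLengthScale ℓ b) (x : Plane) :
    ∫ z, window ℓ 7 x z ≤ 10000 * (1 / ℓ x) := by
  have hx := h.pos x
  refine (integral_mono (h.integrable_window_seven x)
    (integrable_ball_indicator x (24 * ℓ x) (5 / ℓ x ^ 3)) (h.window_seven_le x)).trans ?_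
  rw [integral_indicator Metric.isOpen_ball.measurableSet, setIntegral_const,
    measureReal_ball_plane x (by positivity), smul_eq_mul]
  have : Real.pi * (24 * ℓ x) ^ 2 * (5 / ℓ x ^ 3) = (2880 * Real.pi) * (1 / ℓ x) := by
    field_simp; norm_num
  rw [this]
  gcongr
  linarith [Real.pi_lt_d2]

lemma le_integral_window_one (h : IsLengthScale ℓ b) (x : Plane) :
    1 / ℓ x ≤ ∫ z, window ℓ 1 x z := by
  have hx := h.pos x
  refine le_trans ?_ (integral_mono (integrable_ball_indicator x (9 / 10 * ℓ x) (1 / (2 * ℓ x ^ 3)))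
    (h.integrable_window_one x) fun z => ?_)
  · rw [integral_indicator Metric.isOpen_ball.measurableSet, setIntegral_const,
      measureReal_ball_plane x (by positivity), smul_eq_mul]
    have : Real.pi * (9 / 10 * ℓ x) ^ 2 * (1 / (2 * ℓ x ^ 3)) = (81 / 200 * Real.pi) * (1 / ℓ x) := by
      field_simp; norm_num
    rw [this]
    exact le_mul_of_one_le_left (by positivity) (by linarith [Real.pi_gt_d2])
  · by_cases hz : z ∈ Metric.ball x (9 / 10 * ℓ x)
    · rw [Set.indicator_of_mem hz]
      rw [Metric.mem_ball, dist_eq_norm] at hz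
      have h1 := h.lip z x
      have h2 := h.lip x z
      rw [norm_sub_rev] at h2
      have hz0 := h.pos z
      rw [window, if_pos (by rw [norm_sub_rev]; linarith), one_div]
      gcongr
      calc ℓ z ^ 3 ≤ (109 / 100 * ℓ x) ^ 3 := by gcongr; linarith
        _ ≤ 2 * ℓ x ^ 3 := by rw [mul_pow]; gcongr; norm_num
    · rw [Set.indicator_of_notMem hz]
      exact h.window_nonneg 1 x z

end IsLengthScale

section Counting

variable {N : ℕ}

/-- The midpoint of the particles `j` and `k`. -/
noncomputable def pairMid (x : Fin N → Plane) (j k : Fin N) : Plane := (2⁻¹ : ℝ) • (x j + x k)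

lemma sub_pairMid_left (x : Fin N → Plane) (j k : Fin N) :
    x j - pairMid x j k = (2⁻¹ : ℝ) • (x j - x k) := by
  unfold pairMid; module

lemma sub_pairMid_right (x : Fin N → Plane) (j k : Fin N) :
    x k - pairMid x j k = -((2⁻¹ : ℝ) • (x j - x k)) := by
  unfold pairMid; module

lemma norm_sub_pairMid_left (x : Fin N → Plane) (j k : Fin N) :
    ‖x j - pairMid x j k‖ = ‖x j - x k‖ / 2 := by
  rw [sub_pairMid_left, norm_smul]; norm_num; ring

/-- The number of particles at distance less than `r` from `z`. -/
noncomputable def ballCount (x : Fin N → Plane) (r : ℝ) (z : Plane) : ℝ :=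
  ∑ l, if ‖x l - z‖ < r then 1 else 0

lemma ballCount_nonneg (x : Fin N → Plane) (r : ℝ) (z : Plane) : 0 ≤ ballCount x r z :=
  Finset.sum_nonneg fun _ _ => by split_ifs <;> norm_num

lemma one_le_ballCount {x : Fin N → Plane} {r : ℝ} {z : Plane} {j : Fin N}
    (h : ‖x j - z‖ < r) : 1 ≤ ballCount x r z := by
  refine le_trans ?_ (Finset.single_le_sum (f := fun l => if ‖x l - z‖ < r then (1 : ℝ) else 0)
    (fun _ _ => by split_ifs <;> norm_num) (Finset.mem_univ j))
  simp [h]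

lemma ballCount_mono {x : Fin N → Plane} {r s : ℝ} {z w : Plane}
    (h : ∀ l, ‖x l - z‖ < r → ‖x l - w‖ < s) : ballCount x r z ≤ ballCount x s w := by
  refine Finset.sum_le_sum fun l _ => ?_
  by_cases h1 : ‖x l - z‖ < r
  · simp [h1, h l h1]
  · simp only [h1, if_false]; split_ifs <;> norm_num

/-- The weight of a pair of close particles, normalized by the number of particles nearby. -/
noncomputable def pairWeight (ℓ : Plane → ℝ) (x : Fin N → Plane) (j k : Fin N) : ℝ :=
  if ‖x j - x k‖ ≤ 5 / 2 * ℓ (pairMid x j k) then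
    (ballCount x (5 * ℓ (pairMid x j k)) (pairMid x j k) * ℓ (pairMid x j k) ^ 2)⁻¹ else 0

namespace IsLengthScale

variable {ℓ : Plane → ℝ} {b : ℝ}

lemma pairWeight_nonneg (x : Fin N → Plane) (j k : Fin N) :
    0 ≤ pairWeight ℓ x j k := by
  have := ballCount_nonneg x (5 * ℓ (pairMid x j k)) (pairMid x j k)
  unfold pairWeight; split_ifs <;> positivity

lemma sum_pairWeight_mul_sq_le (h : IsLengthScale ℓ b) (x : Fin N → Plane) (j : Fin N) :
    ∑ k, pairWeight ℓ x j k * ‖x j - x k‖ ^ 2 ≤ 25 / 4 := by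
  classical
  set S : Finset (Fin N) := {k | ‖x j - x k‖ ≤ 5 / 2 * ℓ (pairMid x j k)} with hS
  have hmem : ∀ k, k ∈ S ↔ ‖x j - x k‖ ≤ 5 / 2 * ℓ (pairMid x j k) := by simp [hS]
  have hcomp : ∀ k ∈ S, ℓ (pairMid x j k) ≤ ℓ (x j) / (7 / 8) ∧
      ℓ (x j) / (9 / 8) ≤ ℓ (pairMid x j k) := by
    intro k hk
    have h1 := h.lip (x j) (pairMid x j k)
    have h2 := h.lip (pairMid x j k) (x j)
    rw [norm_sub_rev] at h2
    rw [norm_sub_pairMid_left] at h1 h2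
    have := (hmem k).1 hk
    constructor <;> linarith
  have hcount : ∀ k ∈ S, (S.card : ℝ) ≤ ballCount x (5 * ℓ (pairMid x j k)) (pairMid x j k) := by
    intro k hk
    have : (S.card : ℝ) = ∑ l, if l ∈ S then (1 : ℝ) else 0 := by simp
    rw [this]
    refine Finset.sum_le_sum fun l _ => ?_
    by_cases hl : l ∈ S
    · have hd : ‖x l - pairMid x j k‖ < 5 * ℓ (pairMid x j k) := by
        have h1 : ‖x l - pairMid x j k‖ ≤ ‖x j - x l‖ + ‖x j - pairMid x j k‖ := by
          rw [norm_sub_rev (x j) (x l)]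
          exact norm_sub_le_norm_sub_add_norm_sub _ _ _
        rw [norm_sub_pairMid_left] at h1
        have := (hmem k).1 hk
        have := (hmem l).1 hl
        have := (hcomp l hl).1
        have := (hcomp k hk).2
        have := h.pos (x j)
        linarith
      simp [hl, hd]
    · simp only [hl, if_false]; split_ifs <;> norm_num
  have hterm : ∀ k, pairWeight ℓ x j k * ‖x j - x k‖ ^ 2 ≤
      if k ∈ S then 25 / 4 * (S.card : ℝ)⁻¹ else 0 := by
    intro k
    by_cases hk : k ∈ S
    · have hk' := (hmem k).1 hk
      have hc := hcount k hk
      have hp : 0 < (S.card : ℝ) := by exact_mod_cast Finset.card_pos.2 ⟨k, hk⟩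
      have hl := h.pos (pairMid x j k)
      rw [if_pos hk, pairWeight, if_pos hk']
      calc _ ≤ ((S.card : ℝ) * ℓ (pairMid x j k) ^ 2)⁻¹ * (5 / 2 * ℓ (pairMid x j k)) ^ 2 := by
            gcongr
        _ = 25 / 4 * (S.card : ℝ)⁻¹ := by field_simp; norm_num
    · rw [if_neg hk, pairWeight, if_neg (fun h' => hk ((hmem k).2 h'))]; simp
  refine (Finset.sum_le_sum fun k _ => hterm k).trans ?_
  rw [Finset.sum_ite_mem, Finset.univ_inter, Finset.sum_const, nsmul_eq_mul]
  rcases Nat.eq_zero_or_pos S.card with h0 | h0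
  · simp [h0]; norm_num
  · have : (S.card : ℝ) ≠ 0 := by positivity
    field_simp; rfl

lemma near_pair (h : IsLengthScale ℓ b) {x : Fin N → Plane} {j k : Fin N} {z : Plane}
    (hj : ‖x j - z‖ < 1 * ℓ z) (hk : ‖x k - z‖ < 1 * ℓ z) :
    (ballCount x (7 * ℓ z) z)⁻¹ ≤ pairWeight ℓ x j k * ℓ (pairMid x j k) ^ 2 := by
  have hX : ‖pairMid x j k - z‖ ≤ ℓ z := by
    have : pairMid x j k - z = (2⁻¹ : ℝ) • (x j - z) + (2⁻¹ : ℝ) • (x k - z) := by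
      unfold pairMid; module
    rw [this]
    refine (norm_add_le _ _).trans ?_
    rw [norm_smul, norm_smul]; norm_num; linarith
  have h1 := h.lip z (pairMid x j k)
  have h2 := h.lip (pairMid x j k) z
  rw [norm_sub_rev] at h1
  have hz := h.pos z
  have hXp := h.pos (pairMid x j k)
  have hjk : ‖x j - x k‖ ≤ ‖x j - z‖ + ‖x k - z‖ := by
    rw [norm_sub_rev (x k) z]; exact norm_sub_le_norm_sub_add_norm_sub _ _ _
  have hedge : ‖x j - x k‖ ≤ 5 / 2 * ℓ (pairMid x j k) := by linarith
  have hpos : 0 < ballCount x (5 * ℓ (pairMid x j k)) (pairMid x j k) := by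
    refine zero_lt_one.trans_le (one_le_ballCount (j := j) ?_)
    rw [norm_sub_pairMid_left]; linarith
  rw [pairWeight, if_pos hedge, mul_inv, mul_assoc, inv_mul_cancel₀ (by positivity), mul_one]
  gcongr
  refine ballCount_mono fun l hl => ?_
  have := norm_sub_le_norm_sub_add_norm_sub (x l) (pairMid x j k) z
  linarith

lemma window_combination_le (h : IsLengthScale ℓ b) (x : Fin N → Plane) (ε : ℝ) (z : Plane) :
    2 * ε * ∑ j, window ℓ 1 (x j) z - ε ^ 2 * ∑ j, window ℓ 7 (x j) z ≤
      ∑ j, ∑ k ∈ {j}ᶜ, (pairWeight ℓ x j k * ℓ (pairMid x j k) ^ 2) * window ℓ 7 (x j) z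
        + {z | ℓ z < b}.indicator (fun z => (ℓ z ^ 3)⁻¹) z
        + ∑ j, (Metric.ball (x j) b).indicator (fun _ => (b ^ 3)⁻¹) z := by
  classical
  have hz := h.pos z
  have hb := h.bound_pos
  have hw : ∀ c, ∑ j, window ℓ c (x j) z = (ℓ z ^ 3)⁻¹ * ballCount x (c * ℓ z) z := by
    intro c
    rw [ballCount, Finset.mul_sum]
    refine Finset.sum_congr rfl fun j _ => ?_
    unfold window; split_ifs <;> simp
  set n := ballCount x (1 * ℓ z) z with hn
  set n' := ballCount x (7 * ℓ z) z with hn'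
  have hn0 : 0 ≤ n := ballCount_nonneg _ _ _
  have hnn : n ≤ n' := ballCount_mono fun l hl => by linarith
  have hpair : (ℓ z ^ 3)⁻¹ * ((n ^ 2 - n) * n'⁻¹) ≤
      ∑ j, ∑ k ∈ {j}ᶜ, (pairWeight ℓ x j k * ℓ (pairMid x j k) ^ 2) * window ℓ 7 (x j) z := by
    have hsq : n ^ 2 - n = ∑ j, ∑ k ∈ {j}ᶜ, (if ‖x j - z‖ < 1 * ℓ z then (1 : ℝ) else 0) *
        (if ‖x k - z‖ < 1 * ℓ z then (1 : ℝ) else 0) := by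
      have h1 : ∀ j, ∑ k ∈ {j}ᶜ, (if ‖x j - z‖ < 1 * ℓ z then (1 : ℝ) else 0) *
        (if ‖x k - z‖ < 1 * ℓ z then (1 : ℝ) else 0) =
          (if ‖x j - z‖ < 1 * ℓ z then (1 : ℝ) else 0) * n -
            (if ‖x j - z‖ < 1 * ℓ z then (1 : ℝ) else 0) := by
        intro j
        rw [← Finset.mul_sum, hn, ballCount, ← Finset.sum_compl_add_sum {j},
          Finset.sum_singleton]
        split_ifs <;> ring
      rw [Finset.sum_congr rfl fun j _ => h1 j, Finset.sum_sub_distrib, ← Finset.sum_mul]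
      change n ^ 2 - n = n * n - n
      ring
    rw [hsq, Finset.sum_mul, Finset.mul_sum]
    refine Finset.sum_le_sum fun j _ => ?_
    rw [Finset.sum_mul, Finset.mul_sum]
    refine Finset.sum_le_sum fun k _ => ?_
    have hR : 0 ≤ (pairWeight ℓ x j k * ℓ (pairMid x j k) ^ 2) * window ℓ 7 (x j) z :=
      mul_nonneg (mul_nonneg (pairWeight_nonneg _ _ _) (sq_nonneg _)) (h.window_nonneg _ _ _)
    by_cases hj : ‖x j - z‖ < 1 * ℓ z
    · by_cases hk : ‖x k - z‖ < 1 * ℓ z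
      · have := h.near_pair hj hk
        rw [window, if_pos hj, if_pos hk, one_mul, one_mul, mul_comm,
          if_pos (show ‖x j - z‖ < 7 * ℓ z by linarith)]
        gcongr
      · rw [if_neg hk, mul_zero, zero_mul, mul_zero]; exact hR
    · rw [if_neg hj, zero_mul, zero_mul, mul_zero]; exact hR
  have hone : (ℓ z ^ 3)⁻¹ * (n * n'⁻¹) ≤ {z | ℓ z < b}.indicator (fun z => (ℓ z ^ 3)⁻¹) z
        + ∑ j, (Metric.ball (x j) b).indicator (fun _ => (b ^ 3)⁻¹) z := by
    have hI : 0 ≤ {z | ℓ z < b}.indicator (fun z => (ℓ z ^ 3)⁻¹) z :=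
      Set.indicator_nonneg (fun y _ => by have := h.pos y; positivity) _
    have hJ : ∀ j ∈ Finset.univ, 0 ≤ (Metric.ball (x j) b).indicator (fun _ => (b ^ 3)⁻¹) z :=
      fun j _ => Set.indicator_nonneg (fun y _ => by positivity) _
    have hle : (ℓ z ^ 3)⁻¹ * (n * n'⁻¹) ≤ (ℓ z ^ 3)⁻¹ := by
      refine mul_le_of_le_one_right (by positivity) ?_
      rw [← div_eq_mul_inv]
      exact div_le_one_of_le₀ hnn (hn0.trans hnn)
    rcases (h.le z).lt_or_eq with hlt | heq
    · rw [Set.indicator_of_mem (show z ∈ {z | ℓ z < b} from hlt)]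
      linarith [Finset.sum_nonneg hJ]
    · by_cases hex : ∃ j, ‖x j - z‖ < 1 * ℓ z
      · obtain ⟨j, hj⟩ := hex
        have hmem : z ∈ Metric.ball (x j) b := by
          rw [Metric.mem_ball, dist_comm, dist_eq_norm]; linarith
        have := Finset.single_le_sum hJ (Finset.mem_univ j)
        rw [Set.indicator_of_mem hmem] at this
        rw [heq] at hle ⊢
        linarith
      · push Not at hex
        have : n = 0 := Finset.sum_eq_zero fun j _ => if_neg (not_lt.2 (hex j))
        rw [this]
        simp only [zero_mul, mul_zero]
        exact add_nonneg hI (Finset.sum_nonneg hJ)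
  have hmain : 2 * ε * n - ε ^ 2 * n' ≤ (n ^ 2 - n) * n'⁻¹ + n * n'⁻¹ := by
    rcases (hn0.trans hnn).eq_or_lt with h0 | h0
    · have : n = 0 := by linarith
      simp [this, ← h0]
    · have : (n ^ 2 - n) * n'⁻¹ + n * n'⁻¹ - (2 * ε * n - ε ^ 2 * n') = (n - ε * n') ^ 2 / n' := by
        field_simp; ring
      have h2 : 0 ≤ (n - ε * n') ^ 2 / n' := by positivity
      linarith
  rw [hw, hw]
  have := mul_le_mul_of_nonneg_left hmain (show 0 ≤ (ℓ z ^ 3)⁻¹ by positivity)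
  calc _ = (ℓ z ^ 3)⁻¹ * (2 * ε * n - ε ^ 2 * n') := by ring
    _ ≤ _ := by linarith

lemma pairWeight_mul_sq_div_le (h : IsLengthScale ℓ b) (x : Fin N → Plane) (j k : Fin N) :
    (pairWeight ℓ x j k * ℓ (pairMid x j k) ^ 2) * (1 / ℓ (x j)) ≤ 2 * b * pairWeight ℓ x j k := by
  by_cases hE : ‖x j - x k‖ ≤ 5 / 2 * ℓ (pairMid x j k)
  · have hw := pairWeight_nonneg (ℓ := ℓ) x j k
    have h2 := h.lip (pairMid x j k) (x j)
    rw [norm_sub_rev, norm_sub_pairMid_left] at h2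
    have hX := h.pos (pairMid x j k)
    have hj := h.pos (x j)
    have hq : ℓ (pairMid x j k) / ℓ (x j) ≤ 2 := by
      rw [div_le_iff₀ hj]; linarith
    calc _ = pairWeight ℓ x j k * (ℓ (pairMid x j k) * (ℓ (pairMid x j k) / ℓ (x j))) := by
          ring
      _ ≤ pairWeight ℓ x j k * (b * 2) := by
          gcongr
          · exact h.bound_pos.le
          · exact h.le _
      _ = _ := by ring
  · simp [pairWeight, if_neg hE]

/-- Exclusion principle: close particles are penalized by the pair weights. -/
lemma sum_inv_le (h : IsLengthScale ℓ b) (x : Fin N → Plane)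
    (hI : IntegrableOn (fun z => (ℓ z ^ 3)⁻¹) {z | ℓ z < b}) :
    ∑ j, 1 / ℓ (x j) ≤ 200000000 * (b * ∑ j, ∑ k ∈ {j}ᶜ, pairWeight ℓ x j k
      + (∫ z in {z | ℓ z < b}, (ℓ z ^ 3)⁻¹) + N / b) := by
  have hms : MeasurableSet {z | ℓ z < b} :=
    (isOpen_lt h.continuous continuous_const).measurableSet
  have hb := h.bound_pos
  have i1 : ∀ j, Integrable (window ℓ 1 (x j)) := fun j => h.integrable_window_one _
  have i7 : ∀ j, Integrable (window ℓ 7 (x j)) := fun j => h.integrable_window_seven _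
  have iI := hI.integrable_indicator hms
  have iB : ∀ j, Integrable ((Metric.ball (x j) b).indicator fun _ => (b ^ 3)⁻¹) :=
    fun j => integrable_ball_indicator _ _ _
  set ε : ℝ := 1 / 10000 with hε
  have key := integral_mono (μ := volume)
    (f := fun z => 2 * ε * ∑ j, window ℓ 1 (x j) z - ε ^ 2 * ∑ j, window ℓ 7 (x j) z)
    (g := fun z => ∑ j, ∑ k ∈ {j}ᶜ, (pairWeight ℓ x j k * ℓ (pairMid x j k) ^ 2) *
        window ℓ 7 (x j) z
        + {z | ℓ z < b}.indicator (fun z => (ℓ z ^ 3)⁻¹) z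
        + ∑ j, (Metric.ball (x j) b).indicator (fun _ => (b ^ 3)⁻¹) z)
    (by fun_prop) (by fun_prop) (fun z => h.window_combination_le x ε z)
  rw [integral_sub (by fun_prop) (by fun_prop), integral_const_mul, integral_const_mul,
    integral_finsetSum _ (fun j _ => i1 j), integral_finsetSum _ (fun j _ => i7 j),
    integral_add (by fun_prop) (by fun_prop), integral_add (by fun_prop) (by fun_prop),
    integral_finsetSum _ (fun j _ => by fun_prop), integral_indicator hms,
    integral_finsetSum _ (fun j _ => iB j)] at key
  have e1 : ∑ j, 1 / ℓ (x j) ≤ ∑ j, ∫ z, window ℓ 1 (x j) z :=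
    Finset.sum_le_sum fun j _ => h.le_integral_window_one _
  have e7 : ∑ j, ∫ z, window ℓ 7 (x j) z ≤ 10000 * ∑ j, 1 / ℓ (x j) := by
    rw [Finset.mul_sum]
    exact Finset.sum_le_sum fun j _ => h.integral_window_seven_le _
  have eP : ∑ j, ∫ z, ∑ k ∈ {j}ᶜ, (pairWeight ℓ x j k * ℓ (pairMid x j k) ^ 2) *
        window ℓ 7 (x j) z ≤ 20000 * (b * ∑ j, ∑ k ∈ {j}ᶜ, pairWeight ℓ x j k) := by
    rw [Finset.mul_sum, Finset.mul_sum]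
    refine Finset.sum_le_sum fun j _ => ?_
    rw [integral_finsetSum _ (fun k _ => by fun_prop), Finset.mul_sum, Finset.mul_sum]
    refine Finset.sum_le_sum fun k _ => ?_
    rw [integral_const_mul]
    have hw : 0 ≤ pairWeight ℓ x j k * ℓ (pairMid x j k) ^ 2 :=
      mul_nonneg (pairWeight_nonneg _ _ _) (sq_nonneg _)
    have h1 := mul_le_mul_of_nonneg_left (h.integral_window_seven_le (x j)) hw
    have h2 := h.pairWeight_mul_sq_div_le x j k
    calc _ ≤ _ := h1
      _ = 10000 * ((pairWeight ℓ x j k * ℓ (pairMid x j k) ^ 2) * (1 / ℓ (x j))) := by ring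
      _ ≤ 10000 * (2 * b * pairWeight ℓ x j k) := by gcongr
      _ = _ := by ring
  have eB : ∑ j : Fin N, ∫ z, (Metric.ball (x j) b).indicator (fun _ => (b ^ 3)⁻¹) z
      ≤ 4 * (N / b) := by
    have : ∀ j : Fin N, ∫ z, (Metric.ball (x j) b).indicator (fun _ => (b ^ 3)⁻¹) z
        = Real.pi * b⁻¹ := by
      intro j
      rw [integral_indicator Metric.isOpen_ball.measurableSet, setIntegral_const,
        measureReal_ball_plane _ hb.le, smul_eq_mul]
      field_simp
    rw [Finset.sum_congr rfl fun j _ => this j, Finset.sum_const, nsmul_eq_mul, Finset.card_univ,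
      Fintype.card_fin]
    have : (0:ℝ) ≤ N / b := by positivity
    calc (N : ℝ) * (Real.pi * b⁻¹) = Real.pi * (N / b) := by ring
      _ ≤ _ := by gcongr; exact Real.pi_lt_four.le
  have hI0 : 0 ≤ ∫ z in {z | ℓ z < b}, (ℓ z ^ 3)⁻¹ :=
    integral_nonneg fun z => by have := h.pos z; positivity
  have hN0 : (0:ℝ) ≤ N / b := by positivity
  have hP0 : 0 ≤ b * ∑ j, ∑ k ∈ {j}ᶜ, pairWeight ℓ x j k :=
    mul_nonneg hb.le (Finset.sum_nonneg fun j _ => Finset.sum_nonneg fun k _ =>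
      pairWeight_nonneg _ _ _)
  rw [hε] at key
  norm_num at key e1 e7 eP eB hI0 hN0 hP0 ⊢
  linarith

end IsLengthScale

end Counting

/-! ### Magnetic Hardy inequality on a circle -/

lemma hasDerivAt_integral_of_continuous {E : Type*} [NormedAddCommGroup E] [NormedSpace ℝ E]
    [CompleteSpace E] {L : ℝ → E} (hL : Continuous L) (t : ℝ) :
    HasDerivAt (fun s => ∫ u in (0 : ℝ)..s, L u) (L t) t :=
  intervalIntegral.integral_hasDerivAt_right (hL.intervalIntegrable _ _)
    hL.stronglyMeasurable.stronglyMeasurableAtFilter hL.continuousAt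

lemma eq_mul_exp_integral {p L : ℝ → ℂ} (hL : Continuous L)
    (hp : ∀ t, HasDerivAt p (L t * p t) t) (t : ℝ) :
    p t = p 0 * Complex.exp (∫ u in (0 : ℝ)..t, L u) := by
  have hd : ∀ s, HasDerivAt (fun s => p s * Complex.exp (-∫ u in (0 : ℝ)..s, L u)) 0 s := by
    intro s
    exact ((hp s).mul (hasDerivAt_integral_of_continuous hL s).neg.cexp).congr_deriv (by ring)
  have := is_const_of_deriv_eq_zero (fun s => (hd s).differentiableAt) (fun s => (hd s).deriv) t 0
  simp only [intervalIntegral.integral_same, neg_zero, Complex.exp_zero, mul_one] at this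
  rw [← this, mul_assoc, ← Complex.exp_add]
  simp

/-- The winding number of `θ ↦ (c + e^{iθ}ρ)(c - e^{iθ}ρ)` over half a turn is an integer. -/
lemma exists_winding {c ρ : ℂ} (h1 : ∀ θ : ℝ, c + Complex.exp (θ * Complex.I) * ρ ≠ 0)
    (h2 : ∀ θ : ℝ, c - Complex.exp (θ * Complex.I) * ρ ≠ 0) :
    ∃ q : ℤ, ∫ θ in (0 : ℝ)..Real.pi,
      ((Complex.exp (θ * Complex.I) * ρ / (c + Complex.exp (θ * Complex.I) * ρ)).re
        - (Complex.exp (θ * Complex.I) * ρ / (c - Complex.exp (θ * Complex.I) * ρ)).re)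
      = 2 * Real.pi * q := by
  set r : ℝ → ℂ := fun θ => Complex.exp (θ * Complex.I) * ρ with hr
  have hrd : ∀ θ, HasDerivAt r (Complex.I * r θ) θ := by
    intro θ
    have : HasDerivAt (fun t : ℝ => (t : ℂ) * Complex.I) Complex.I θ := by
      simpa using (Complex.ofRealCLM.hasDerivAt (x := θ)).mul_const Complex.I
    exact (this.cexp.mul_const ρ).congr_deriv (by simp only [hr]; ring)
  have hrc : Continuous r := by fun_prop
  set L : ℝ → ℂ := fun θ => Complex.I * (r θ / (c + r θ) - r θ / (c - r θ)) with hLdef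
  have hLc : Continuous L :=
    continuous_const.mul ((hrc.div (continuous_const.add hrc) h1).sub
      (hrc.div (continuous_const.sub hrc) h2))
  have hp : ∀ t, HasDerivAt (fun θ => (c + r θ) * (c - r θ)) (L t * ((c + r t) * (c - r t))) t := by
    intro t
    refine (((hrd t).const_add c).mul ((hrd t).const_sub c)).congr_deriv ?_
    have h1' : c + r t ≠ 0 := h1 t
    have h2' : c - r t ≠ 0 := h2 t
    simp only [hLdef]
    field_simp
    ring
  have hpi := eq_mul_exp_integral hLc hp Real.pi
  have hrpi : r Real.pi = - r 0 := by simp [hr, Complex.exp_pi_mul_I]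
  rw [hrpi] at hpi
  have hne : (c + r 0) * (c - r 0) ≠ 0 := mul_ne_zero (h1 0) (h2 0)
  have hexp : Complex.exp (∫ u in (0 : ℝ)..Real.pi, L u) = 1 := by
    have : (c + r 0) * (c - r 0) * Complex.exp (∫ u in (0 : ℝ)..Real.pi, L u)
        = (c + r 0) * (c - r 0) * 1 := by rw [← hpi]; ring
    exact mul_left_cancel₀ hne this
  obtain ⟨q, hq⟩ := Complex.exp_eq_one_iff.1 hexp
  refine ⟨q, ?_⟩
  have him : (∫ u in (0 : ℝ)..Real.pi, L u).im = ∫ u in (0 : ℝ)..Real.pi, (L u).im := by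
    have := Complex.imCLM.intervalIntegral_comp_comm (hLc.intervalIntegrable (μ := volume) 0 Real.pi)
    simpa using this.symm
  have hL : ∀ θ, (L θ).im = (r θ / (c + r θ)).re - (r θ / (c - r θ)).re := by
    intro θ
    simp [hLdef]
  change ∫ θ in (0 : ℝ)..Real.pi, ((r θ / (c + r θ)).re - (r θ / (c - r θ)).re) = _
  rw [← intervalIntegral.integral_congr fun θ _ => hL θ, ← him, hq]
  simp
  ring

lemma two_div_le_norm_exp_sub_one {M : ℤ} (hM : Odd M) {ν : ℕ} (hν : 0 < ν) :
    2 / (ν : ℝ) ≤ ‖Complex.exp (Complex.I * ((Real.pi * (M / ν) : ℝ) : ℂ)) - 1‖ := by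
  have hpi := Real.pi_pos
  have hνp : (0 : ℝ) < ν := by exact_mod_cast hν
  rw [Complex.norm_exp_I_mul_ofReal_sub_one]
  set n : ℤ := round ((M : ℝ) / (2 * ν)) with hn
  have hround := abs_sub_round ((M : ℝ) / (2 * ν))
  rw [← hn] at hround
  set y : ℝ := Real.pi * (M / ν) / 2 - n * Real.pi with hy
  have hsin : |Real.sin y| = |Real.sin (Real.pi * (M / ν) / 2)| := by
    rw [hy, Real.sin_sub_int_mul_pi, abs_mul, abs_zpow, abs_neg, abs_one, one_zpow, one_mul]
  have hy' : y = Real.pi * ((M : ℝ) / (2 * ν) - n) := by rw [hy]; field_simp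
  have hyabs : |y| = Real.pi * |(M : ℝ) / (2 * ν) - n| := by
    rw [hy', abs_mul, abs_of_pos hpi]
  have hle : |y| ≤ Real.pi / 2 := by
    rw [hyabs]; nlinarith
  have h1 := Real.mul_abs_le_abs_sin hle
  have hodd : (1 : ℝ) ≤ |(M : ℝ) - 2 * ν * n| := by
    have : M - 2 * ν * n ≠ 0 := by
      obtain ⟨t, rfl⟩ := hM
      intro h0
      have : 2 * ((ν : ℤ) * n - t) = 1 := by linarith
      omega
    have := Int.one_le_abs this
    exact_mod_cast this
  have h2 : |(M : ℝ) / (2 * ν) - n| = |(M : ℝ) - 2 * ν * n| / (2 * ν) := by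
    rw [show (M : ℝ) / (2 * ν) - n = ((M : ℝ) - 2 * ν * n) / (2 * ν) by field_simp, abs_div,
      abs_of_pos (show (0 : ℝ) < 2 * ν by positivity)]
  rw [norm_mul, Real.norm_eq_abs, Real.norm_eq_abs, abs_of_pos (zero_lt_two' ℝ), ← hsin]
  have h3 : 1 / (ν : ℝ) ≤ 2 / Real.pi * |y| := by
    rw [hyabs, h2]
    calc 1 / (ν : ℝ) ≤ |(M : ℝ) - 2 * ν * n| / ν := by gcongr
      _ = _ := by field_simp
  calc 2 / (ν : ℝ) = 2 * (1 / ν) := by ring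
    _ ≤ _ := by linarith

/-- A function on an interval which vanishes somewhere is controlled by its gauge-covariant
derivative. -/
lemma integral_norm_sq_le_of_vanish {f F : ℝ → ℂ} {A : ℝ → ℝ}
    (hf : ∀ θ, HasDerivAt f (Complex.I * (F θ - A θ * f θ)) θ) (hF : Continuous F)
    {θ₀ : ℝ} (hθ₀ : θ₀ ∈ Set.Icc 0 Real.pi) (h0 : f θ₀ = 0) :
    ∫ θ in (0 : ℝ)..Real.pi, ‖f θ‖ ^ 2 ≤
      4 * Real.pi ^ 2 * ∫ θ in (0 : ℝ)..Real.pi, ‖F θ‖ ^ 2 := by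
  have hpi := Real.pi_pos
  have hfc : Continuous f := continuous_iff_continuousAt.2 fun θ => (hf θ).continuousAt
  obtain ⟨θ₁, hθ₁, hmax⟩ := isCompact_Icc.exists_isMaxOn (Set.nonempty_Icc.2 hpi.le)
    (f := fun θ => ‖f θ‖ ^ 2) (by fun_prop : Continuous fun θ => ‖f θ‖ ^ 2).continuousOn
  set M := ‖f θ₁‖ ^ 2 with hM
  set a := ∫ θ in (0 : ℝ)..Real.pi, ‖F θ‖ ^ 2 with ha
  have hder : ∀ θ, HasDerivAt (fun t => ‖f t‖ ^ 2) (2 * (Complex.I * F θ * starRingEnd ℂ (f θ)).re) θ := by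
    intro θ
    have := (hf θ).norm_sq
    convert this using 1
    rw [Complex.inner]
    simp [Complex.mul_re, Complex.mul_im]
    ring
  have hbound : ∀ θ ∈ Set.Icc 0 Real.pi, ‖2 * (Complex.I * F θ * starRingEnd ℂ (f θ)).re‖ ≤
      M / (2 * Real.pi) + 2 * Real.pi * ‖F θ‖ ^ 2 := by
    intro θ hθ
    have h1 : |(Complex.I * F θ * starRingEnd ℂ (f θ)).re| ≤ ‖F θ‖ * ‖f θ‖ := by
      refine (Complex.abs_re_le_norm _).trans ?_
      simp
    have h2 : ‖f θ‖ ^ 2 / (2 * Real.pi) ≤ M / (2 * Real.pi) := by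
      gcongr; exact hmax hθ
    have h3 : 2 * (‖F θ‖ * ‖f θ‖) ≤ ‖f θ‖ ^ 2 / (2 * Real.pi) + 2 * Real.pi * ‖F θ‖ ^ 2 := by
      have : ‖f θ‖ ^ 2 / (2 * Real.pi) + 2 * Real.pi * ‖F θ‖ ^ 2 - 2 * (‖F θ‖ * ‖f θ‖)
        = (‖f θ‖ - 2 * Real.pi * ‖F θ‖) ^ 2 / (2 * Real.pi) := by field_simp; ring
      have h4 : 0 ≤ (‖f θ‖ - 2 * Real.pi * ‖F θ‖) ^ 2 / (2 * Real.pi) := by positivity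
      linarith
    rw [norm_mul, Real.norm_eq_abs, Real.norm_eq_abs]
    rw [abs_of_pos (zero_lt_two' ℝ)]
    linarith
  have hgc : Continuous fun θ => 2 * (Complex.I * F θ * starRingEnd ℂ (f θ)).re := by
    have : Continuous fun θ => starRingEnd ℂ (f θ) := Complex.continuous_conj.comp hfc
    fun_prop
  have hMle : M ≤ M / 2 + 2 * Real.pi * a := by
    have h1 := intervalIntegral.integral_eq_sub_of_hasDerivAt (a := θ₀) (b := θ₁)
      (fun θ _ => hder θ) (hgc.intervalIntegrable _ _)
    simp only [h0, norm_zero] at h1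
    have h2 : M ≤ ‖∫ θ in θ₀..θ₁, 2 * (Complex.I * F θ * starRingEnd ℂ (f θ)).re‖ := by
      rw [h1, Real.norm_eq_abs]
      refine le_trans ?_ (le_abs_self _)
      simp [hM]
    have hsub : Set.uIoc θ₀ θ₁ ⊆ Set.Ioc 0 Real.pi := by
      intro θ hθ
      rw [Set.uIoc, Set.mem_Ioc] at hθ
      exact ⟨(le_inf hθ₀.1 hθ₁.1).trans_lt hθ.1, hθ.2.trans (sup_le hθ₀.2 hθ₁.2)⟩
    have hc2 : Continuous fun θ => M / (2 * Real.pi) + 2 * Real.pi * ‖F θ‖ ^ 2 := by fun_prop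
    have h3 : ‖∫ θ in θ₀..θ₁, 2 * (Complex.I * F θ * starRingEnd ℂ (f θ)).re‖ ≤
        ∫ θ in Set.Ioc 0 Real.pi, (M / (2 * Real.pi) + 2 * Real.pi * ‖F θ‖ ^ 2) := by
      refine (intervalIntegral.norm_integral_le_integral_norm_uIoc).trans ?_
      refine (setIntegral_mono_set ?_ ?_ hsub.eventuallyLE).trans
        (setIntegral_mono_on ?_ ?_ measurableSet_Ioc fun θ hθ => hbound θ ⟨hθ.1.le, hθ.2⟩)
      · exact (hgc.norm.integrableOn_Icc).mono_set Set.Ioc_subset_Icc_self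
      · exact Filter.Eventually.of_forall fun _ => norm_nonneg _
      · exact (hgc.norm.integrableOn_Icc).mono_set Set.Ioc_subset_Icc_self
      · exact (hc2.integrableOn_Icc).mono_set Set.Ioc_subset_Icc_self
    rw [← intervalIntegral.integral_of_le hpi.le, intervalIntegral.integral_add
      (Continuous.intervalIntegrable (by fun_prop) _ _)
      (Continuous.intervalIntegrable (by fun_prop) _ _),
      intervalIntegral.integral_const_mul (2 * Real.pi), intervalIntegral.integral_const, smul_eq_mul] at h3
    have h4 : (Real.pi - 0) * (M / (2 * Real.pi)) = M / 2 := by field_simp; ring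
    linarith
  have hfin : ∫ θ in (0 : ℝ)..Real.pi, ‖f θ‖ ^ 2 ≤ ∫ θ in (0 : ℝ)..Real.pi, M :=
    intervalIntegral.integral_mono_on hpi.le (Continuous.intervalIntegrable (by fun_prop) _ _)
      (Continuous.intervalIntegrable (by fun_prop) _ _) fun θ hθ => hmax hθ
  rw [intervalIntegral.integral_const, smul_eq_mul, sub_zero] at hfin
  calc _ ≤ _ := hfin
    _ ≤ Real.pi * (4 * Real.pi * a) := by gcongr; linarith
    _ = _ := by ring

/-- Magnetic Hardy inequality for a nonvanishing periodic function with nontrivial flux. -/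
lemma integral_norm_sq_le_of_flux {f F : ℝ → ℂ} {A : ℝ → ℝ}
    (hf : ∀ θ, HasDerivAt f (Complex.I * (F θ - A θ * f θ)) θ) (hF : Continuous F)
    (hA : Continuous A) (hper : f Real.pi = f 0) {ν : ℕ} (hν : 0 < ν)
    (hflux : 2 / (ν : ℝ) ≤
      ‖Complex.exp (Complex.I * ((∫ θ in (0 : ℝ)..Real.pi, A θ : ℝ) : ℂ)) - 1‖) :
    ∫ θ in (0 : ℝ)..Real.pi, ‖f θ‖ ^ 2 ≤
      4 * Real.pi ^ 2 * ν ^ 2 * ∫ θ in (0 : ℝ)..Real.pi, ‖F θ‖ ^ 2 := by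
  have hpi := Real.pi_pos
  have hfc : Continuous f := continuous_iff_continuousAt.2 fun θ => (hf θ).continuousAt
  have hν1 : (1 : ℝ) ≤ ν := by exact_mod_cast hν
  set B : ℝ → ℝ := fun θ => ∫ u in (0 : ℝ)..θ, A u with hB
  have hBd : ∀ θ, HasDerivAt B (A θ) θ := hasDerivAt_integral_of_continuous hA
  have hBc : Continuous B := continuous_iff_continuousAt.2 fun θ => (hBd θ).continuousAt
  set g : ℝ → ℂ := fun θ => Complex.exp (Complex.I * (B θ : ℂ)) * f θ with hg
  have hunit : ∀ θ, ‖Complex.exp (Complex.I * (B θ : ℂ))‖ = 1 := fun θ => by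
    rw [mul_comm]; exact Complex.norm_exp_ofReal_mul_I _
  have hgd : ∀ θ, HasDerivAt g (Complex.exp (Complex.I * (B θ : ℂ)) * (Complex.I * F θ)) θ := by
    intro θ
    have h1 : HasDerivAt (fun t => Complex.I * (B t : ℂ)) (Complex.I * (A θ : ℂ)) θ :=
      (hBd θ).ofReal_comp.const_mul Complex.I
    exact (h1.cexp.mul (hf θ)).congr_deriv (by ring)
  set s := ∫ θ in (0 : ℝ)..Real.pi, ‖F θ‖ with hs
  have hs0 : 0 ≤ s := intervalIntegral.integral_nonneg hpi.le fun _ _ => norm_nonneg _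
  have hgs : ∀ θ ∈ Set.Icc 0 Real.pi, ‖g θ - g 0‖ ≤ s := by
    intro θ hθ
    rw [← intervalIntegral.integral_eq_sub_of_hasDerivAt (fun t _ => hgd t)
      (Continuous.intervalIntegrable (by fun_prop) _ _)]
    refine (intervalIntegral.norm_integral_le_integral_norm hθ.1).trans ?_
    have : ∀ t, ‖Complex.exp (Complex.I * (B t : ℂ)) * (Complex.I * F t)‖ = ‖F t‖ := by
      intro t; rw [norm_mul, hunit]; simp
    simp only [this]
    exact intervalIntegral.integral_mono_interval le_rfl hθ.1 hθ.2
      (Filter.Eventually.of_forall fun _ => norm_nonneg _) (hF.norm.intervalIntegrable _ _)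
  have hg0 : g 0 = f 0 := by simp [hg, hB]
  have hf0 : ‖f 0‖ ≤ ν / 2 * s := by
    have h1 := hgs Real.pi ⟨hpi.le, le_rfl⟩
    have h2 : g Real.pi - g 0 =
        (Complex.exp (Complex.I * ((∫ θ in (0 : ℝ)..Real.pi, A θ : ℝ) : ℂ)) - 1) * f 0 := by
      rw [hg0]; simp only [hg, hB, hper]; ring
    rw [h2, norm_mul] at h1
    have h3 := (mul_le_mul_of_nonneg_right hflux (norm_nonneg (f 0))).trans h1
    have hνp : (0:ℝ) < ν := by linarith
    calc ‖f 0‖ = ν / 2 * (2 / ν * ‖f 0‖) := by field_simp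
      _ ≤ ν / 2 * s := by gcongr
  have hsup : ∀ θ ∈ Set.Icc 0 Real.pi, ‖f θ‖ ^ 2 ≤ (2 * ν * s) ^ 2 := by
    intro θ hθ
    have h1 : ‖f θ‖ = ‖g θ‖ := by simp only [hg, norm_mul, hunit, one_mul]
    have h2 : ‖g θ‖ ≤ ‖g θ - g 0‖ + ‖g 0‖ := by
      simpa using norm_add_le (g θ - g 0) (g 0)
    have h3 := hgs θ hθ
    rw [hg0] at h2 h3
    have h4 : s ≤ ν * s := le_mul_of_one_le_left hs0 hν1
    have h5 : ‖f θ‖ ≤ 2 * ν * s := by rw [h1]; nlinarith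
    gcongr
  have hcs : s ^ 2 ≤ Real.pi * ∫ θ in (0 : ℝ)..Real.pi, ‖F θ‖ ^ 2 := by
    have h0 : 0 ≤ ∫ θ in (0 : ℝ)..Real.pi, (‖F θ‖ ^ 2 - 2 * (s / Real.pi) * ‖F θ‖ + (s / Real.pi) ^ 2) := by
      refine intervalIntegral.integral_nonneg hpi.le fun θ _ => ?_
      have := sq_nonneg (‖F θ‖ - s / Real.pi)
      linarith
    rw [intervalIntegral.integral_add (Continuous.intervalIntegrable (by fun_prop) _ _)
        (Continuous.intervalIntegrable (by fun_prop) _ _),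
      intervalIntegral.integral_sub (Continuous.intervalIntegrable (by fun_prop) _ _)
        (Continuous.intervalIntegrable (by fun_prop) _ _), intervalIntegral.integral_const_mul,
      intervalIntegral.integral_const, smul_eq_mul, ← hs] at h0
    have h1 : (Real.pi - 0) * (s / Real.pi) ^ 2 = s ^ 2 / Real.pi := by field_simp; ring
    have h2 : 2 * (s / Real.pi) * s = 2 * (s ^ 2 / Real.pi) := by ring
    rw [h1, h2] at h0
    have h3 : s ^ 2 / Real.pi ≤ ∫ θ in (0 : ℝ)..Real.pi, ‖F θ‖ ^ 2 := by linarith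
    rwa [div_le_iff₀' hpi] at h3
  have hfin : ∫ θ in (0 : ℝ)..Real.pi, ‖f θ‖ ^ 2 ≤ ∫ θ in (0 : ℝ)..Real.pi, (2 * ν * s) ^ 2 :=
    intervalIntegral.integral_mono_on hpi.le (Continuous.intervalIntegrable (by fun_prop) _ _)
      (Continuous.intervalIntegrable (by fun_prop) _ _) hsup
  rw [intervalIntegral.integral_const, smul_eq_mul, sub_zero] at hfin
  calc _ ≤ _ := hfin
    _ = 4 * Real.pi * ν ^ 2 * s ^ 2 := by ring
    _ ≤ 4 * Real.pi * ν ^ 2 * (Real.pi * ∫ θ in (0 : ℝ)..Real.pi, ‖F θ‖ ^ 2) := by gcongr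
    _ = _ := by ring

/-! ### Rotating a pair of particles about its midpoint -/

section PairRotation

lemma plane_norm_sq (v : Plane) : ‖v‖ ^ 2 = v 0 ^ 2 + v 1 ^ 2 := by
  simp [EuclideanSpace.norm_sq_eq, Fin.sum_univ_two]

/-- Counterclockwise rotation by the angle `θ`. -/
noncomputable def planeRot (θ : ℝ) (v : Plane) : Plane :=
  !₂[Real.cos θ * v 0 - Real.sin θ * v 1, Real.sin θ * v 0 + Real.cos θ * v 1]

@[simp] lemma planeRot_zero_apply (θ : ℝ) (v : Plane) :
    planeRot θ v 0 = Real.cos θ * v 0 - Real.sin θ * v 1 := rfl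

@[simp] lemma planeRot_one_apply (θ : ℝ) (v : Plane) :
    planeRot θ v 1 = Real.sin θ * v 0 + Real.cos θ * v 1 := rfl

lemma plane_ext {v w : Plane} (h0 : v 0 = w 0) (h1 : v 1 = w 1) : v = w := by
  ext i; fin_cases i <;> assumption

lemma norm_planeRot (θ : ℝ) (v : Plane) : ‖planeRot θ v‖ = ‖v‖ := by
  rw [← sq_eq_sq₀ (norm_nonneg _) (norm_nonneg _), plane_norm_sq, plane_norm_sq]
  simp only [planeRot_zero_apply, planeRot_one_apply]
  linear_combination (v 0 ^ 2 + v 1 ^ 2) * Real.sin_sq_add_cos_sq θ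

lemma planeRot_add_pi (θ : ℝ) (v : Plane) : planeRot (θ + Real.pi) v = -planeRot θ v := by
  apply plane_ext <;> simp <;> ring

lemma planeRot_zero (v : Plane) : planeRot 0 v = v := by
  apply plane_ext <;> simp

lemma planeRot_smul (θ c : ℝ) (v : Plane) : planeRot θ (c • v) = c • planeRot θ v := by
  apply plane_ext <;> simp <;> ring

lemma planeRot_add (θ : ℝ) (v w : Plane) :
    planeRot θ (v + w) = planeRot θ v + planeRot θ w := by
  apply plane_ext <;> simp <;> ring

lemma hasDerivAt_planeRot (v : Plane) (θ : ℝ) :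
    HasDerivAt (fun t => planeRot t v) (planeRot (θ + Real.pi / 2) v) θ := by
  have h : HasDerivAt (fun t => ![Real.cos t * v 0 - Real.sin t * v 1,
      Real.sin t * v 0 + Real.cos t * v 1])
      ![-Real.sin θ * v 0 - Real.cos θ * v 1, Real.cos θ * v 0 + -Real.sin θ * v 1] θ := by
    rw [hasDerivAt_pi]
    intro i
    fin_cases i
    · exact ((Real.hasDerivAt_cos θ).mul_const _).sub ((Real.hasDerivAt_sin θ).mul_const _)
    · exact ((Real.hasDerivAt_sin θ).mul_const _).add ((Real.hasDerivAt_cos θ).mul_const _)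
  have h2 := (PiLp.continuousLinearEquiv 2 ℝ (fun _ : Fin 2 => ℝ)).symm.toContinuousLinearMap.hasFDerivAt.comp_hasDerivAt θ h
  refine h2.congr_deriv ?_
  apply plane_ext <;> simp [Real.cos_add_pi_div_two, Real.sin_add_pi_div_two]

lemma continuous_planeRot : Continuous fun p : ℝ × Plane => planeRot p.1 p.2 := by
  unfold planeRot
  fun_prop

variable {N : ℕ}

/-- Rotation of the particles `j` and `k` about their midpoint by the angle `θ`. -/
noncomputable def pairRot (j k : Fin N) (θ : ℝ) (x : Fin N → Plane) : Fin N → Plane :=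
  x + Pi.single j (planeRot θ ((2⁻¹ : ℝ) • (x j - x k)) - (2⁻¹ : ℝ) • (x j - x k))
    - Pi.single k (planeRot θ ((2⁻¹ : ℝ) • (x j - x k)) - (2⁻¹ : ℝ) • (x j - x k))

lemma pairRot_left {j k : Fin N} (hjk : j ≠ k) (θ : ℝ) (x : Fin N → Plane) :
    pairRot j k θ x j = pairMid x j k + planeRot θ ((2⁻¹ : ℝ) • (x j - x k)) := by
  simp only [pairRot, Pi.add_apply, Pi.sub_apply, Pi.single_eq_same, Pi.single_eq_of_ne hjk, pairMid]
  module

lemma pairRot_right {j k : Fin N} (hjk : j ≠ k) (θ : ℝ) (x : Fin N → Plane) :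
    pairRot j k θ x k = pairMid x j k - planeRot θ ((2⁻¹ : ℝ) • (x j - x k)) := by
  simp only [pairRot, Pi.add_apply, Pi.sub_apply, Pi.single_eq_same,
    Pi.single_eq_of_ne hjk.symm, pairMid]
  module

lemma pairRot_of_ne {j k l : Fin N} (hj : l ≠ j) (hk : l ≠ k) (θ : ℝ) (x : Fin N → Plane) :
    pairRot j k θ x l = x l := by
  simp [pairRot, Pi.single_eq_of_ne hj, Pi.single_eq_of_ne hk]

lemma pairRot_zero (j k : Fin N) (x : Fin N → Plane) : pairRot j k 0 x = x := by
  simp [pairRot, planeRot_zero]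

lemma pairRot_add_pi {j k : Fin N} (hjk : j ≠ k) (θ : ℝ) (x : Fin N → Plane) :
    pairRot j k (θ + Real.pi) x = pairRot j k θ x ∘ Equiv.swap j k := by
  funext l
  by_cases hj : l = j
  · subst hj
    simp [pairRot_left hjk, pairRot_right hjk, planeRot_add_pi, sub_eq_add_neg]
  · by_cases hk : l = k
    · subst hk
      simp [pairRot_left hjk, pairRot_right hjk, planeRot_add_pi]
    · simp [pairRot_of_ne hj hk, Equiv.swap_apply_of_ne_of_ne hj hk]

lemma pairMid_pairRot {j k : Fin N} (hjk : j ≠ k) (θ : ℝ) (x : Fin N → Plane) :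
    pairMid (pairRot j k θ x) j k = pairMid x j k := by
  rw [pairMid, pairRot_left hjk, pairRot_right hjk]
  module

lemma pairRot_sub {j k : Fin N} (hjk : j ≠ k) (θ : ℝ) (x : Fin N → Plane) :
    pairRot j k θ x j - pairRot j k θ x k = planeRot θ (x j - x k) := by
  rw [pairRot_left hjk, pairRot_right hjk, planeRot_smul]
  module

lemma norm_pairRot_sub_pairMid {j k : Fin N} (hjk : j ≠ k) (θ : ℝ) (x : Fin N → Plane)
    (l : Fin N) : ‖pairRot j k θ x l - pairMid x j k‖ = ‖x l - pairMid x j k‖ := by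
  by_cases hj : l = j
  · subst hj
    rw [pairRot_left hjk, add_sub_cancel_left, norm_planeRot, sub_pairMid_left]
  · by_cases hk : l = k
    · subst hk
      rw [pairRot_right hjk, sub_sub_cancel_left, norm_neg, norm_planeRot, sub_pairMid_right,
        norm_neg]
    · rw [pairRot_of_ne hj hk]

lemma pairWeight_pairRot {j k : Fin N} (hjk : j ≠ k) (ℓ : Plane → ℝ) (θ : ℝ)
    (x : Fin N → Plane) : pairWeight ℓ (pairRot j k θ x) j k = pairWeight ℓ x j k := by
  simp only [pairWeight, pairMid_pairRot hjk, pairRot_sub hjk, norm_planeRot, ballCount,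
    norm_pairRot_sub_pairMid hjk]

lemma sum_norm_sq_pairRot {j k : Fin N} (hjk : j ≠ k) (θ : ℝ) (x : Fin N → Plane) :
    ∑ l, ‖pairRot j k θ x l‖ ^ 2 = ∑ l, ‖x l‖ ^ 2 := by
  rw [← sub_eq_zero, ← Finset.sum_sub_distrib, Fintype.sum_eq_add j k hjk fun l hl => by
    rw [pairRot_of_ne hl.1 hl.2, sub_self]]
  have h1 := parallelogram_law_with_norm ℝ (pairMid x j k) (planeRot θ ((2⁻¹ : ℝ) • (x j - x k)))
  have h2 := parallelogram_law_with_norm ℝ (pairMid x j k) ((2⁻¹ : ℝ) • (x j - x k))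
  have e1 : pairMid x j k + (2⁻¹ : ℝ) • (x j - x k) = x j := by unfold pairMid; module
  have e2 : pairMid x j k - (2⁻¹ : ℝ) • (x j - x k) = x k := by unfold pairMid; module
  rw [e1, e2] at h2
  rw [norm_planeRot] at h1
  rw [pairRot_left hjk, pairRot_right hjk]
  linarith

lemma continuous_pairRot (j k : Fin N) :
    Continuous fun p : ℝ × (Fin N → Plane) => pairRot j k p.1 p.2 := by
  have h : Continuous fun p : ℝ × (Fin N → Plane) =>
      planeRot p.1 ((2⁻¹ : ℝ) • (p.2 j - p.2 k)) - (2⁻¹ : ℝ) • (p.2 j - p.2 k) :=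
    (continuous_planeRot.comp (by fun_prop : Continuous fun p : ℝ × (Fin N → Plane) =>
      (p.1, (2⁻¹ : ℝ) • (p.2 j - p.2 k)))).sub (by fun_prop)
  exact (continuous_snd.add ((continuous_single j).comp h)).sub ((continuous_single k).comp h)

lemma hasDerivAt_pairRot (j k : Fin N) (x : Fin N → Plane) (θ : ℝ) :
    HasDerivAt (fun t => pairRot j k t x)
      (Pi.single j (planeRot (θ + Real.pi / 2) ((2⁻¹ : ℝ) • (x j - x k)))
        - Pi.single k (planeRot (θ + Real.pi / 2) ((2⁻¹ : ℝ) • (x j - x k)))) θ := by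
  have h := (hasDerivAt_planeRot ((2⁻¹ : ℝ) • (x j - x k)) θ).sub_const ((2⁻¹ : ℝ) • (x j - x k))
  have hs : ∀ l : Fin N, HasDerivAt (fun t => (Pi.single l
      (planeRot t ((2⁻¹ : ℝ) • (x j - x k)) - (2⁻¹ : ℝ) • (x j - x k)) : Fin N → Plane))
      (Pi.single l (planeRot (θ + Real.pi / 2) ((2⁻¹ : ℝ) • (x j - x k)))) θ := fun l =>
    (ContinuousLinearMap.single ℝ (fun _ : Fin N => Plane) l).hasFDerivAt.comp_hasDerivAt θ h
  exact ((hs j).const_add x).sub (hs k)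

lemma measurePreserving_pairRot {j k : Fin N} (hjk : j ≠ k) (θ : ℝ) :
    MeasurePreserving (pairRot j k θ) := by
  have hc : Continuous (pairRot j k θ) :=
    (continuous_pairRot j k).comp (by fun_prop : Continuous fun x : Fin N → Plane => (θ, x))
  let L : (Fin N → Plane) →ₗ[ℝ] (Fin N → Plane) :=
    { toFun := pairRot j k θ
      map_add' := fun x y => by
        have : (2⁻¹ : ℝ) • ((x + y) j - (x + y) k) = (2⁻¹ : ℝ) • (x j - x k) +
            (2⁻¹ : ℝ) • (y j - y k) := by simp only [Pi.add_apply]; module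
        simp only [pairRot, this, planeRot_add, add_sub_add_comm, Pi.single_add]
        abel
      map_smul' := fun c x => by
        have : (2⁻¹ : ℝ) • ((c • x) j - (c • x) k) = c • (2⁻¹ : ℝ) • (x j - x k) := by
          simp only [Pi.smul_apply]; module
        simp only [pairRot, this, planeRot_smul, ← smul_sub, Pi.single_smul, RingHom.id_apply]
        module }
  have hinj : LinearMap.ker L = ⊥ := by
    rw [LinearMap.ker_eq_bot']
    intro x hx
    have h1 := sum_norm_sq_pairRot hjk θ x
    have h2 : pairRot j k θ x = 0 := hx
    rw [h2] at h1
    simp only [Pi.zero_apply, norm_zero] at h1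
    have h3 : ∑ l, ‖x l‖ ^ 2 = 0 := by rw [← h1]; simp
    rw [Finset.sum_eq_zero_iff_of_nonneg (fun _ _ => by positivity)] at h3
    funext l
    simpa using h3 l (Finset.mem_univ l)
  have hdet : LinearMap.det L ≠ 0 := by
    have := LinearMap.isUnit_iff_ker_eq_bot L |>.2 hinj
    exact ((LinearMap.isUnit_iff_isUnit_det L).1 this).ne_zero
  have hmap := Measure.map_linearMap_addHaar_eq_smul_addHaar
    (volume : Measure (Fin N → Plane)) hdet
  set S : Set (Fin N → Plane) := {x | ∑ l, ‖x l‖ ^ 2 < 1} with hS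
  have hSo : IsOpen S := isOpen_lt (by fun_prop) continuous_const
  have hpre : L ⁻¹' S = S := by
    ext x
    change ∑ l, ‖pairRot j k θ x l‖ ^ 2 < 1 ↔ ∑ l, ‖x l‖ ^ 2 < 1
    rw [sum_norm_sq_pairRot hjk]
  have hSpos : volume S ≠ 0 := (hSo.measure_pos volume ⟨0, by simp [hS]⟩).ne'
  have hSfin : volume S ≠ ⊤ := by
    refine ((Metric.isBounded_ball (x := (0 : Fin N → Plane)) (r := 2)).subset ?_).measure_lt_top.ne
    intro x hx
    rw [mem_ball_zero_iff, pi_norm_lt_iff two_pos]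
    intro l
    have h1 : ‖x l‖ ^ 2 ≤ ∑ l, ‖x l‖ ^ 2 :=
      Finset.single_le_sum (f := fun l => ‖x l‖ ^ 2) (fun _ _ => by positivity) (Finset.mem_univ l)
    have h2 : ∑ l, ‖x l‖ ^ 2 < 1 := hx
    nlinarith [norm_nonneg (x l)]
  have h1 : volume S = ENNReal.ofReal |(LinearMap.det L)⁻¹| * volume S := by
    conv_lhs => rw [← hpre, ← Measure.map_apply (show Measurable L from hc.measurable)
      hSo.measurableSet, hmap]
    simp
  have h2 : ENNReal.ofReal |(LinearMap.det L)⁻¹| = 1 := by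
    have : ENNReal.ofReal |(LinearMap.det L)⁻¹| * volume S = 1 * volume S := by
      rw [one_mul]; exact h1.symm
    exact (ENNReal.mul_left_inj hSpos hSfin).1 this
  refine ⟨hc.measurable, ?_⟩
  rw [h2, one_smul] at hmap
  exact hmap

/-- Averaging over rotations of a pair. -/
lemma lintegral_le_of_pairRot {j k : Fin N} (hjk : j ≠ k) {G H : (Fin N → Plane) → ENNReal}
    (hG : Measurable G) (hH : Measurable H) (c : ENNReal)
    (h : ∀ x, ∫⁻ θ in Set.Ioc 0 Real.pi, G (pairRot j k θ x) ≤
      c * ∫⁻ θ in Set.Ioc 0 Real.pi, H (pairRot j k θ x)) :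
    ∫⁻ x, G x ≤ c * ∫⁻ x, H x := by
  have key : ∀ G : (Fin N → Plane) → ENNReal, Measurable G →
      ∫⁻ x, ∫⁻ θ in Set.Ioc 0 Real.pi, G (pairRot j k θ x) =
        ENNReal.ofReal Real.pi * ∫⁻ x, G x := by
    intro G hG
    rw [lintegral_lintegral_swap]
    · have : ∀ θ, ∫⁻ x, G (pairRot j k θ x) = ∫⁻ x, G x := fun θ =>
        (measurePreserving_pairRot hjk θ).lintegral_comp hG
      simp [this, mul_comm]
    · refine (hG.comp ?_).aemeasurable
      exact ((continuous_pairRot j k).comp continuous_swap).measurable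
  have h1 := lintegral_mono (μ := volume) h
  rw [lintegral_const_mul, key G hG, key H hH, mul_left_comm] at h1
  · exact (ENNReal.mul_le_mul_iff_right (by simp [Real.pi_pos]) ENNReal.ofReal_ne_top).1 h1
  · exact ((hH.comp (continuous_pairRot j k).measurable).lintegral_prod_left' (μ := volume.restrict (Set.Ioc 0 Real.pi)))

end PairRotation

/-! ### The magnetic derivative along rotations of a pair -/

section PairDerivative

variable {N : ℕ}

lemma continuous_planeRot_left (v : Plane) : Continuous fun t => planeRot t v :=
  continuous_iff_continuousAt.2 fun t => (hasDerivAt_planeRot v t).continuousAt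

lemma continuousAt_anyonA (α : ℝ) {x : Fin N → Plane} (hx : ∀ j k, j ≠ k → x j ≠ x k)
    (j : Fin N) (i : Fin 2) : ContinuousAt (fun y => anyonA α y j i) x := by
  unfold anyonA
  refine continuousAt_const.mul (tendsto_finsetSum _ fun k hk => ?_)
  refine ContinuousAt.div ?_ (by fun_prop) ?_
  · fin_cases i
    · simp only [Fin.zero_eta, if_true]; fun_prop
    · simp only [Fin.mk_one, one_ne_zero, if_false]; fun_prop
  · have := hx j k (Finset.mem_filter.1 hk).2.symm
    have : x j - x k ≠ 0 := sub_ne_zero.2 this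
    positivity

lemma anyonD_of_notMem_tsupport {α : ℝ} {ψ : (Fin N → Plane) → ℂ} {x : Fin N → Plane}
    (hx : x ∉ tsupport ψ) (j : Fin N) (i : Fin 2) : anyonD α ψ x j i = 0 := by
  have h1 : fderiv ℝ ψ x = 0 := by
    by_contra h
    exact hx (support_fderiv_subset ℝ h)
  simp [anyonD, h1, image_eq_zero_of_notMem_tsupport hx]

lemma continuous_anyonD (α : ℝ) {ψ : (Fin N → Plane) → ℂ} (hψ : ContDiff ℝ (⊤ : ℕ∞) ψ)
    (hd : ∀ x ∈ tsupport ψ, ∀ j k : Fin N, j ≠ k → x j ≠ x k) (j : Fin N) (i : Fin 2) :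
    Continuous fun x => anyonD α ψ x j i := by
  refine continuous_iff_continuousAt.2 fun x => ?_
  by_cases hx : x ∈ tsupport ψ
  · have h1 : Continuous (fderiv ℝ ψ) := hψ.continuous_fderiv (by simp)
    have h2 : Continuous fun y => fderiv ℝ ψ y
        (Pi.single j (EuclideanSpace.single i (1 : ℝ))) := h1.clm_apply continuous_const
    exact (continuousAt_const.mul h2.continuousAt).add
      ((Complex.continuous_ofReal.continuousAt.comp (continuousAt_anyonA α (hd x hx) j i)).mul
        hψ.continuous.continuousAt)
  · refine (continuousAt_const (y := (0 : ℂ))).congr ?_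
    filter_upwards [(isClosed_tsupport ψ).isOpen_compl.mem_nhds hx] with y hy
    exact (anyonD_of_notMem_tsupport hy j i).symm

lemma fderiv_single_eq {ψ : (Fin N → Plane) → ℂ} (α : ℝ) (x : Fin N → Plane) (j : Fin N)
    (i : Fin 2) : fderiv ℝ ψ x (Pi.single j (EuclideanSpace.single i (1 : ℝ))) =
      Complex.I * (anyonD α ψ x j i - anyonA α x j i * ψ x) := by
  rw [anyonD]
  linear_combination (fderiv ℝ ψ x (Pi.single j (EuclideanSpace.single i (1 : ℝ)))) *
    Complex.I_mul_I

lemma fderiv_single_vec {ψ : (Fin N → Plane) → ℂ} (x : Fin N → Plane) (j : Fin N) (v : Plane) :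
    fderiv ℝ ψ x (Pi.single j v) =
      ∑ i, (v i : ℂ) * fderiv ℝ ψ x (Pi.single j (EuclideanSpace.single i (1 : ℝ))) := by
  have : (Pi.single j v : Fin N → Plane) =
      ∑ i, v i • Pi.single j (EuclideanSpace.single i (1 : ℝ)) := by
    have hv : v = ∑ i, v i • EuclideanSpace.single i (1 : ℝ) := by
      apply plane_ext <;> simp [Fin.sum_univ_two]
    conv_lhs => rw [hv]
    simp [Fin.sum_univ_two, Pi.single_add, ← Pi.single_smul]
  conv_lhs => rw [this]
  simp

/-- The complex number corresponding to a point of the plane. -/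
noncomputable def planeToComplex (v : Plane) : ℂ := ⟨v 0, v 1⟩

lemma planeToComplex_ne_zero {v : Plane} (hv : v ≠ 0) : planeToComplex v ≠ 0 := by
  intro h
  apply hv
  have h0 := congrArg Complex.re h
  have h1 := congrArg Complex.im h
  exact plane_ext h0 h1

lemma planeToComplex_planeRot (θ : ℝ) (v : Plane) :
    planeToComplex (planeRot θ v) = Complex.exp (θ * Complex.I) * planeToComplex v := by
  rw [Complex.exp_mul_I, ← Complex.ofReal_cos, ← Complex.ofReal_sin]
  apply Complex.ext <;> simp [planeToComplex, Complex.cos_ofReal_re, Complex.sin_ofReal_re]; ring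

lemma re_planeToComplex_div (v w : Plane) :
    (planeToComplex v / planeToComplex w).re = (v 0 * w 0 + v 1 * w 1) / ‖w‖ ^ 2 := by
  rw [Complex.div_re, plane_norm_sq]
  simp [planeToComplex, Complex.normSq_apply]
  ring

/-- The component of the magnetic potential along the rotation of a pair. -/
noncomputable def pairPotential (α : ℝ) (x : Fin N → Plane) (j k : Fin N) (θ : ℝ) : ℝ :=
  ∑ i, planeRot (θ + Real.pi / 2) ((2⁻¹ : ℝ) • (x j - x k)) i *
    (anyonA α (pairRot j k θ x) j i - anyonA α (pairRot j k θ x) k i)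

/-- The component of the magnetic derivative along the rotation of a pair. -/
noncomputable def pairDeriv (α : ℝ) (ψ : (Fin N → Plane) → ℂ) (x : Fin N → Plane) (j k : Fin N)
    (θ : ℝ) : ℂ :=
  ∑ i, (planeRot (θ + Real.pi / 2) ((2⁻¹ : ℝ) • (x j - x k)) i : ℂ) *
    (anyonD α ψ (pairRot j k θ x) j i - anyonD α ψ (pairRot j k θ x) k i)

lemma hasDerivAt_comp_pairRot (α : ℝ) {ψ : (Fin N → Plane) → ℂ} (hψ : ContDiff ℝ (⊤ : ℕ∞) ψ)
    (x : Fin N → Plane) (j k : Fin N) (θ : ℝ) :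
    HasDerivAt (fun t => ψ (pairRot j k t x))
      (Complex.I * (pairDeriv α ψ x j k θ - pairPotential α x j k θ * ψ (pairRot j k θ x))) θ := by
  have h1 : DifferentiableAt ℝ ψ (pairRot j k θ x) :=
    (hψ.differentiable (by simp)).differentiableAt
  refine (h1.hasFDerivAt.comp_hasDerivAt θ (hasDerivAt_pairRot j k x θ)).congr_deriv ?_
  rw [map_sub, fderiv_single_vec, fderiv_single_vec]
  simp only [fderiv_single_eq α, pairDeriv, pairPotential, Fin.sum_univ_two]
  push_cast
  ring

lemma norm_pairDeriv_sq_le (α : ℝ) (ψ : (Fin N → Plane) → ℂ) (x : Fin N → Plane) (j k : Fin N)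
    (θ : ℝ) : ‖pairDeriv α ψ x j k θ‖ ^ 2 ≤ ‖x j - x k‖ ^ 2 *
      ((∑ i, ‖anyonD α ψ (pairRot j k θ x) j i‖ ^ 2) +
        ∑ i, ‖anyonD α ψ (pairRot j k θ x) k i‖ ^ 2) := by
  set n := planeRot (θ + Real.pi / 2) ((2⁻¹ : ℝ) • (x j - x k)) with hn
  set a := anyonD α ψ (pairRot j k θ x) j
  set c := anyonD α ψ (pairRot j k θ x) k
  have hn' : n 0 ^ 2 + n 1 ^ 2 = ‖x j - x k‖ ^ 2 / 4 := by
    rw [← plane_norm_sq, hn, norm_planeRot, norm_smul]; norm_num; ring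
  have h1 : ‖pairDeriv α ψ x j k θ‖ ≤ |n 0| * (‖a 0‖ + ‖c 0‖) + |n 1| * (‖a 1‖ + ‖c 1‖) := by
    simp only [pairDeriv, Fin.sum_univ_two]
    refine (norm_add_le _ _).trans ?_
    rw [norm_mul, norm_mul, Complex.norm_real, Complex.norm_real]
    exact add_le_add (mul_le_mul_of_nonneg_left (norm_sub_le _ _) (abs_nonneg _))
      (mul_le_mul_of_nonneg_left (norm_sub_le _ _) (abs_nonneg _))
  simp only [Fin.sum_univ_two]
  have e0 := sq_abs (n 0)
  have e1 := sq_abs (n 1)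
  calc _ ≤ (|n 0| * (‖a 0‖ + ‖c 0‖) + |n 1| * (‖a 1‖ + ‖c 1‖)) ^ 2 := by gcongr
    _ ≤ (|n 0| ^ 2 + |n 1| ^ 2) * ((‖a 0‖ + ‖c 0‖) ^ 2 + (‖a 1‖ + ‖c 1‖) ^ 2) := by
      nlinarith [sq_nonneg (|n 0| * (‖a 1‖ + ‖c 1‖) - |n 1| * (‖a 0‖ + ‖c 0‖))]
    _ = ‖x j - x k‖ ^ 2 / 4 * ((‖a 0‖ + ‖c 0‖) ^ 2 + (‖a 1‖ + ‖c 1‖) ^ 2) := by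
      rw [e0, e1, hn']
    _ ≤ ‖x j - x k‖ ^ 2 / 4 * (4 * (‖a 0‖ ^ 2 + ‖a 1‖ ^ 2 + (‖c 0‖ ^ 2 + ‖c 1‖ ^ 2))) := by
      gcongr
      nlinarith [sq_nonneg (‖a 0‖ - ‖c 0‖), sq_nonneg (‖a 1‖ - ‖c 1‖), sq_nonneg (‖a 0‖),
        sq_nonneg (‖a 1‖), sq_nonneg (‖c 0‖), sq_nonneg (‖c 1‖)]
    _ = _ := by ring

/-- The magnetic potential along the rotation of a pair, in complex form. -/
lemma pairPotential_eq (α : ℝ) {x : Fin N → Plane} {j k : Fin N} (hjk : j ≠ k)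
    (hx : x j ≠ x k) (θ : ℝ) :
    pairPotential α x j k θ = α * (1 + ∑ l ∈ {j, k}ᶜ,
      ((Complex.exp (θ * Complex.I) * planeToComplex ((2⁻¹ : ℝ) • (x j - x k)) /
        (planeToComplex (pairMid x j k - x l) +
          Complex.exp (θ * Complex.I) * planeToComplex ((2⁻¹ : ℝ) • (x j - x k)))).re
      - (Complex.exp (θ * Complex.I) * planeToComplex ((2⁻¹ : ℝ) • (x j - x k)) /
        (planeToComplex (pairMid x j k - x l) -
          Complex.exp (θ * Complex.I) * planeToComplex ((2⁻¹ : ℝ) • (x j - x k)))).re)) := by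
  set ρ := planeRot θ ((2⁻¹ : ℝ) • (x j - x k)) with hρ
  set y := pairRot j k θ x with hy
  have hn0 : planeRot (θ + Real.pi / 2) ((2⁻¹ : ℝ) • (x j - x k)) 0 = - ρ 1 := by
    simp only [hρ, planeRot_zero_apply, planeRot_one_apply, Real.cos_add_pi_div_two,
      Real.sin_add_pi_div_two]; ring
  have hn1 : planeRot (θ + Real.pi / 2) ((2⁻¹ : ℝ) • (x j - x k)) 1 = ρ 0 := by
    simp only [hρ, planeRot_zero_apply, planeRot_one_apply, Real.cos_add_pi_div_two,
      Real.sin_add_pi_div_two]; ring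
  have hA : ∀ l, -ρ 1 * anyonA α y l 0 + ρ 0 * anyonA α y l 1 =
      α * ∑ m ∈ {l}ᶜ, (ρ 0 * (y l - y m) 0 + ρ 1 * (y l - y m) 1) / ‖y l - y m‖ ^ 2 := by
    intro l
    have hf : Finset.univ.filter (fun k => k ≠ l) = {l}ᶜ := by ext; simp
    simp only [anyonA, hf, Finset.mul_sum, ← Finset.sum_add_distrib]
    refine Finset.sum_congr rfl fun m _ => ?_
    simp
    ring
  have hρ0 : ‖ρ‖ ^ 2 ≠ 0 := by
    rw [hρ, norm_planeRot]
    exact pow_ne_zero 2 (norm_ne_zero_iff.2 (smul_ne_zero (by norm_num) (sub_ne_zero.2 hx)))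
  have hjk' : y j - y k = (2 : ℝ) • ρ := by
    rw [hy, pairRot_sub hjk, hρ, planeRot_smul]; module
  have hsj : ({j}ᶜ : Finset (Fin N)) = insert k {j, k}ᶜ := by
    ext l; simp only [Finset.mem_compl, Finset.mem_singleton, Finset.mem_insert]
    by_cases h : l = k
    · subst h; simp [hjk.symm]
    · simp [h]
  have hsk : ({k}ᶜ : Finset (Fin N)) = insert j {j, k}ᶜ := by
    ext l; simp only [Finset.mem_compl, Finset.mem_singleton, Finset.mem_insert]
    by_cases h : l = j
    · subst h; simp [hjk]
    · simp [h]
  have hpart : (ρ 0 * (y j - y k) 0 + ρ 1 * (y j - y k) 1) / ‖y j - y k‖ ^ 2 = 1 / 2 := by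
    rw [hjk', norm_smul]
    have := plane_norm_sq ρ
    simp only [PiLp.smul_apply, smul_eq_mul, Real.norm_ofNat, mul_pow]
    rw [div_eq_iff (by positivity), this]; ring
  have hpart' : (ρ 0 * (y k - y j) 0 + ρ 1 * (y k - y j) 1) / ‖y k - y j‖ ^ 2 = -(1 / 2) := by
    rw [← hpart, norm_sub_rev (y k)]
    simp only [PiLp.sub_apply]; ring
  simp only [pairPotential, Fin.sum_univ_two, hn0, hn1, ← hy]
  rw [show -ρ 1 * (anyonA α y j 0 - anyonA α y k 0) + ρ 0 * (anyonA α y j 1 - anyonA α y k 1) =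
    (-ρ 1 * anyonA α y j 0 + ρ 0 * anyonA α y j 1) -
      (-ρ 1 * anyonA α y k 0 + ρ 0 * anyonA α y k 1) by ring, hA, hA, ← mul_sub, hsj, hsk,
    Finset.sum_insert (by simp), Finset.sum_insert (by simp), hpart, hpart']
  congr 1
  rw [show ∀ a c : ℝ, 1 / 2 + a - (-(1 / 2) + c) = 1 + (a - c) by intros; ring,
    ← Finset.sum_sub_distrib]
  congr 1
  refine Finset.sum_congr rfl fun l hl => ?_
  have hl' : l ≠ j ∧ l ≠ k := by simpa using hl
  rw [← planeToComplex_planeRot, ← hρ]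
  have hadd : planeToComplex (pairMid x j k - x l) + planeToComplex ρ =
      planeToComplex (y j - y l) := by
    rw [hy, pairRot_left hjk, pairRot_of_ne hl'.1 hl'.2]
    apply Complex.ext <;> simp [planeToComplex, hρ] <;> ring
  have hsub : planeToComplex (pairMid x j k - x l) - planeToComplex ρ =
      planeToComplex (y k - y l) := by
    rw [hy, pairRot_right hjk, pairRot_of_ne hl'.1 hl'.2]
    apply Complex.ext <;> simp [planeToComplex, hρ] <;> ring
  rw [hadd, hsub, re_planeToComplex_div, re_planeToComplex_div]

/-- Magnetic Hardy inequality on the orbit of a pair. -/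
lemma integral_pairRot_norm_sq_le {μ : ℤ} (hμ : Odd μ) {ν : ℕ} (hν : 0 < ν)
    {ψ : (Fin N → Plane) → ℂ} (hψ : ContDiff ℝ (⊤ : ℕ∞) ψ)
    (hsym : ∀ (σ : Equiv.Perm (Fin N)) (x : Fin N → Plane), ψ (x ∘ σ) = ψ x)
    (hd : ∀ x ∈ tsupport ψ, ∀ j k : Fin N, j ≠ k → x j ≠ x k)
    {j k : Fin N} (hjk : j ≠ k) (x : Fin N → Plane) :
    ∫ θ in (0 : ℝ)..Real.pi, ‖ψ (pairRot j k θ x)‖ ^ 2 ≤ 4 * Real.pi ^ 2 * ν ^ 2 *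
      ∫ θ in (0 : ℝ)..Real.pi, ‖pairDeriv ((μ : ℝ) / ν) ψ x j k θ‖ ^ 2 := by
  set α : ℝ := (μ : ℝ) / ν with hα
  have hf := fun θ => hasDerivAt_comp_pairRot α hψ x j k θ
  have hrotc : Continuous fun θ => pairRot j k θ x :=
    (continuous_pairRot j k).comp (by fun_prop : Continuous fun θ : ℝ => (θ, x))
  have hF : Continuous (pairDeriv α ψ x j k) := by
    refine continuous_finsetSum _ fun i _ => ?_
    have h1 : Continuous fun θ => planeRot (θ + Real.pi / 2) ((2⁻¹ : ℝ) • (x j - x k)) :=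
      (continuous_planeRot_left _).comp (continuous_add_const (Real.pi / 2))
    have h2 := fun l => (continuous_anyonD α hψ hd l i).comp hrotc
    have h3 : Continuous fun θ => planeRot (θ + Real.pi / 2) ((2⁻¹ : ℝ) • (x j - x k)) i :=
      (EuclideanSpace.proj (𝕜 := ℝ) i).continuous.comp h1
    exact (Complex.continuous_ofReal.comp h3).mul ((h2 j).sub (h2 k))
  have hper : ∀ θ, ψ (pairRot j k (θ + Real.pi) x) = ψ (pairRot j k θ x) := fun θ => by
    rw [pairRot_add_pi hjk, hsym]
  have hν1 : (1 : ℝ) ≤ (ν : ℝ) ^ 2 := one_le_pow₀ (by exact_mod_cast hν)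
  by_cases hvan : ∃ θ₀ ∈ Set.Icc 0 Real.pi, ψ (pairRot j k θ₀ x) = 0
  · obtain ⟨θ₀, hθ₀, h0⟩ := hvan
    refine (integral_norm_sq_le_of_vanish hf hF hθ₀ h0).trans ?_
    have : 0 ≤ ∫ θ in (0 : ℝ)..Real.pi, ‖pairDeriv α ψ x j k θ‖ ^ 2 :=
      intervalIntegral.integral_nonneg Real.pi_pos.le fun _ _ => by positivity
    exact mul_le_mul_of_nonneg_right (le_mul_of_one_le_right (by positivity) hν1) this
  · push Not at hvan
    have hne : ∀ θ, ψ (pairRot j k θ x) ≠ 0 := by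
      intro θ
      have hp : Function.Periodic (fun θ => ψ (pairRot j k θ x)) Real.pi := hper
      obtain ⟨t, ht, hte⟩ := hp.exists_mem_Ico₀ Real.pi_pos θ
      rw [show ψ (pairRot j k θ x) = ψ (pairRot j k t x) from hte]
      exact hvan t ⟨ht.1, ht.2.le⟩
    have hoff : ∀ θ, ∀ l m, l ≠ m → pairRot j k θ x l ≠ pairRot j k θ x m := fun θ =>
      hd _ (subset_tsupport _ (hne θ))
    have hxjk : x j ≠ x k := by
      have := hoff 0 j k hjk
      rwa [pairRot_zero] at this
    set ρ := planeToComplex ((2⁻¹ : ℝ) • (x j - x k)) with hρ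
    have h1 : ∀ l ∈ ({j, k}ᶜ : Finset (Fin N)), ∀ θ : ℝ,
        planeToComplex (pairMid x j k - x l) + Complex.exp (θ * Complex.I) * ρ ≠ 0 := by
      intro l hl θ
      have hl' : l ≠ j ∧ l ≠ k := by simpa using hl
      have := planeToComplex_ne_zero (sub_ne_zero.2 (hoff θ j l hl'.1.symm))
      rw [pairRot_left hjk, pairRot_of_ne hl'.1 hl'.2] at this
      rw [hρ, ← planeToComplex_planeRot]
      convert this using 1
      apply Complex.ext <;> simp [planeToComplex] <;> ring
    have h2 : ∀ l ∈ ({j, k}ᶜ : Finset (Fin N)), ∀ θ : ℝ,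
        planeToComplex (pairMid x j k - x l) - Complex.exp (θ * Complex.I) * ρ ≠ 0 := by
      intro l hl θ
      have hl' : l ≠ j ∧ l ≠ k := by simpa using hl
      have := planeToComplex_ne_zero (sub_ne_zero.2 (hoff θ k l hl'.2.symm))
      rw [pairRot_right hjk, pairRot_of_ne hl'.1 hl'.2] at this
      rw [hρ, ← planeToComplex_planeRot]
      convert this using 1
      apply Complex.ext <;> simp [planeToComplex] <;> ring
    have hA := fun θ => pairPotential_eq α hjk hxjk θ
    have hc : ∀ l ∈ ({j, k}ᶜ : Finset (Fin N)), Continuous fun θ : ℝ =>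
        ((Complex.exp (θ * Complex.I) * ρ / (planeToComplex (pairMid x j k - x l) +
          Complex.exp (θ * Complex.I) * ρ)).re
        - (Complex.exp (θ * Complex.I) * ρ / (planeToComplex (pairMid x j k - x l) -
          Complex.exp (θ * Complex.I) * ρ)).re) := by
      intro l hl
      exact (Complex.continuous_re.comp (Continuous.div (by fun_prop) (by fun_prop) (h1 l hl))).sub
        (Complex.continuous_re.comp (Continuous.div (by fun_prop) (by fun_prop) (h2 l hl)))
    have hAc : Continuous (pairPotential α x j k) := by
      rw [funext hA]
      exact continuous_const.mul (continuous_const.add (continuous_finsetSum _ hc))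
    choose! q hq using fun l hl => exists_winding (h1 l hl) (h2 l hl)
    have hflux : ∫ θ in (0 : ℝ)..Real.pi, pairPotential α x j k θ =
        Real.pi * ((μ * (1 + 2 * ∑ l ∈ ({j, k}ᶜ : Finset (Fin N)), q l) : ℤ) / ν) := by
      rw [funext hA, intervalIntegral.integral_const_mul, intervalIntegral.integral_add
        (Continuous.intervalIntegrable (by fun_prop) _ _)
        (Continuous.intervalIntegrable (continuous_finsetSum _ hc) _ _),
        intervalIntegral.integral_finsetSum fun l hl => (hc l hl).intervalIntegrable _ _,
        Finset.sum_congr rfl hq, ← Finset.mul_sum, intervalIntegral.integral_const, hα]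
      push_cast
      simp
      ring
    refine integral_norm_sq_le_of_flux hf hF hAc ?_ hν ?_
    · have := hper 0
      rwa [zero_add] at this
    · rw [hflux]
      exact two_div_le_norm_exp_sub_one (hμ.mul ⟨_, add_comm _ _⟩) hν

end PairDerivative

/-! ### The many-body Hardy inequality -/

section ManyBody

variable {N : ℕ}

namespace IsLengthScale

variable {ℓ : Plane → ℝ} {b : ℝ}

lemma continuous_pairMid (j k : Fin N) : Continuous fun x : Fin N → Plane => pairMid x j k := by
  unfold pairMid; fun_prop

lemma measurable_pairWeight (h : IsLengthScale ℓ b) (j k : Fin N) :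
    Measurable fun x : Fin N → Plane => pairWeight ℓ x j k := by
  have h1 : Continuous fun x : Fin N → Plane => ℓ (pairMid x j k) :=
    h.continuous.comp (continuous_pairMid j k)
  have h2 := continuous_pairMid (N := N) j k
  unfold pairWeight ballCount
  refine Measurable.ite (measurableSet_le
    ((continuous_apply j).sub (continuous_apply k)).norm.measurable
    (h1.measurable.const_mul _)) (Measurable.inv
    (Measurable.mul (Finset.measurable_sum _ fun l _ => Measurable.ite
      (measurableSet_lt ?_ (h1.measurable.const_mul _)) measurable_const measurable_const)
      (h1.pow 2).measurable)) measurable_const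
  exact ((continuous_apply l).sub h2).norm.measurable

lemma pairWeight_le (h : IsLengthScale ℓ b) (x : Fin N → Plane) (j k : Fin N) :
    pairWeight ℓ x j k ≤ (ℓ (pairMid x j k) ^ 2)⁻¹ := by
  have hp := h.pos (pairMid x j k)
  unfold pairWeight
  split_ifs with he
  · have : 1 ≤ ballCount x (5 * ℓ (pairMid x j k)) (pairMid x j k) :=
      one_le_ballCount (j := j) (by rw [norm_sub_pairMid_left]; linarith)
    gcongr
    exact le_mul_of_one_le_left (by positivity) this
  · positivity

lemma pairWeight_comm (x : Fin N → Plane) (j k : Fin N) :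
    pairWeight ℓ x j k = pairWeight ℓ x k j := by
  have : pairMid x j k = pairMid x k j := by rw [pairMid, pairMid, add_comm]
  rw [pairWeight, pairWeight, this, norm_sub_rev]

lemma integrable_pairWeight_mul (h : IsLengthScale ℓ b) (j k : Fin N)
    {g : (Fin N → Plane) → ℝ} (hg : Continuous g) (hc : HasCompactSupport g) :
    Integrable fun x => pairWeight ℓ x j k * g x := by
  have h1 : Continuous fun x : Fin N → Plane => ℓ (pairMid x j k) :=
    h.continuous.comp (continuous_pairMid j k)
  have h2 : Continuous fun x : Fin N → Plane => (ℓ (pairMid x j k) ^ 2)⁻¹ * g x :=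
    ((h1.pow 2).inv₀ fun x => (pow_pos (h.pos _) 2).ne').mul hg
  refine (h2.integrable_of_hasCompactSupport hc.mul_left).mono
    ((h.measurable_pairWeight j k).mul hg.measurable).aestronglyMeasurable
    (Filter.Eventually.of_forall fun x => ?_)
  rw [norm_mul, norm_mul, Real.norm_of_nonneg (pairWeight_nonneg _ _ _),
    Real.norm_of_nonneg (inv_nonneg.2 (sq_nonneg _))]
  gcongr
  exact h.pairWeight_le x j k

lemma lintegral_pairWeight_le (h : IsLengthScale ℓ b) {μ : ℤ} (hμ : Odd μ) {ν : ℕ} (hν : 0 < ν)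
    {ψ : (Fin N → Plane) → ℂ} (hψ : ContDiff ℝ (⊤ : ℕ∞) ψ)
    (hsym : ∀ (σ : Equiv.Perm (Fin N)) (x : Fin N → Plane), ψ (x ∘ σ) = ψ x)
    (hd : ∀ x ∈ tsupport ψ, ∀ j k : Fin N, j ≠ k → x j ≠ x k) {j k : Fin N} (hjk : j ≠ k) :
    ∫⁻ x, ENNReal.ofReal (pairWeight ℓ x j k * ‖ψ x‖ ^ 2) ≤
      ENNReal.ofReal (4 * Real.pi ^ 2 * ν ^ 2) * ∫⁻ x, ENNReal.ofReal (pairWeight ℓ x j k *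
        (‖x j - x k‖ ^ 2 * ((∑ i, ‖anyonD ((μ : ℝ) / ν) ψ x j i‖ ^ 2) +
          ∑ i, ‖anyonD ((μ : ℝ) / ν) ψ x k i‖ ^ 2))) := by
  set α : ℝ := (μ : ℝ) / ν
  have hD := fun l i => continuous_anyonD α hψ hd l i
  have hw := h.measurable_pairWeight (N := N) j k
  have hψc := hψ.continuous
  have hDc : Continuous fun x : Fin N → Plane => ‖x j - x k‖ ^ 2 *
      ((∑ i, ‖anyonD α ψ x j i‖ ^ 2) + ∑ i, ‖anyonD α ψ x k i‖ ^ 2) := by fun_prop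
  refine lintegral_le_of_pairRot hjk ?_ ?_ _ fun x => ?_
  · exact (hw.mul (hψc.norm.pow 2).measurable).ennreal_ofReal
  · exact (hw.mul hDc.measurable).ennreal_ofReal
  have hw0 := pairWeight_nonneg (ℓ := ℓ) x j k
  have hrotc : Continuous fun θ => pairRot j k θ x :=
    (continuous_pairRot j k).comp (by fun_prop : Continuous fun θ : ℝ => (θ, x))
  have hconv : ∀ g : ℝ → ℝ, Continuous g → (∀ θ, 0 ≤ g θ) →
      ∫⁻ θ in Set.Ioc 0 Real.pi, ENNReal.ofReal (pairWeight ℓ x j k * g θ) =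
        ENNReal.ofReal (pairWeight ℓ x j k * ∫ θ in (0 : ℝ)..Real.pi, g θ) := by
    intro g hg hg0
    rw [intervalIntegral.integral_of_le Real.pi_pos.le, ← integral_const_mul]
    refine (ofReal_integral_eq_lintegral_ofReal ?_ ?_).symm
    · exact ((continuous_const.mul hg).integrableOn_Icc).mono_set Set.Ioc_subset_Icc_self
    · exact Filter.Eventually.of_forall fun θ => mul_nonneg hw0 (hg0 θ)
  simp only [pairWeight_pairRot hjk, pairRot_sub hjk, norm_planeRot]
  rw [hconv (fun θ => ‖ψ (pairRot j k θ x)‖ ^ 2) ((hψc.comp hrotc).norm.pow 2)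
    (fun θ => by positivity)]
  have hc2 : Continuous fun θ => ‖x j - x k‖ ^ 2 * ((∑ i, ‖anyonD α ψ (pairRot j k θ x) j i‖ ^ 2) +
          ∑ i, ‖anyonD α ψ (pairRot j k θ x) k i‖ ^ 2) := by
    have := fun l i => (hD l i).comp hrotc
    simp only [Function.comp_def] at this
    fun_prop
  rw [hconv _ hc2 (fun θ => by positivity), ← ENNReal.ofReal_mul (by positivity)]
  refine ENNReal.ofReal_le_ofReal ?_
  rw [mul_left_comm]
  gcongr
  refine (integral_pairRot_norm_sq_le hμ hν hψ hsym hd hjk x).trans ?_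
  gcongr
  by_cases hi : IntervalIntegrable (fun θ => ‖pairDeriv α ψ x j k θ‖ ^ 2) volume 0 Real.pi
  · exact intervalIntegral.integral_mono_on Real.pi_pos.le hi (hc2.intervalIntegrable _ _)
      fun θ _ => norm_pairDeriv_sq_le α ψ x j k θ
  · rw [intervalIntegral.integral_undef hi]
    exact intervalIntegral.integral_nonneg Real.pi_pos.le fun θ _ => by positivity

lemma integral_pairWeight_le (h : IsLengthScale ℓ b) {μ : ℤ} (hμ : Odd μ) {ν : ℕ} (hν : 0 < ν)
    {ψ : (Fin N → Plane) → ℂ} (hψ : ContDiff ℝ (⊤ : ℕ∞) ψ) (hc : HasCompactSupport ψ)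
    (hsym : ∀ (σ : Equiv.Perm (Fin N)) (x : Fin N → Plane), ψ (x ∘ σ) = ψ x)
    (hd : ∀ x ∈ tsupport ψ, ∀ j k : Fin N, j ≠ k → x j ≠ x k) {j k : Fin N} (hjk : j ≠ k) :
    ∫ x, pairWeight ℓ x j k * ‖ψ x‖ ^ 2 ≤
      4 * Real.pi ^ 2 * ν ^ 2 * ∫ x, pairWeight ℓ x j k *
        (‖x j - x k‖ ^ 2 * ((∑ i, ‖anyonD ((μ : ℝ) / ν) ψ x j i‖ ^ 2) +
          ∑ i, ‖anyonD ((μ : ℝ) / ν) ψ x k i‖ ^ 2)) := by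
  have h1 := h.lintegral_pairWeight_le hμ hν hψ hsym hd hjk
  have hw0 := fun x => pairWeight_nonneg (ℓ := ℓ) x j k
  set α : ℝ := (μ : ℝ) / ν
  have hD := fun l i => continuous_anyonD α hψ hd l i
  have i1 : Integrable fun x => pairWeight ℓ x j k * ‖ψ x‖ ^ 2 :=
    h.integrable_pairWeight_mul j k (hψ.continuous.norm.pow 2)
      (hc.norm.comp_left (g := fun t => t ^ 2) (by simp))
  have i2 : Integrable fun x => pairWeight ℓ x j k *
        (‖x j - x k‖ ^ 2 * ((∑ i, ‖anyonD α ψ x j i‖ ^ 2) + ∑ i, ‖anyonD α ψ x k i‖ ^ 2)) := by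
    refine h.integrable_pairWeight_mul j k (by fun_prop) (HasCompactSupport.intro hc fun x hx => ?_)
    simp [anyonD_of_notMem_tsupport hx]
  rw [← ofReal_integral_eq_lintegral_ofReal i1
      (Filter.Eventually.of_forall fun x => mul_nonneg (hw0 x) (by positivity)),
    ← ofReal_integral_eq_lintegral_ofReal i2
      (Filter.Eventually.of_forall fun x => mul_nonneg (hw0 x) (by positivity)),
    ← ENNReal.ofReal_mul (by positivity)] at h1
  refine (ENNReal.ofReal_le_ofReal_iff (mul_nonneg (by positivity) ?_)).1 h1
  exact integral_nonneg fun x => mul_nonneg (hw0 x) (by positivity)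

/-- The pair weights are controlled by the kinetic energy. -/
lemma integral_sum_pairWeight_le (h : IsLengthScale ℓ b) {μ : ℤ} (hμ : Odd μ) {ν : ℕ} (hν : 0 < ν)
    {ψ : (Fin N → Plane) → ℂ} (hψ : ContDiff ℝ (⊤ : ℕ∞) ψ) (hc : HasCompactSupport ψ)
    (hsym : ∀ (σ : Equiv.Perm (Fin N)) (x : Fin N → Plane), ψ (x ∘ σ) = ψ x)
    (hd : ∀ x ∈ tsupport ψ, ∀ j k : Fin N, j ≠ k → x j ≠ x k) :
    Integrable (fun x => (∑ j, ∑ k ∈ {j}ᶜ, pairWeight ℓ x j k) * ‖ψ x‖ ^ 2) ∧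
    ∫ x, (∑ j, ∑ k ∈ {j}ᶜ, pairWeight ℓ x j k) * ‖ψ x‖ ^ 2 ≤
      500 * ν ^ 2 * ∫ x, ∑ j, ∑ i, ‖anyonD ((μ : ℝ) / ν) ψ x j i‖ ^ 2 := by
  set α : ℝ := (μ : ℝ) / ν
  have hD := fun l i => continuous_anyonD α hψ hd l i
  have i1 : ∀ j k, Integrable fun x => pairWeight ℓ x j k * ‖ψ x‖ ^ 2 := fun j k =>
    h.integrable_pairWeight_mul j k (hψ.continuous.norm.pow 2)
      (hc.norm.comp_left (g := fun t => t ^ 2) (by simp))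
  have i2 : ∀ j k, Integrable fun x => pairWeight ℓ x j k *
        (‖x j - x k‖ ^ 2 * ((∑ i, ‖anyonD α ψ x j i‖ ^ 2) + ∑ i, ‖anyonD α ψ x k i‖ ^ 2)) := by
    intro j k
    refine h.integrable_pairWeight_mul j k (by fun_prop) (HasCompactSupport.intro hc fun x hx => ?_)
    simp [anyonD_of_notMem_tsupport hx]
  have i3 : Integrable fun x => ∑ j, ∑ i, ‖anyonD α ψ x j i‖ ^ 2 := by
    refine Continuous.integrable_of_hasCompactSupport (by fun_prop)
      (HasCompactSupport.intro hc fun x hx => ?_)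
    simp [anyonD_of_notMem_tsupport hx]
  simp only [Finset.sum_mul]
  refine ⟨integrable_finsetSum _ fun j _ => integrable_finsetSum _ fun k _ => i1 j k, ?_⟩
  rw [integral_finsetSum _ fun j _ => integrable_finsetSum _ fun k _ => i1 j k]
  have step : ∑ j, ∫ x, ∑ k ∈ {j}ᶜ, pairWeight ℓ x j k * ‖ψ x‖ ^ 2 ≤
      4 * Real.pi ^ 2 * ν ^ 2 * ∫ x, ∑ j, ∑ k, pairWeight ℓ x j k *
        (‖x j - x k‖ ^ 2 * ((∑ i, ‖anyonD α ψ x j i‖ ^ 2) + ∑ i, ‖anyonD α ψ x k i‖ ^ 2)) := by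
    rw [integral_finsetSum _ fun j _ => integrable_finsetSum _ fun k _ => i2 j k, Finset.mul_sum]
    refine Finset.sum_le_sum fun j _ => ?_
    rw [integral_finsetSum _ fun k _ => i1 j k, integral_finsetSum _ fun k _ => i2 j k,
      Finset.mul_sum]
    refine (Finset.sum_le_sum fun k hk => h.integral_pairWeight_le hμ hν hψ hc hsym hd
      (show j ≠ k by simpa [eq_comm] using hk)).trans ?_
    refine Finset.sum_le_sum_of_subset_of_nonneg (Finset.subset_univ _) fun k _ _ => ?_
    refine mul_nonneg (by positivity) (integral_nonneg fun x => ?_)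
    exact mul_nonneg (pairWeight_nonneg _ _ _) (by positivity)
  have hpt : ∀ x, ∑ j, ∑ k, pairWeight ℓ x j k *
        (‖x j - x k‖ ^ 2 * ((∑ i, ‖anyonD α ψ x j i‖ ^ 2) + ∑ i, ‖anyonD α ψ x k i‖ ^ 2)) ≤
      25 / 2 * ∑ j, ∑ i, ‖anyonD α ψ x j i‖ ^ 2 := by
    intro x
    have hrow : ∑ j, ∑ k, pairWeight ℓ x j k * ‖x j - x k‖ ^ 2 * ∑ i, ‖anyonD α ψ x j i‖ ^ 2 ≤
        25 / 4 * ∑ j, ∑ i, ‖anyonD α ψ x j i‖ ^ 2 := by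
      rw [Finset.mul_sum]
      refine Finset.sum_le_sum fun j _ => ?_
      rw [← Finset.sum_mul]
      gcongr
      exact h.sum_pairWeight_mul_sq_le x j
    have hswap : ∑ j, ∑ k, pairWeight ℓ x j k * ‖x j - x k‖ ^ 2 * ∑ i, ‖anyonD α ψ x k i‖ ^ 2 =
        ∑ j, ∑ k, pairWeight ℓ x j k * ‖x j - x k‖ ^ 2 * ∑ i, ‖anyonD α ψ x j i‖ ^ 2 := by
      rw [Finset.sum_comm]
      refine Finset.sum_congr rfl fun j _ => Finset.sum_congr rfl fun k _ => ?_
      rw [pairWeight_comm, norm_sub_rev]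
    have hsplit : ∑ j, ∑ k, pairWeight ℓ x j k *
        (‖x j - x k‖ ^ 2 * ((∑ i, ‖anyonD α ψ x j i‖ ^ 2) + ∑ i, ‖anyonD α ψ x k i‖ ^ 2)) =
        ∑ j, ∑ k, pairWeight ℓ x j k * ‖x j - x k‖ ^ 2 * ∑ i, ‖anyonD α ψ x j i‖ ^ 2 +
        ∑ j, ∑ k, pairWeight ℓ x j k * ‖x j - x k‖ ^ 2 * ∑ i, ‖anyonD α ψ x k i‖ ^ 2 := by
      rw [← Finset.sum_add_distrib]
      refine Finset.sum_congr rfl fun j _ => ?_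
      rw [← Finset.sum_add_distrib]
      refine Finset.sum_congr rfl fun k _ => ?_
      ring
    rw [hsplit, hswap]
    linarith
  have h_int := integral_mono
    (integrable_finsetSum _ fun j _ => integrable_finsetSum _ fun k _ => i2 j k)
    (i3.const_mul (25 / 2)) hpt
  rw [integral_const_mul] at h_int
  have hK : 0 ≤ ∫ x, ∑ j, ∑ i, ‖anyonD α ψ x j i‖ ^ 2 := integral_nonneg fun x => by positivity
  have hpi : Real.pi ^ 2 ≤ 10 := by nlinarith [Real.pi_lt_d2, Real.pi_pos]
  calc _ ≤ _ := step
    _ ≤ 4 * Real.pi ^ 2 * ν ^ 2 * (25 / 2 * ∫ x, ∑ j, ∑ i, ‖anyonD α ψ x j i‖ ^ 2) := by gcongr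
    _ = Real.pi ^ 2 * (50 * ν ^ 2 * ∫ x, ∑ j, ∑ i, ‖anyonD α ψ x j i‖ ^ 2) := by ring
    _ ≤ 10 * (50 * ν ^ 2 * ∫ x, ∑ j, ∑ i, ‖anyonD α ψ x j i‖ ^ 2) := by gcongr
    _ = _ := by ring

end IsLengthScale

end ManyBody

/-! ### The Coulomb singularity of a nucleus -/

section OneBody

variable {N : ℕ}

lemma hasDerivAt_max_zero_sq (t : ℝ) : HasDerivAt (fun t : ℝ => max 0 t ^ 2) (2 * max 0 t) t := by
  rcases lt_trichotomy t 0 with ht | rfl | ht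
  · rw [max_eq_left ht.le, mul_zero]
    refine (hasDerivAt_const t (0 : ℝ)).congr_of_eventuallyEq ?_
    filter_upwards [gt_mem_nhds ht] with s hs
    rw [max_eq_left hs.le]; norm_num
  · rw [max_self, mul_zero, hasDerivAt_iff_isLittleO]
    simp only [max_self, sub_zero, smul_zero]
    refine Asymptotics.IsBigO.trans_isLittleO (g := fun t : ℝ => t ^ 2)
      (Asymptotics.IsBigO.of_bound 1 (Filter.Eventually.of_forall fun s => ?_)) ?_
    · rcases le_total s 0 with hs | hs
      · rw [max_eq_left hs]; simp; positivity
      · rw [max_eq_right hs]; simp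
    · simpa using Asymptotics.isLittleO_pow_id (𝕜 := ℝ) one_lt_two
  · rw [max_eq_right ht.le]
    refine HasDerivAt.congr_of_eventuallyEq (f := fun t : ℝ => t ^ 2) ?_ ?_
    · simpa using hasDerivAt_pow 2 t
    · filter_upwards [lt_mem_nhds ht] with s hs
      rw [max_eq_right hs.le]

/-- Radial profile of the vector field used to resolve the Coulomb singularity. -/
noncomputable def coulombProfile (ε δ s : ℝ) : ℝ :=
  (√(s + ε ^ 2))⁻¹ * max 0 (1 - s / δ ^ 2) ^ 2

/-- The derivative of `coulombProfile`. -/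
noncomputable def coulombProfileDeriv (ε δ s : ℝ) : ℝ :=
  -(1 / 2 * (√(s + ε ^ 2))⁻¹ / (s + ε ^ 2)) * max 0 (1 - s / δ ^ 2) ^ 2 +
    (√(s + ε ^ 2))⁻¹ * (2 * max 0 (1 - s / δ ^ 2) * (-1 / δ ^ 2))

lemma hasDerivAt_coulombProfile {ε : ℝ} (hε : 0 < ε) (δ : ℝ) {s : ℝ} (hs : 0 ≤ s) :
    HasDerivAt (coulombProfile ε δ) (coulombProfileDeriv ε δ s) s := by
  have h0 : 0 < s + ε ^ 2 := by positivity
  have h1 : HasDerivAt (fun s : ℝ => (√(s + ε ^ 2))⁻¹)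
      (-(1 / 2 * (√(s + ε ^ 2))⁻¹ / (s + ε ^ 2))) s := by
    refine ((((hasDerivAt_id s).add_const (ε ^ 2)).sqrt h0.ne').inv
      (Real.sqrt_pos.2 h0).ne').congr_deriv ?_
    simp only [id]
    have := Real.sqrt_pos.2 h0
    rw [Real.sq_sqrt h0.le]
    field_simp
  have h2 : HasDerivAt (fun s : ℝ => 1 - s / δ ^ 2) (-1 / δ ^ 2) s :=
    (((hasDerivAt_id s).div_const _).const_sub 1).congr_deriv (by simp [neg_div])
  exact h1.mul ((hasDerivAt_max_zero_sq _).comp s h2)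

/-- The coordinate `x ↦ x_{j,i}` as a continuous linear map. -/
noncomputable def coordCLM (j : Fin N) (i : Fin 2) : (Fin N → Plane) →L[ℝ] ℝ :=
  (EuclideanSpace.proj i).comp (ContinuousLinearMap.proj j)

@[simp] lemma coordCLM_apply (j : Fin N) (i : Fin 2) (x : Fin N → Plane) :
    coordCLM j i x = x j i := rfl

lemma hasFDerivAt_coulombField {ε : ℝ} (hε : 0 < ε) (δ : ℝ) (j : Fin N) (p : Plane) (i : Fin 2)
    (x : Fin N → Plane) :
    ∃ L : (Fin N → Plane) →L[ℝ] ℝ,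
      HasFDerivAt (fun x : Fin N → Plane => (x j i - p i) * coulombProfile ε δ (‖x j - p‖ ^ 2))
        L x ∧
      L (Pi.single j (EuclideanSpace.single i (1 : ℝ))) = coulombProfile ε δ (‖x j - p‖ ^ 2) +
        2 * (x j i - p i) ^ 2 * coulombProfileDeriv ε δ (‖x j - p‖ ^ 2) := by
  have hc : ∀ i, HasFDerivAt (fun x : Fin N → Plane => x j i - p i) (coordCLM j i) x := fun i =>
    (coordCLM j i).hasFDerivAt.sub_const (p i)
  have hs := ((hc 0).pow 2).add ((hc 1).pow 2)
  have hprof := (hasDerivAt_coulombProfile hε δ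
    (s := (x j 0 - p 0) ^ 2 + (x j 1 - p 1) ^ 2) (by positivity)).comp_hasFDerivAt x hs
  have hF := (hc i).mul hprof
  have hn : ∀ x : Fin N → Plane, ‖x j - p‖ ^ 2 = (x j 0 - p 0) ^ 2 + (x j 1 - p 1) ^ 2 := fun x => by
    rw [plane_norm_sq]; rfl
  simp only [hn]
  refine ⟨_, hF, ?_⟩
  fin_cases i <;> simp <;> ring

lemma continuous_coulombProfile {ε : ℝ} (hε : 0 < ε) (δ : ℝ) (j : Fin N) (p : Plane) :
    Continuous fun x : Fin N → Plane => coulombProfile ε δ (‖x j - p‖ ^ 2) := by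
  have : ∀ x : Fin N → Plane, √(‖x j - p‖ ^ 2 + ε ^ 2) ≠ 0 := fun x => by positivity
  unfold coulombProfile
  fun_prop (disch := assumption)

lemma continuous_coulombProfileDeriv {ε : ℝ} (hε : 0 < ε) (δ : ℝ) (j : Fin N) (p : Plane) :
    Continuous fun x : Fin N → Plane => coulombProfileDeriv ε δ (‖x j - p‖ ^ 2) := by
  have h1 : ∀ x : Fin N → Plane, √(‖x j - p‖ ^ 2 + ε ^ 2) ≠ 0 := fun x => by positivity
  have h2 : ∀ x : Fin N → Plane, ‖x j - p‖ ^ 2 + ε ^ 2 ≠ 0 := fun x => by positivity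
  unfold coulombProfileDeriv
  fun_prop (disch := assumption)

lemma coulombProfile_eq_zero {ε δ r : ℝ} (hδ : 0 < δ) (hr : δ ≤ r) :
    coulombProfile ε δ (r ^ 2) = 0 ∧ coulombProfileDeriv ε δ (r ^ 2) = 0 := by
  have : max 0 (1 - r ^ 2 / δ ^ 2) = 0 := by
    refine max_eq_left ?_
    rw [sub_nonpos, one_le_div (by positivity)]
    gcongr
  simp [coulombProfile, coulombProfileDeriv, this]

lemma abs_mul_coulombProfile_le {ε δ r t : ℝ} (hε : 0 < ε) (ht : |t| ≤ r) :
    |t * coulombProfile ε δ (r ^ 2)| ≤ 1 := by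
  have hr := (abs_nonneg t).trans ht
  have hq : r ≤ √(r ^ 2 + ε ^ 2) := Real.le_sqrt_of_sq_le (by nlinarith)
  have hq0 : 0 < √(r ^ 2 + ε ^ 2) := by positivity
  have hw : max 0 (1 - r ^ 2 / δ ^ 2) ≤ 1 := max_le zero_le_one (by
    have : 0 ≤ r ^ 2 / δ ^ 2 := by positivity
    linarith)
  have hw0 : 0 ≤ max 0 (1 - r ^ 2 / δ ^ 2) := le_max_left _ _
  rw [coulombProfile, ← mul_assoc, abs_mul, abs_mul, abs_of_pos (inv_pos.2 hq0),
    abs_of_nonneg (pow_nonneg hw0 2)]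
  refine mul_le_one₀ ?_ (by positivity) (pow_le_one₀ hw0 hw)
  rw [← div_eq_mul_inv, div_le_one hq0]
  exact ht.trans hq

lemma inv_sqrt_le_div {ε δ r : ℝ} (hε : 0 < ε) (hr : 0 ≤ r) (hrδ : r < δ) :
    (√(r ^ 2 + ε ^ 2))⁻¹ ≤ 2 * coulombProfile ε δ (r ^ 2) +
      2 * r ^ 2 * coulombProfileDeriv ε δ (r ^ 2) + 6 / δ := by
  have hδ : 0 < δ := hr.trans_lt hrδ
  have hS : √(r ^ 2 + ε ^ 2) ^ 2 = r ^ 2 + ε ^ 2 := Real.sq_sqrt (by positivity)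
  have hq : r ≤ √(r ^ 2 + ε ^ 2) := Real.le_sqrt_of_sq_le (by nlinarith)
  have hq0 : 0 < √(r ^ 2 + ε ^ 2) := by positivity
  set y := r / δ with hy
  have hry : r = y * δ := by rw [hy]; field_simp
  have hy0 : 0 ≤ y := by positivity
  have hy1 : y ≤ 1 := by rw [hy, div_le_one hδ]; exact hrδ.le
  have hw : max 0 (1 - r ^ 2 / δ ^ 2) = 1 - y ^ 2 := by
    rw [← div_pow]; exact max_eq_right (by nlinarith)
  unfold coulombProfile coulombProfileDeriv
  rw [hw, ← hS]
  set q := √(r ^ 2 + ε ^ 2)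
  set a := r / q with ha
  have ha0 : 0 ≤ a := by positivity
  have ha1 : a ≤ 1 := by rw [ha, div_le_one hq0]; exact hq
  rw [Real.sqrt_sq hq0.le]
  have e : 2 * (q⁻¹ * (1 - y ^ 2) ^ 2) + 2 * r ^ 2 * (-(1 / 2 * q⁻¹ / q ^ 2) * (1 - y ^ 2) ^ 2 +
      q⁻¹ * (2 * (1 - y ^ 2) * (-1 / δ ^ 2))) + 6 / δ - q⁻¹ =
      q⁻¹ * (1 - y ^ 2) ^ 2 * (1 - a ^ 2) + (6 * (1 - a * y) + a * y ^ 3 + 4 * a * y ^ 3) / δ := by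
    rw [ha, hy]
    field_simp
    ring
  have e1 : 0 ≤ 1 - a ^ 2 := by nlinarith
  have e2 : 0 ≤ 1 - a * y := by nlinarith
  have : 0 ≤ q⁻¹ * (1 - y ^ 2) ^ 2 * (1 - a ^ 2) +
      (6 * (1 - a * y) + a * y ^ 3 + 4 * a * y ^ 3) / δ := by positivity
  linarith

lemma integrable_ite_near {g : (Fin N → Plane) → ℝ} (hg : Integrable g) (j : Fin N) (p : Plane)
    (δ : ℝ) : Integrable fun x => if ‖x j - p‖ < δ then g x else 0 := by
  have hm : MeasurableSet {x : Fin N → Plane | ‖x j - p‖ < δ} :=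
    measurableSet_lt (by fun_prop) measurable_const
  refine (hg.indicator hm).congr (Filter.Eventually.of_forall fun x => ?_)
  simp only [Set.indicator_apply, Set.mem_ofPred_eq]

lemma integral_regularized_near_le {u : (Fin N → Plane) → ℝ} (hu : ContDiff ℝ 1 u)
    (hc : HasCompactSupport u) (h0 : ∀ x, 0 ≤ u x) (j : Fin N) (p : Plane) {δ ε : ℝ}
    (hδ : 0 < δ) (hε : 0 < ε) :
    Integrable (fun x => if ‖x j - p‖ < δ then (√(‖x j - p‖ ^ 2 + ε ^ 2))⁻¹ * u x else 0) ∧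
    ∫ x, (if ‖x j - p‖ < δ then (√(‖x j - p‖ ^ 2 + ε ^ 2))⁻¹ * u x else 0) ≤
      ∫ x, if ‖x j - p‖ < δ then
        (∑ i, |fderiv ℝ u x (Pi.single j (EuclideanSpace.single i (1 : ℝ)))|) + 6 / δ * u x
        else 0 := by
  set e : Fin 2 → Fin N → Plane := fun i => Pi.single j (EuclideanSpace.single i (1 : ℝ))
  set F : Fin 2 → (Fin N → Plane) → ℝ := fun i x =>
    (x j i - p i) * coulombProfile ε δ (‖x j - p‖ ^ 2)
  set G : Fin 2 → (Fin N → Plane) → ℝ := fun i x => coulombProfile ε δ (‖x j - p‖ ^ 2) +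
        2 * (x j i - p i) ^ 2 * coulombProfileDeriv ε δ (‖x j - p‖ ^ 2)
  have hcP := continuous_coulombProfile hε δ j p
  have hcD := continuous_coulombProfileDeriv hε δ j p
  have hFc : ∀ i, Continuous (F i) := fun i => by unfold F; fun_prop
  have hGc : ∀ i, Continuous (G i) := fun i => by unfold G; fun_prop
  have hFd : ∀ i, Differentiable ℝ (F i) := fun i x =>
    (hasFDerivAt_coulombField hε δ j p i x).choose_spec.1.differentiableAt
  have hFG : ∀ i x, fderiv ℝ (F i) x (e i) = G i x := by
    intro i x
    obtain ⟨L, h1, h2⟩ := hasFDerivAt_coulombField hε δ j p i x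
    rw [h1.fderiv, h2]
  have hud : ∀ i, Continuous fun x => fderiv ℝ u x (e i) := fun i =>
    (hu.continuous_fderiv (by simp)).clm_apply continuous_const
  have hudc : ∀ i, HasCompactSupport fun x => fderiv ℝ u x (e i) := fun i =>
    hc.fderiv_apply ℝ (e i)
  have iu : Integrable u := hu.continuous.integrable_of_hasCompactSupport hc
  have iGu : ∀ i, Integrable fun x => G i x * u x := fun i =>
    ((hGc i).mul hu.continuous).integrable_of_hasCompactSupport hc.mul_left
  have iFu : ∀ i, Integrable fun x => F i x * fderiv ℝ u x (e i) := fun i =>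
    ((hFc i).mul (hud i)).integrable_of_hasCompactSupport (hudc i).mul_left
  have ibp : ∀ i, ∫ x, G i x * u x = -∫ x, F i x * fderiv ℝ u x (e i) := by
    intro i
    have := integral_mul_fderiv_eq_neg_fderiv_mul_of_integrable (μ := volume) (f := F i) (g := u)
      (v := e i) (by simpa only [hFG] using iGu i) (iFu i)
      (((hFc i).mul hu.continuous).integrable_of_hasCompactSupport hc.mul_left)
      (fun x _ => hFd i x) (fun x _ => hu.differentiable (by simp) x)
    simp only [hFG] at this
    linarith
  have hreg : Continuous fun x : Fin N → Plane => (√(‖x j - p‖ ^ 2 + ε ^ 2))⁻¹ * u x := by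
    have : ∀ x : Fin N → Plane, √(‖x j - p‖ ^ 2 + ε ^ 2) ≠ 0 := fun x => by positivity
    have := hu.continuous
    fun_prop (disch := assumption)
  have iL := integrable_ite_near (hreg.integrable_of_hasCompactSupport hc.mul_left) j p δ
  have iR1 := integrable_ite_near (integrable_finsetSum Finset.univ fun i _ =>
    ((hud i).integrable_of_hasCompactSupport (hudc i)).abs) j p δ
  have iR2 := integrable_ite_near (iu.const_mul (6 / δ)) j p δ
  refine ⟨iL, ?_⟩
  have iR : Integrable fun x => (∑ i, G i x * u x) +
      if ‖x j - p‖ < δ then 6 / δ * u x else 0 :=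
    (integrable_finsetSum _ fun i _ => iGu i).add iR2
  have s1 : ∫ x, (if ‖x j - p‖ < δ then (√(‖x j - p‖ ^ 2 + ε ^ 2))⁻¹ * u x else 0) ≤
      ∫ x, ((∑ i, G i x * u x) + if ‖x j - p‖ < δ then 6 / δ * u x else 0) := by
    refine integral_mono iL iR fun x => ?_
    have hn : ‖x j - p‖ ^ 2 = (x j 0 - p 0) ^ 2 + (x j 1 - p 1) ^ 2 := by
      rw [plane_norm_sq]; rfl
    have hsum : ∑ i, G i x * u x = (2 * coulombProfile ε δ (‖x j - p‖ ^ 2) +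
        2 * ‖x j - p‖ ^ 2 * coulombProfileDeriv ε δ (‖x j - p‖ ^ 2)) * u x := by
      rw [Fin.sum_univ_two]
      simp only [G]
      linear_combination -(2 * coulombProfileDeriv ε δ (‖x j - p‖ ^ 2) * u x) * hn
    simp only [hsum]
    split_ifs with hlt
    · rw [← add_mul]
      exact mul_le_mul_of_nonneg_right (inv_sqrt_le_div hε (norm_nonneg _) hlt) (h0 x)
    · obtain ⟨z1, z2⟩ := coulombProfile_eq_zero (ε := ε) hδ (not_lt.1 hlt)
      simp [z1, z2]
  refine s1.trans ?_
  rw [integral_add (integrable_finsetSum _ fun i _ => iGu i) iR2,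
    integral_finsetSum _ fun i _ => iGu i]
  simp only [ibp]
  rw [Finset.sum_neg_distrib, ← integral_finsetSum _ fun i _ => iFu i, ← integral_neg]
  have s2 : ∫ x, -∑ i, F i x * fderiv ℝ u x (e i) ≤
      ∫ x, if ‖x j - p‖ < δ then ∑ i, |fderiv ℝ u x (e i)| else 0 := by
    refine integral_mono (integrable_finsetSum _ fun i _ => iFu i).neg iR1 fun x => ?_
    simp only
    split_ifs with hlt
    · rw [← Finset.sum_neg_distrib]
      refine Finset.sum_le_sum fun i _ => (neg_le_abs _).trans ?_
      rw [abs_mul]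
      refine mul_le_of_le_one_left (abs_nonneg _) (abs_mul_coulombProfile_le hε ?_)
      simpa using PiLp.norm_apply_le (x j - p) i
    · simp [F, (coulombProfile_eq_zero (ε := ε) hδ (not_lt.1 hlt)).1]
  have s3 : (∫ x, if ‖x j - p‖ < δ then ∑ i, |fderiv ℝ u x (e i)| else 0) +
      (∫ x, if ‖x j - p‖ < δ then 6 / δ * u x else 0) =
      ∫ x, if ‖x j - p‖ < δ then (∑ i, |fderiv ℝ u x (e i)|) + 6 / δ * u x else 0 := by
    rw [← integral_add iR1 iR2]
    refine integral_congr_ae (Filter.Eventually.of_forall fun x => ?_)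
    simp only
    split_ifs <;> simp
  linarith

lemma integral_near_le {u : (Fin N → Plane) → ℝ} (hu : ContDiff ℝ 1 u)
    (hc : HasCompactSupport u) (h0 : ∀ x, 0 ≤ u x) (j : Fin N) (p : Plane) {δ : ℝ} (hδ : 0 < δ) :
    Integrable (fun x => if ‖x j - p‖ < δ then 1 / ‖x j - p‖ * u x else 0) ∧
    ∫ x, (if ‖x j - p‖ < δ then 1 / ‖x j - p‖ * u x else 0) ≤
      ∫ x, if ‖x j - p‖ < δ then
        (∑ i, |fderiv ℝ u x (Pi.single j (EuclideanSpace.single i (1 : ℝ)))|) + 6 / δ * u x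
        else 0 := by
  set B := ∫ x, if ‖x j - p‖ < δ then
        (∑ i, |fderiv ℝ u x (Pi.single j (EuclideanSpace.single i (1 : ℝ)))|) + 6 / δ * u x
        else 0
  set f : (Fin N → Plane) → ℝ := fun x => if ‖x j - p‖ < δ then 1 / ‖x j - p‖ * u x else 0 with hf
  set g : ℕ → (Fin N → Plane) → ℝ := fun n x => if ‖x j - p‖ < δ then
    (√(‖x j - p‖ ^ 2 + (1 / ((n : ℝ) + 1)) ^ 2))⁻¹ * u x else 0 with hg
  have hreg := fun n : ℕ => integral_regularized_near_le hu hc h0 j p hδ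
    (ε := 1 / ((n : ℝ) + 1)) (by positivity)
  have hf0 : ∀ x, 0 ≤ f x := fun x => by
    have := h0 x
    simp only [hf]; split_ifs <;> positivity
  have hg0 : ∀ n x, 0 ≤ g n x := fun n x => by
    have := h0 x
    simp only [hg]; split_ifs <;> positivity
  have hB : 0 ≤ B := (integral_nonneg (hg0 0)).trans (hreg 0).2
  have hlim : ∀ x, x j ≠ p → Filter.Tendsto (fun n => g n x) Filter.atTop (nhds (f x)) := by
    intro x hx
    have hpos : 0 < ‖x j - p‖ := norm_pos_iff.2 (sub_ne_zero.2 hx)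
    simp only [hf, hg]
    split_ifs
    · have t0 : Filter.Tendsto (fun n : ℕ => 1 / ((n : ℝ) + 1)) Filter.atTop (nhds 0) :=
        tendsto_one_div_add_atTop_nhds_zero_nat
      have t1 : Filter.Tendsto (fun n : ℕ => √(‖x j - p‖ ^ 2 + (1 / ((n : ℝ) + 1)) ^ 2))
          Filter.atTop (nhds ‖x j - p‖) := by
        have := ((t0.pow 2).const_add (‖x j - p‖ ^ 2)).sqrt
        simpa [Real.sqrt_sq hpos.le] using this
      rw [one_div]
      exact (t1.inv₀ hpos.ne').mul_const _
    · exact tendsto_const_nhds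
  have hle : ∀ x, ENNReal.ofReal (f x) ≤
      Filter.liminf (fun n => ENNReal.ofReal (g n x)) Filter.atTop := by
    intro x
    by_cases hx : x j = p
    · simp [hf, hx]
    · exact (ENNReal.tendsto_ofReal (hlim x hx)).liminf_eq.ge
  have hfm : Measurable f := by
    refine Measurable.ite (measurableSet_lt (by fun_prop) measurable_const) ?_ measurable_const
    have := hu.continuous.measurable
    fun_prop
  have hl : ∫⁻ x, ENNReal.ofReal (f x) ≤ ENNReal.ofReal B := by
    refine (lintegral_mono hle).trans ((lintegral_liminf_le' fun n =>
      (hreg n).1.aestronglyMeasurable.aemeasurable.ennreal_ofReal).trans ?_)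
    have hn : ∀ n, ∫⁻ x, ENNReal.ofReal (g n x) ≤ ENNReal.ofReal B := fun n => by
      rw [← ofReal_integral_eq_lintegral_ofReal (hreg n).1 (Filter.Eventually.of_forall (hg0 n))]
      exact ENNReal.ofReal_le_ofReal (hreg n).2
    exact (Filter.liminf_le_liminf (Filter.Eventually.of_forall hn)).trans
      (Filter.liminf_const _).le
  have hfi : Integrable f := by
    refine ⟨hfm.aestronglyMeasurable, ?_⟩
    rw [hasFiniteIntegral_iff_ofReal (Filter.Eventually.of_forall hf0)]
    exact hl.trans_lt ENNReal.ofReal_lt_top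
  refine ⟨hfi, ?_⟩
  rw [integral_eq_lintegral_of_nonneg_ae (Filter.Eventually.of_forall hf0)
    hfm.aestronglyMeasurable]
  exact ENNReal.toReal_le_of_le_ofReal hB hl

lemma integrable_coulomb_mul {u : (Fin N → Plane) → ℝ} (hu : ContDiff ℝ 1 u)
    (hc : HasCompactSupport u) (h0 : ∀ x, 0 ≤ u x) (j : Fin N) (p : Plane) :
    Integrable fun x => 1 / ‖x j - p‖ * u x := by
  have iu : Integrable u := hu.continuous.integrable_of_hasCompactSupport hc
  have hum := hu.continuous.measurable
  refine ((integral_near_le hu hc h0 j p one_pos).1.add iu).mono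
    (by fun_prop : Measurable _).aestronglyMeasurable (Filter.Eventually.of_forall fun x => ?_)
  have hx := h0 x
  rw [Real.norm_of_nonneg (by positivity)]
  refine le_trans ?_ (le_abs_self _)
  simp only [Pi.add_apply]
  split_ifs with hlt
  · linarith
  · rw [zero_add]
    refine mul_le_of_le_one_left hx ?_
    rw [not_lt] at hlt
    rwa [div_le_one (by linarith)]

end OneBody

/-! ### The length scale of a configuration of nuclei -/

open scoped Classical in
/-- The length scale of a finite set of nuclei: a tenth of the distance to the second nearest
nucleus, capped at `b`. -/
noncomputable def nucleusScale (P : Finset Plane) (b : ℝ) (z : Plane) : ℝ :=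
  P.offDiag.fold min (10 * b) (fun pq => max ‖z - pq.1‖ ‖z - pq.2‖) / 10

section NucleusScale

variable {P : Finset Plane} {b : ℝ}

lemma nucleusScale_le {p q : Plane} (hp : p ∈ P) (hq : q ∈ P) (hpq : p ≠ q) (z : Plane) :
    10 * nucleusScale P b z ≤ max ‖z - p‖ ‖z - q‖ := by
  classical
  rw [nucleusScale, mul_div_cancel₀ _ (by norm_num)]
  exact ((Finset.le_fold_min _).1 le_rfl).2 (p, q) (Finset.mem_offDiag.2 ⟨hp, hq, hpq⟩)

lemma exists_le_nucleusScale {z : Plane} (hz : nucleusScale P b z < b) :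
    ∃ p ∈ P, ∃ q ∈ P, p ≠ q ∧ ‖z - p‖ ≤ 10 * nucleusScale P b z ∧
      ‖z - q‖ ≤ 10 * nucleusScale P b z := by
  classical
  have h : P.offDiag.fold min (10 * b) (fun pq => max ‖z - pq.1‖ ‖z - pq.2‖) ≤
      10 * nucleusScale P b z := by
    rw [nucleusScale, mul_div_cancel₀ _ (by norm_num)]
  rcases (Finset.fold_min_le _).1 h with h | ⟨⟨p, q⟩, hm, h⟩
  · linarith
  · obtain ⟨hp, hq, hpq⟩ := Finset.mem_offDiag.1 hm
    exact ⟨p, hp, q, hq, hpq, (le_max_left _ _).trans h, (le_max_right _ _).trans h⟩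

lemma isLengthScale_nucleusScale (P : Finset Plane) (hb : 0 < b) :
    IsLengthScale (nucleusScale P b) b where
  pos z := by
    refine div_pos ((Finset.lt_fold_min _).2 ⟨by positivity, fun pq hpq => ?_⟩) (by norm_num)
    by_contra hle
    have h1 := (le_max_left _ _).trans (not_lt.1 hle)
    have h2 := (le_max_right _ _).trans (not_lt.1 hle)
    rw [norm_le_zero_iff, sub_eq_zero] at h1 h2
    exact (Finset.mem_offDiag.1 hpq).2.2 (h1.symm.trans h2)
  le z := by
    rw [nucleusScale, div_le_iff₀ (by norm_num)]
    linarith [((Finset.le_fold_min _).1 (le_refl (P.offDiag.fold min (10 * b)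
      (fun pq => max ‖z - pq.1‖ ‖z - pq.2‖)))).1]
  lip x y := by
    rw [nucleusScale, nucleusScale, ← add_div]
    gcongr
    obtain ⟨h1, h2⟩ := (Finset.le_fold_min _).1 (le_refl (P.offDiag.fold min (10 * b)
      (fun pq => max ‖x - pq.1‖ ‖x - pq.2‖)))
    rw [← sub_le_iff_le_add]
    refine (Finset.le_fold_min _).2 ⟨by linarith [norm_nonneg (x - y)], fun pq hpq => ?_⟩
    rw [sub_le_iff_le_add]
    refine (h2 pq hpq).trans (max_le ?_ ?_)
    · have := norm_sub_le_norm_sub_add_norm_sub x y pq.1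
      linarith [le_max_left ‖y - pq.1‖ ‖y - pq.2‖]
    · have := norm_sub_le_norm_sub_add_norm_sub x y pq.2
      linarith [le_max_right ‖y - pq.1‖ ‖y - pq.2‖]

lemma eq_of_near_nuclei {p q x : Plane} (hp : p ∈ P) (hq : q ∈ P)
    (hxp : ‖x - p‖ < 5 * nucleusScale P b p) (hxq : ‖x - q‖ < 5 * nucleusScale P b q) : p = q := by
  by_contra hpq
  have h1 := nucleusScale_le (b := b) hp hq hpq p
  have h2 := nucleusScale_le (b := b) hp hq hpq q
  rw [sub_self, norm_zero, max_eq_right (norm_nonneg _)] at h1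
  rw [sub_self, norm_zero, max_eq_left (norm_nonneg _), norm_sub_rev] at h2
  have h3 := norm_sub_le_norm_sub_add_norm_sub p x q
  rw [norm_sub_rev p x] at h3
  linarith

lemma one_div_infDist_le (hb : 0 < b) (x : Plane) :
    1 / Metric.infDist x P ≤ (∑ p ∈ P, if ‖x - p‖ < 5 * nucleusScale P b p then
      1 / ‖x - p‖ else 0) + 1 / nucleusScale P b x := by
  have hℓ := isLengthScale_nucleusScale P hb
  have hx := hℓ.pos x
  have hnn : ∀ p ∈ P, 0 ≤ if ‖x - p‖ < 5 * nucleusScale P b p then 1 / ‖x - p‖ else 0 :=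
    fun p _ => by split_ifs <;> positivity
  rcases P.eq_empty_or_nonempty with rfl | hne
  · simp [hx.le]
  obtain ⟨p, hp, hd⟩ := P.finite_toSet.isCompact.exists_infDist_eq_dist hne x
  rw [hd, dist_eq_norm]
  have hs := Finset.single_le_sum hnn hp
  split_ifs at hs with hlt
  · have : 0 ≤ 1 / nucleusScale P b x := by positivity
    linarith
  · have h0 := Finset.sum_nonneg hnn
    have h1 := hℓ.lip x p
    have h2 := hℓ.pos p
    have : 1 / ‖x - p‖ ≤ 1 / nucleusScale P b x :=
      one_div_le_one_div_of_le hx (by linarith)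
    linarith

lemma sum_near_le (hb : 0 < b) (x : Plane) {s t : ℝ} (hs : 0 ≤ s) (ht : 0 ≤ t) :
    (∑ p ∈ P, if ‖x - p‖ < 5 * nucleusScale P b p then
      s + 6 / (5 * nucleusScale P b p) * t else 0) ≤ s + 6 * (1 / nucleusScale P b x * t) := by
  have hℓ := isLengthScale_nucleusScale P hb
  have hx := hℓ.pos x
  by_cases hex : ∃ p ∈ P, ‖x - p‖ < 5 * nucleusScale P b p
  · obtain ⟨p, hp, hlt⟩ := hex
    rw [Finset.sum_eq_single_of_mem p hp fun q hq hqp => if_neg fun hlt' =>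
      hqp (eq_of_near_nuclei hq hp hlt' hlt), if_pos hlt]
    have h1 := hℓ.lip x p
    have h2 := hℓ.pos p
    rw [← mul_assoc, mul_one_div]
    gcongr
    linarith
  · push Not at hex
    rw [Finset.sum_eq_zero fun p hp => if_neg (not_lt.2 (hex p hp))]
    positivity

end NucleusScale

section OneBody

variable {N : ℕ}

lemma abs_fderiv_norm_sq_le {ψ : (Fin N → Plane) → ℂ} (hψ : Differentiable ℝ ψ) (α : ℝ)
    {c : ℝ} (hc : 0 < c) (x : Fin N → Plane) (j : Fin N) (i : Fin 2) :
    |fderiv ℝ (fun x => ‖ψ x‖ ^ 2) x (Pi.single j (EuclideanSpace.single i (1 : ℝ)))| ≤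
      c * ‖anyonD α ψ x j i‖ ^ 2 + 1 / c * ‖ψ x‖ ^ 2 := by
  have h1 : fderiv ℝ (fun x => ‖ψ x‖ ^ 2) x (Pi.single j (EuclideanSpace.single i (1 : ℝ))) =
      2 * inner ℝ (ψ x) (Complex.I * anyonD α ψ x j i) := by
    rw [(hψ x).hasFDerivAt.norm_sq.fderiv]
    simp only [smul_apply, ContinuousLinearMap.comp_apply, innerSL_apply_apply,
      fderiv_single_eq α, nsmul_eq_mul, Nat.cast_ofNat]
    simp [Complex.inner]
    ring
  rw [h1, abs_mul, abs_two]
  have h2 : |inner ℝ (ψ x) (Complex.I * anyonD α ψ x j i)| ≤ ‖ψ x‖ * ‖anyonD α ψ x j i‖ := by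
    simpa using abs_real_inner_le_norm (ψ x) (Complex.I * anyonD α ψ x j i)
  have h3 : c * ‖anyonD α ψ x j i‖ ^ 2 + 1 / c * ‖ψ x‖ ^ 2 -
      2 * (‖ψ x‖ * ‖anyonD α ψ x j i‖) = 1 / c * (c * ‖anyonD α ψ x j i‖ - ‖ψ x‖) ^ 2 := by
    field_simp
    ring
  have h4 : 0 ≤ 1 / c * (c * ‖anyonD α ψ x j i‖ - ‖ψ x‖) ^ 2 := by positivity
  linarith

lemma integral_one_div_infDist_le {ψ : (Fin N → Plane) → ℂ} (hψ : ContDiff ℝ (⊤ : ℕ∞) ψ)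
    (hc : HasCompactSupport ψ) (hd : ∀ x ∈ tsupport ψ, ∀ j k : Fin N, j ≠ k → x j ≠ x k)
    (α : ℝ) (P : Finset Plane) {b c : ℝ} (hb : 0 < b) (hc0 : 0 < c) :
    Integrable (fun x => (∑ j, 1 / Metric.infDist (x j) P) * ‖ψ x‖ ^ 2) ∧
    Integrable (fun x => (∑ j, 1 / nucleusScale P b (x j)) * ‖ψ x‖ ^ 2) ∧
    ∫ x, (∑ j, 1 / Metric.infDist (x j) P) * ‖ψ x‖ ^ 2 ≤
      c * (∫ x, ∑ j, ∑ i, ‖anyonD α ψ x j i‖ ^ 2) + 2 * N / c * (∫ x, ‖ψ x‖ ^ 2) +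
        7 * ∫ x, (∑ j, 1 / nucleusScale P b (x j)) * ‖ψ x‖ ^ 2 := by
  have hℓ := isLengthScale_nucleusScale P hb
  have hD := fun l i => continuous_anyonD α hψ hd l i
  set u : (Fin N → Plane) → ℝ := fun x => ‖ψ x‖ ^ 2 with hu_def
  have hu : ContDiff ℝ 1 u := (hψ.of_le (by simp)).norm_sq ℝ
  have huc : HasCompactSupport u := hc.norm.comp_left (g := fun t => t ^ 2) (by simp)
  have hu0 : ∀ x, 0 ≤ u x := fun x => by positivity
  have iu : Integrable u := hu.continuous.integrable_of_hasCompactSupport huc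
  have iℓ : ∀ j, Integrable fun x : Fin N → Plane => 1 / nucleusScale P b (x j) * u x := by
    intro j
    have h1 : Continuous fun x : Fin N → Plane => nucleusScale P b (x j) :=
      hℓ.continuous.comp (continuous_apply j)
    exact ((continuous_const.div h1 fun x => (hℓ.pos _).ne').mul
      hu.continuous).integrable_of_hasCompactSupport huc.mul_left
  have near := fun j p => integral_near_le hu huc hu0 j p
    (δ := 5 * nucleusScale P b p) (mul_pos (by norm_num) (hℓ.pos p))
  have hle : ∀ (j : Fin N) (x : Fin N → Plane), 1 / Metric.infDist (x j) P * u x ≤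
      (∑ p ∈ P, if ‖x j - p‖ < 5 * nucleusScale P b p then 1 / ‖x j - p‖ * u x else 0) +
        1 / nucleusScale P b (x j) * u x := by
    intro j x
    refine (mul_le_mul_of_nonneg_right (one_div_infDist_le hb (x j)) (hu0 x)).trans_eq ?_
    rw [add_mul, Finset.sum_mul]
    simp only [ite_mul, zero_mul]
  have inear : ∀ j, Integrable fun x : Fin N → Plane => ∑ p ∈ P,
      if ‖x j - p‖ < 5 * nucleusScale P b p then 1 / ‖x j - p‖ * u x else 0 := fun j =>
    integrable_finsetSum _ fun p _ => (near j p).1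
  have iinf : ∀ j, Integrable fun x : Fin N → Plane => 1 / Metric.infDist (x j) P * u x := by
    intro j
    have hm : Measurable fun x : Fin N → Plane => Metric.infDist (x j) (P : Set Plane) :=
      ((Metric.continuous_infDist_pt _).comp (continuous_apply j)).measurable
    refine ((inear j).add (iℓ j)).mono
      ((measurable_const.div hm).mul hu.continuous.measurable).aestronglyMeasurable
      (Filter.Eventually.of_forall fun x => ?_)
    rw [Real.norm_of_nonneg (mul_nonneg (one_div_nonneg.2 Metric.infDist_nonneg) (hu0 x))]
    exact (hle j x).trans (le_abs_self _)
  simp only [Finset.sum_mul]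
  refine ⟨integrable_finsetSum _ fun j _ => iinf j, integrable_finsetSum _ fun j _ => iℓ j, ?_⟩
  have iD : ∀ j i, Integrable fun x => ‖anyonD α ψ x j i‖ ^ 2 := fun j i =>
    ((hD j i).norm.pow 2).integrable_of_hasCompactSupport
      (HasCompactSupport.intro hc fun x hx => by simp [anyonD_of_notMem_tsupport hx])
  have ifd : ∀ (j : Fin N) (i : Fin 2), Integrable fun x =>
      |fderiv ℝ u x (Pi.single j (EuclideanSpace.single i (1 : ℝ)))| := fun j i =>
    (((hu.continuous_fderiv (by simp)).clm_apply
      continuous_const).integrable_of_hasCompactSupport (huc.fderiv_apply ℝ _)).abs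
  have hj : ∀ j, ∫ x, 1 / Metric.infDist (x j) P * u x ≤
      c * (∫ x, ∑ i, ‖anyonD α ψ x j i‖ ^ 2) + 2 / c * (∫ x, u x) +
        7 * ∫ x, 1 / nucleusScale P b (x j) * u x := by
    intro j
    have s1 := integral_mono (iinf j) ((inear j).add (iℓ j)) (hle j)
    rw [integral_add' (inear j) (iℓ j), integral_finsetSum _ fun p _ => (near j p).1] at s1
    have s2 := Finset.sum_le_sum fun p (_ : p ∈ P) => (near j p).2
    have iS : ∀ p ∈ P, Integrable fun x => if ‖x j - p‖ < 5 * nucleusScale P b p then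
        (∑ i, |fderiv ℝ u x (Pi.single j (EuclideanSpace.single i (1 : ℝ)))|) +
          6 / (5 * nucleusScale P b p) * u x else 0 := fun p _ =>
      integrable_ite_near ((integrable_finsetSum _ fun i _ => ifd j i).add
        (iu.const_mul _)) j p _
    rw [← integral_finsetSum _ iS] at s2
    have iT : Integrable fun x => (c * ∑ i, ‖anyonD α ψ x j i‖ ^ 2) + 2 / c * u x +
        6 * (1 / nucleusScale P b (x j) * u x) :=
      (((integrable_finsetSum _ fun i _ => iD j i).const_mul c).add (iu.const_mul _)).add
        ((iℓ j).const_mul 6)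
    have s3 := integral_mono (integrable_finsetSum _ iS) iT fun x => by
      refine (sum_near_le hb (x j) (Finset.sum_nonneg fun i _ => abs_nonneg _) (hu0 x)).trans ?_
      refine add_le_add ?_ le_rfl
      refine (Finset.sum_le_sum fun i _ => abs_fderiv_norm_sq_le
        (hψ.differentiable (by simp)) α hc0 x j i).trans_eq ?_
      rw [Finset.sum_add_distrib, ← Finset.mul_sum]
      simp
      ring
    have iKE : Integrable fun x => c * ∑ i, ‖anyonD α ψ x j i‖ ^ 2 :=
      (integrable_finsetSum _ fun i _ => iD j i).const_mul c
    have iKE' : Integrable fun x => (c * ∑ i, ‖anyonD α ψ x j i‖ ^ 2) + 2 / c * u x :=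
      iKE.add (iu.const_mul _)
    rw [integral_add iKE' ((iℓ j).const_mul 6), integral_add iKE (iu.const_mul _),
      integral_const_mul, integral_const_mul, integral_const_mul] at s3
    linarith
  rw [integral_finsetSum _ fun j _ => iinf j, integral_finsetSum _ fun j _ => iℓ j,
    integral_finsetSum _ fun j _ => integrable_finsetSum _ fun i _ => iD j i]
  refine (Finset.sum_le_sum fun j _ => hj j).trans_eq ?_
  rw [Finset.sum_add_distrib, Finset.sum_add_distrib, ← Finset.mul_sum, ← Finset.mul_sum, ← Finset.mul_sum,
    Finset.sum_const, Finset.card_univ, Fintype.card_fin, nsmul_eq_mul]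
  ring

end OneBody

/-! ### Stability for large nuclear charges -/

section Assembly

lemma integrableOn_nucleusScale (P : Finset Plane) {b : ℝ} (hb : 0 < b) :
    IntegrableOn (fun z => (nucleusScale P b z ^ 3)⁻¹) {z | nucleusScale P b z < b} ∧
    ∀ z ∉ P, 0 < {z | nucleusScale P b z < b}.indicator
        (fun z => (nucleusScale P b z ^ 3)⁻¹ / 1000) z →
      ∃ p ∈ P, ∃ q ∈ P, p ≠ q ∧
        {z | nucleusScale P b z < b}.indicator (fun z => (nucleusScale P b z ^ 3)⁻¹ / 1000) z ≤
          cubeKernel p z ∧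
        {z | nucleusScale P b z < b}.indicator (fun z => (nucleusScale P b z ^ 3)⁻¹ / 1000) z ≤
          cubeKernel q z := by
  have hℓ := isLengthScale_nucleusScale P hb
  have hcont := hℓ.continuous
  have hm : MeasurableSet {z | nucleusScale P b z < b} :=
    measurableSet_lt hcont.measurable measurable_const
  have key : ∀ z ∉ P, 0 < {z | nucleusScale P b z < b}.indicator
        (fun z => (nucleusScale P b z ^ 3)⁻¹ / 1000) z →
      ∃ p ∈ P, ∃ q ∈ P, p ≠ q ∧
        {z | nucleusScale P b z < b}.indicator (fun z => (nucleusScale P b z ^ 3)⁻¹ / 1000) z ≤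
          cubeKernel p z ∧
        {z | nucleusScale P b z < b}.indicator (fun z => (nucleusScale P b z ^ 3)⁻¹ / 1000) z ≤
          cubeKernel q z := by
    intro z hz hpos
    have hmem : nucleusScale P b z < b := by
      by_contra hn
      rw [Set.indicator_of_notMem (s := {z | nucleusScale P b z < b}) hn] at hpos
      exact hpos.false
    obtain ⟨p, hp, q, hq, hpq, h1, h2⟩ := exists_le_nucleusScale hmem
    have hle : ∀ r ∈ P, ‖z - r‖ ≤ 10 * nucleusScale P b z →
        (nucleusScale P b z ^ 3)⁻¹ / 1000 ≤ cubeKernel r z := by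
      intro r hr hle
      have hr0 : 0 < ‖z - r‖ := norm_pos_iff.2 (sub_ne_zero.2 fun e => hz (e ▸ hr))
      have e : (nucleusScale P b z ^ 3)⁻¹ / 1000 = ((10 * nucleusScale P b z) ^ 3)⁻¹ := by
        rw [mul_pow, mul_inv]; ring
      rw [e, cubeKernel]
      gcongr
    rw [Set.indicator_of_mem (show z ∈ {z | nucleusScale P b z < b} from hmem)]
    exact ⟨p, hp, q, hq, hpq, hle p hp h1, hle q hq h2⟩
  refine ⟨?_, key⟩
  have hmeas : Measurable fun z => (nucleusScale P b z ^ 3)⁻¹ / 1000 :=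
    ((hcont.measurable.pow_const 3).inv).div_const _
  have h_int := integrable_of_le_cubeKernel P
    (hmeas.indicator hm).aestronglyMeasurable (fun z => Set.indicator_nonneg (fun z _ => by
      have := hℓ.pos z
      positivity) z) key
  have := (integrable_indicator_iff hm).1 h_int
  refine (this.const_mul 1000).congr (Filter.Eventually.of_forall fun z => ?_)
  simp only
  ring

open scoped Classical in
lemma exists_coulomb_ge_nucleusScale :
    ∃ C c : ℝ, 0 < C ∧ 0 < c ∧ ∀ (P : Finset Plane) (Z : ℝ), 1 ≤ Z → ∀ (N : ℕ)
      (x : Fin N → Plane), Function.Injective x → (∀ j, x j ∉ P) → ∀ b : ℝ, 0 < b →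
      1 / 2 * ∑ j, ∑ k ∈ {j}ᶜ, 1 / ‖x j - x k‖ - Z * ∑ j, ∑ p ∈ P, 1 / ‖x j - p‖
        + 1 / 2 * Z ^ 2 * ∑ p ∈ P, ∑ q ∈ P.erase p, 1 / ‖p - q‖
      ≥ -(C * Z * ∑ j, 1 / Metric.infDist (x j) P) +
        c * Z ^ 2 * ∫ z in {z | nucleusScale P b z < b}, (nucleusScale P b z ^ 3)⁻¹ := by
  obtain ⟨C, c, hC, hc, H⟩ := exists_coulomb_ge
  refine ⟨C, c / 1000, hC, by positivity, fun P Z hZ N x hx hxP b hb => ?_⟩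
  have hℓ := isLengthScale_nucleusScale P hb
  have hm : MeasurableSet {z | nucleusScale P b z < b} :=
    measurableSet_lt hℓ.continuous.measurable measurable_const
  obtain ⟨h1, h2⟩ := integrableOn_nucleusScale P hb
  have := H P Z hZ N x hx hxP _ ((integrable_indicator_iff hm).2 (h1.div_const 1000))
    (fun z => Set.indicator_nonneg (fun z _ => by
      have := hℓ.pos z
      positivity) z) h2
  rw [integral_indicator hm, integral_div] at this
  refine this.le.trans_eq' ?_
  ring

variable {N : ℕ}

lemma integrable_pair_coulomb_mul {ψ : (Fin N → Plane) → ℂ} (hψ : Continuous ψ)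
    (hc : HasCompactSupport ψ) (hd : ∀ x ∈ tsupport ψ, ∀ j k : Fin N, j ≠ k → x j ≠ x k)
    {j k : Fin N} (hjk : j ≠ k) : Integrable fun x => 1 / ‖x j - x k‖ * ‖ψ x‖ ^ 2 := by
  refine Continuous.integrable_of_hasCompactSupport (continuous_iff_continuousAt.2 fun x => ?_)
    (HasCompactSupport.intro hc fun x hx => by simp [image_eq_zero_of_notMem_tsupport hx])
  by_cases hx : x ∈ tsupport ψ
  · have : ‖x j - x k‖ ≠ 0 := norm_ne_zero_iff.2 (sub_ne_zero.2 (hd x hx j k hjk))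
    have h1 : ContinuousAt (fun y : Fin N → Plane => 1 / ‖y j - y k‖) x :=
      ContinuousAt.div continuousAt_const (by fun_prop) this
    exact h1.mul
      (hψ.norm.pow 2).continuousAt
  · refine (continuousAt_const (y := (0 : ℝ))).congr ?_
    filter_upwards [(isClosed_tsupport ψ).isOpen_compl.mem_nhds hx] with y hy
    simp [image_eq_zero_of_notMem_tsupport hy]

lemma ae_forall_notMem_finset (P : Finset Plane) :
    ∀ᵐ x : Fin N → Plane, ∀ j, x j ∉ P := by
  have h : ∀ j, ∀ p ∈ P, ∀ᵐ x : Fin N → Plane, x j ≠ p := fun j p _ =>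
    Measure.ae_eval_ne (μ := fun _ : Fin N => (volume : Measure Plane)) j p
  have h' : ∀ j, ∀ᵐ x : Fin N → Plane, ∀ p ∈ P, x j ≠ p := fun j =>
    (Finset.eventually_all P).2 (h j)
  filter_upwards [ae_all_iff.2 h'] with x hx j hj
  exact hx j _ hj rfl

open scoped Classical in
/-- The Coulomb energy of `N` unit charges at `x` and nuclei of charge `Z` at the points of `P`. -/
noncomputable def coulombEnergy {N : ℕ} (P : Finset Plane) (Z : ℝ) (x : Fin N → Plane) : ℝ :=
  1 / 2 * ∑ j, ∑ k ∈ {j}ᶜ, 1 / ‖x j - x k‖ - Z * ∑ j, ∑ p ∈ P, 1 / ‖x j - p‖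
    + 1 / 2 * Z ^ 2 * ∑ p ∈ P, ∑ q ∈ P.erase p, 1 / ‖p - q‖

lemma integrable_coulombEnergy_mul {N : ℕ} {ψ : (Fin N → Plane) → ℂ}
    (hψ : ContDiff ℝ (⊤ : ℕ∞) ψ) (hc : HasCompactSupport ψ)
    (hd : ∀ x ∈ tsupport ψ, ∀ j k : Fin N, j ≠ k → x j ≠ x k) (P : Finset Plane) (Z : ℝ) :
    Integrable fun x => coulombEnergy P Z x * ‖ψ x‖ ^ 2 := by
  have hu : ContDiff ℝ 1 fun x => ‖ψ x‖ ^ 2 := (hψ.of_le (by simp)).norm_sq ℝ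
  have huc : HasCompactSupport fun x => ‖ψ x‖ ^ 2 :=
    hc.norm.comp_left (g := fun t => t ^ 2) (by simp)
  have iu := hu.continuous.integrable_of_hasCompactSupport (μ := volume) huc
  unfold coulombEnergy
  simp only [add_mul, sub_mul, mul_assoc, Finset.sum_mul]
  refine (((integrable_finsetSum _ fun j _ => integrable_finsetSum _ fun k hk => ?_).const_mul
    _).sub ((integrable_finsetSum _ fun j _ => integrable_finsetSum _ fun p _ => ?_).const_mul
    _)).add ((((integrable_finsetSum _ fun p _ => integrable_finsetSum _ fun q _ => ?_).const_mul
    _).const_mul _))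
  · exact integrable_pair_coulomb_mul hψ.continuous hc hd (by simpa [eq_comm] using hk)
  · exact integrable_coulomb_mul hu huc (fun x => by positivity) j p
  · exact iu.const_mul _

lemma exists_energy_ge :
    ∃ C Z₀ : ℝ, 0 < C ∧ 1 ≤ Z₀ ∧ ∀ (μ : ℤ) (ν : ℕ), Odd μ → 0 < ν → ∀ m Z : ℝ, 0 < m → Z₀ ≤ Z →
      ∀ (N : ℕ) (P : Finset Plane) (ψ : (Fin N → Plane) → ℂ),
      ContDiff ℝ (⊤ : ℕ∞) ψ → HasCompactSupport ψ →
      (∀ (σ : Equiv.Perm (Fin N)) (x : Fin N → Plane), ψ (x ∘ σ) = ψ x) →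
      (∫ x, ‖ψ x‖ ^ 2) = 1 →
      (∀ x ∈ tsupport ψ, ∀ j k : Fin N, j ≠ k → x j ≠ x k) →
      -(C * ν ^ 2 * m * Z ^ 2 * N) ≤
        1 / (2 * m) * (∫ x, ∑ j, ∑ i, ‖anyonD ((μ : ℝ) / ν) ψ x j i‖ ^ 2) +
          ∫ x, coulombEnergy P Z x * ‖ψ x‖ ^ 2 := by
  obtain ⟨C₁, c₁, hC₁, hc₁, H⟩ := exists_coulomb_ge_nucleusScale
  obtain ⟨a, ha, hA⟩ : ∃ a : ℝ, 0 < a ∧ a = 200000000 := ⟨_, by norm_num, rfl⟩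
  refine ⟨8 * C₁ ^ 2 + 2000 * (7 * a) ^ 2 * C₁ ^ 2, max 1 (7 * a * C₁ / c₁), by positivity,
    le_max_left _ _, ?_⟩
  intro μ ν hμ hν m Z hm hZ N P ψ hψ hc hsym hnorm hd
  have hZ1 : 1 ≤ Z := (le_max_left _ _).trans hZ
  have hZ2 : 7 * a * C₁ ≤ Z * c₁ := by
    rw [← div_le_iff₀ hc₁]; exact (le_max_right _ _).trans hZ
  have hZ0 : 0 < Z := by linarith
  have hν1 : (1 : ℝ) ≤ ν := by exact_mod_cast hν
  have hν0 : (0 : ℝ) < ν := by linarith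
  set c : ℝ := 1 / (4 * m * C₁ * Z) with hc_def
  set b : ℝ := 1 / (4 * m * C₁ * Z * (7 * a) * 500 * ν ^ 2) with hb_def
  have hc0 : 0 < c := by positivity
  have hb : 0 < b := by positivity
  have hℓ := isLengthScale_nucleusScale P hb
  set KE := ∫ x, ∑ j, ∑ i, ‖anyonD ((μ : ℝ) / ν) ψ x j i‖ ^ 2
  set I := ∫ z in {z | nucleusScale P b z < b}, (nucleusScale P b z ^ 3)⁻¹
  have hI0 : 0 ≤ I := setIntegral_nonneg (measurableSet_lt hℓ.continuous.measurable
    measurable_const) fun z _ => inv_nonneg.2 (pow_pos (hℓ.pos z) 3).le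
  have hKE0 : 0 ≤ KE := integral_nonneg fun x => by positivity
  have iu : Integrable fun x => ‖ψ x‖ ^ 2 := by
    by_contra hn
    rw [integral_undef hn] at hnorm
    exact zero_ne_one hnorm
  obtain ⟨iS, iT, hS⟩ := integral_one_div_infDist_le hψ hc hd ((μ : ℝ) / ν) P hb hc0
  obtain ⟨iW, hW⟩ := hℓ.integral_sum_pairWeight_le hμ hν hψ hc hsym hd
  rw [hnorm] at hS
  set S := ∫ x, (∑ j, 1 / Metric.infDist (x j) P) * ‖ψ x‖ ^ 2
  set T := ∫ x, (∑ j, 1 / nucleusScale P b (x j)) * ‖ψ x‖ ^ 2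
  set W := ∫ x, (∑ j, ∑ k ∈ {j}ᶜ, pairWeight (nucleusScale P b) x j k) * ‖ψ x‖ ^ 2
  have hT : T ≤ a * (b * W + I + N / b) := by
    have i2 : Integrable fun x => a * b * ((∑ j, ∑ k ∈ {j}ᶜ,
        pairWeight (nucleusScale P b) x j k) * ‖ψ x‖ ^ 2) +
        a * (I + N / b) * ‖ψ x‖ ^ 2 := (iW.const_mul _).add (iu.const_mul _)
    have := integral_mono iT i2 fun x => by
      have h1 := hℓ.sum_inv_le x (integrableOn_nucleusScale P hb).1
      rw [← hA] at h1
      refine (mul_le_mul_of_nonneg_right h1 (sq_nonneg ‖ψ x‖)).trans_eq ?_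
      ring
    rw [integral_add (iW.const_mul _) (iu.const_mul _), integral_const_mul, integral_const_mul,
      hnorm] at this
    refine this.trans_eq ?_
    ring
  have hV : -(C₁ * Z * S) + c₁ * Z ^ 2 * I ≤ ∫ x, coulombEnergy P Z x * ‖ψ x‖ ^ 2 := by
    have i1 : Integrable fun x => -(C₁ * Z) * ((∑ j, 1 / Metric.infDist (x j) P) * ‖ψ x‖ ^ 2) +
        c₁ * Z ^ 2 * I * ‖ψ x‖ ^ 2 := (iS.const_mul _).add (iu.const_mul _)
    have := integral_mono_ae i1 (integrable_coulombEnergy_mul hψ hc hd P Z) (by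
      filter_upwards [ae_forall_notMem_finset P] with x hxP
      by_cases hx : x ∈ tsupport ψ
      · have h1 := H P Z hZ1 N x (fun j k hjk => by
          by_contra hne
          exact hd x hx j k hne hjk) hxP b hb
        refine (mul_le_mul_of_nonneg_right h1.le (sq_nonneg ‖ψ x‖)).trans_eq' ?_
        ring
      · simp [image_eq_zero_of_notMem_tsupport hx])
    rw [integral_add (iS.const_mul _) (iu.const_mul _), integral_const_mul, integral_const_mul,
      hnorm] at this
    refine this.trans_eq' ?_
    ring
  have e1 : C₁ * Z * c = 1 / (4 * m) := by rw [hc_def]; field_simp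
  have e2 : C₁ * Z * (7 * a) * b * (500 * ν ^ 2) = 1 / (4 * m) := by rw [hb_def]; field_simp
  have e3 : C₁ * Z * (2 * N / c) = 8 * C₁ ^ 2 * m * Z ^ 2 * N := by rw [hc_def]; field_simp; ring
  have e4 : C₁ * Z * (7 * a) * (N / b) = 2000 * (7 * a) ^ 2 * C₁ ^ 2 * ν ^ 2 * m * Z ^ 2 * N := by
    rw [hb_def]; field_simp; ring
  have b1 : C₁ * Z * S ≤ C₁ * Z * (c * KE + 2 * N / c * 1 +
      7 * (a * (b * (500 * ν ^ 2 * KE) + I + N / b))) := by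
    refine mul_le_mul_of_nonneg_left (hS.trans ?_) (by positivity)
    have : a * (b * W + I + N / b) ≤ a * (b * (500 * ν ^ 2 * KE) + I + N / b) := by gcongr
    linarith
  have b2 : C₁ * Z * (c * KE + 2 * N / c * 1 +
      7 * (a * (b * (500 * ν ^ 2 * KE) + I + N / b))) = 1 / (2 * m) * KE +
      8 * C₁ ^ 2 * m * Z ^ 2 * N + 7 * a * C₁ * Z * I +
      2000 * (7 * a) ^ 2 * C₁ ^ 2 * ν ^ 2 * m * Z ^ 2 * N := by
    have e5 : 1 / (2 * m) = 1 / (4 * m) + 1 / (4 * m) := by field_simp; norm_num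
    rw [e5]
    linear_combination KE * e1 + KE * e2 + e3 + e4
  have b3 : 7 * a * C₁ * (Z * I) ≤ Z * c₁ * (Z * I) := by gcongr
  have b4 : 8 * C₁ ^ 2 * m * Z ^ 2 * N ≤ 8 * C₁ ^ 2 * m * Z ^ 2 * N * ν ^ 2 :=
    le_mul_of_one_le_right (by positivity) (one_le_pow₀ hν1)
  linarith

end Assembly

/-! ### Reduction to large nuclear charges -/

section Reduction

lemma le_of_affine_on_vertices {ι : Type*} [DecidableEq ι] {f : (ι → ℝ) → ℝ}
    (hf : ∀ q k, ∃ s t : ℝ, ∀ y, f (Function.update q k y) = s + t * y) {L M : ℝ} (P : Finset ι)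
    (hL : ∀ q : ι → ℝ, (∀ k, q k = 0 ∨ q k = M) → L ≤ f q) (q : ι → ℝ)
    (hq : ∀ k, 0 ≤ q k ∧ q k ≤ M) (hP : ∀ k ∉ P, q k = 0 ∨ q k = M) : L ≤ f q := by
  induction P using Finset.induction_on generalizing q with
  | empty => exact hL q fun k => hP k (Finset.notMem_empty k)
  | insert a P _ ih =>
    obtain ⟨s, t, hst⟩ := hf q a
    have hM : 0 ≤ M := (hq a).1.trans (hq a).2
    have key : ∀ y, y = 0 ∨ y = M → L ≤ s + t * y := by
      intro y hy
      rw [← hst]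
      refine ih _ (fun k => ?_) fun k hk => ?_
      · by_cases hka : k = a
        · subst hka
          rcases hy with rfl | rfl <;> simp [hM]
        · simpa [hka] using hq k
      · by_cases hka : k = a
        · subst hka
          simpa using hy
        · simpa [hka] using hP k (by simp [hka, hk])
    have h0 := key 0 (Or.inl rfl)
    have h1 := key M (Or.inr rfl)
    have hqa : f q = s + t * q a := by rw [← hst, Function.update_eq_self]
    rw [hqa]
    obtain ⟨ha0, haM⟩ := hq a
    rcases le_total 0 t with ht | ht <;> nlinarith

lemma chargeEnergy_update {ι : Type*} [DecidableEq ι] (P : Finset ι) (A : ℝ) (B : ι → ℝ)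
    (c : ι → ι → ℝ) (q : ι → ℝ) (k : ι) :
    ∃ s t : ℝ, ∀ y, A - ∑ p ∈ P, Function.update q k y p * B p + 1 / 2 * ∑ p ∈ P, ∑ r ∈ P.erase p,
      Function.update q k y p * Function.update q k y r * c p r = s + t * y := by
  set α : ι → ℝ := fun i => if i = k then 0 else q i with hα
  set β : ι → ℝ := fun i => if i = k then 1 else 0 with hβ
  refine ⟨A - ∑ p ∈ P, α p * B p + 1 / 2 * ∑ p ∈ P, ∑ r ∈ P.erase p, α p * α r * c p r,
    -∑ p ∈ P, β p * B p + 1 / 2 * ∑ p ∈ P, ∑ r ∈ P.erase p, (α p * β r + β p * α r) * c p r,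
    fun y => ?_⟩
  have hu : ∀ i, Function.update q k y i = α i + β i * y := fun i => by
    by_cases h : i = k
    · subst h; simp [hα, hβ]
    · simp [hα, hβ, h]
  have hββ : ∀ p, ∀ r ∈ P.erase p, β p * β r = 0 := fun p r hr => by
    have hne := Finset.ne_of_mem_erase hr
    by_cases h : p = k
    · subst h; simp [hβ, hne]
    · simp [hβ, h]
  have h1 : ∑ p ∈ P, Function.update q k y p * B p =
      ∑ p ∈ P, α p * B p + (∑ p ∈ P, β p * B p) * y := by
    rw [Finset.sum_mul, ← Finset.sum_add_distrib]
    exact Finset.sum_congr rfl fun p _ => by rw [hu]; ring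
  have h2 : ∑ p ∈ P, ∑ r ∈ P.erase p, Function.update q k y p * Function.update q k y r * c p r =
      ∑ p ∈ P, ∑ r ∈ P.erase p, α p * α r * c p r +
        (∑ p ∈ P, ∑ r ∈ P.erase p, (α p * β r + β p * α r) * c p r) * y := by
    rw [Finset.sum_mul, ← Finset.sum_add_distrib]
    refine Finset.sum_congr rfl fun p _ => ?_
    rw [Finset.sum_mul, ← Finset.sum_add_distrib]
    refine Finset.sum_congr rfl fun r hr => ?_
    rw [hu, hu]
    linear_combination y ^ 2 * c p r * hββ p r hr
  rw [h1, h2]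
  ring

lemma le_chargeEnergy_of_forall_subset {ι : Type*} [DecidableEq ι] (P : Finset ι) (A : ℝ)
    (B : ι → ℝ) (c : ι → ι → ℝ) {L M Z : ℝ} (hM : 0 < M)
    (hL : ∀ S ⊆ P, L ≤ A - M * ∑ p ∈ S, B p +
      1 / 2 * M ^ 2 * ∑ p ∈ S, ∑ r ∈ S.erase p, c p r) (hZ : 0 ≤ Z) (hZM : Z ≤ M) :
    L ≤ A - Z * ∑ p ∈ P, B p + 1 / 2 * Z ^ 2 * ∑ p ∈ P, ∑ r ∈ P.erase p, c p r := by
  have hvert : ∀ q : ι → ℝ, (∀ k, q k = 0 ∨ q k = M) → L ≤ A - ∑ p ∈ P, q p * B p +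
      1 / 2 * ∑ p ∈ P, ∑ r ∈ P.erase p, q p * q r * c p r := by
    intro q hq
    refine (hL (P.filter fun k => q k = M) (Finset.filter_subset _ _)).trans_eq ?_
    have hqv : ∀ p, q p = if q p = M then M else 0 := fun p => by
      rcases hq p with h | h
      · rw [h, if_neg hM.ne]
      · rw [h, if_pos rfl]
    have h1 : ∑ p ∈ P, q p * B p = M * ∑ p ∈ P.filter (fun k => q k = M), B p := by
      rw [Finset.mul_sum, Finset.sum_filter]
      refine Finset.sum_congr rfl fun p _ => ?_
      rcases hq p with h | h <;> simp [h, hM.ne]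
    have h2 : ∑ p ∈ P, ∑ r ∈ P.erase p, q p * q r * c p r = M ^ 2 *
        ∑ p ∈ P.filter (fun k => q k = M), ∑ r ∈ (P.filter fun k => q k = M).erase p, c p r := by
      rw [Finset.mul_sum, Finset.sum_filter]
      refine Finset.sum_congr rfl fun p _ => ?_
      rcases hq p with h | h
      · simp [h, hM.ne]
      · rw [if_pos h, Finset.mul_sum, ← Finset.filter_erase, Finset.sum_filter]
        refine Finset.sum_congr rfl fun r _ => ?_
        rcases hq r with h' | h' <;> simp [h, h', hM.ne, sq]
    rw [h1, h2]
    ring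
  have := le_of_affine_on_vertices (fun q k => chargeEnergy_update P A B c q k) P hvert
    (fun k => if k ∈ P then Z else 0) (fun k => by split_ifs <;> simp [hZ, hZM, hM.le])
    fun k hk => Or.inl (if_neg hk)
  refine this.trans_eq ?_
  have h1 : ∑ p ∈ P, (if p ∈ P then Z else 0) * B p = Z * ∑ p ∈ P, B p := by
    rw [Finset.mul_sum]
    exact Finset.sum_congr rfl fun p hp => by rw [if_pos hp]
  have h2 : ∑ p ∈ P, ∑ r ∈ P.erase p, (if p ∈ P then Z else 0) * (if r ∈ P then Z else 0) * c p r =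
      Z ^ 2 * ∑ p ∈ P, ∑ r ∈ P.erase p, c p r := by
    rw [Finset.mul_sum]
    refine Finset.sum_congr rfl fun p hp => ?_
    rw [Finset.mul_sum]
    exact Finset.sum_congr rfl fun r hr => by
      rw [if_pos hp, if_pos (Finset.mem_of_mem_erase hr)]; ring
  rw [h1, h2]
  ring

lemma sum_filter_lt_eq_half {n : ℕ} (f : Fin n → Fin n → ℝ) (hf : ∀ j k, f j k = f k j) :
    ∑ j, ∑ k ∈ Finset.univ.filter (fun k => j < k), f j k = 1 / 2 * ∑ j, ∑ k ∈ {j}ᶜ, f j k := by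
  have h := Finset.sum_sum_Ioi_add_eq_sum_sum_off_diag fun j k => f k j
  have h2 : ∑ j, ∑ k ∈ Finset.Ioi j, (f j k + f k j) =
      2 * ∑ j, ∑ k ∈ Finset.univ.filter (fun k => j < k), f j k := by
    rw [Finset.mul_sum]
    refine Finset.sum_congr rfl fun j _ => ?_
    rw [Finset.mul_sum, Finset.filter_lt_eq_Ioi]
    exact Finset.sum_congr rfl fun k _ => by rw [hf k j]; ring
  rw [← h, h2]
  ring

lemma coulombEnergy_map {N K : ℕ} {R : Fin K → Plane} (hR : Function.Injective R) (Z : ℝ)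
    (x : Fin N → Plane) :
    coulombEnergy (Finset.univ.map ⟨R, hR⟩) Z x =
      (∑ j : Fin N, ∑ k ∈ Finset.univ.filter (fun k => j < k), 1 / ‖x j - x k‖) -
        (∑ j : Fin N, ∑ k : Fin K, Z / ‖x j - R k‖) +
        ∑ j : Fin K, ∑ k ∈ Finset.univ.filter (fun k => j < k), Z ^ 2 / ‖R j - R k‖ := by
  rw [sum_filter_lt_eq_half _ fun j k => by rw [norm_sub_rev],
    sum_filter_lt_eq_half _ fun j k => by rw [norm_sub_rev], coulombEnergy]
  congr 1
  · congr 1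
    simp only [Finset.mul_sum, Finset.sum_map, Function.Embedding.coeFn_mk, mul_one_div]
  · rw [mul_assoc, Finset.mul_sum, Finset.sum_map]
    congr 1
    refine Finset.sum_congr rfl fun j _ => ?_
    rw [← Finset.map_erase, Finset.sum_map, Finset.mul_sum]
    refine Finset.sum_congr (by ext; simp) fun k _ => ?_
    rw [mul_one_div]
    rfl

open scoped Classical in
lemma integral_coulombEnergy_mul {N : ℕ} {ψ : (Fin N → Plane) → ℂ}
    (hψ : ContDiff ℝ (⊤ : ℕ∞) ψ) (hc : HasCompactSupport ψ) (hnorm : ∫ x, ‖ψ x‖ ^ 2 = 1)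
    (hd : ∀ x ∈ tsupport ψ, ∀ j k : Fin N, j ≠ k → x j ≠ x k) (P : Finset Plane) (Z : ℝ) :
    ∫ x, coulombEnergy P Z x * ‖ψ x‖ ^ 2 =
      (∫ x, coulombEnergy ∅ 0 x * ‖ψ x‖ ^ 2) -
        Z * ∑ p ∈ P, ∑ j, (∫ x, 1 / ‖x j - p‖ * ‖ψ x‖ ^ 2) +
        1 / 2 * Z ^ 2 * ∑ p ∈ P, ∑ q ∈ P.erase p, 1 / ‖p - q‖ := by
  have hu : ContDiff ℝ 1 fun x => ‖ψ x‖ ^ 2 := (hψ.of_le (by simp)).norm_sq ℝ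
  have huc : HasCompactSupport fun x => ‖ψ x‖ ^ 2 :=
    hc.norm.comp_left (g := fun t => t ^ 2) (by simp)
  have iu := hu.continuous.integrable_of_hasCompactSupport (μ := volume) huc
  have i0 := integrable_coulombEnergy_mul hψ hc hd ∅ 0
  have i1 : ∀ p j, Integrable fun x : Fin N → Plane => 1 / ‖x j - p‖ * ‖ψ x‖ ^ 2 := fun p j =>
    integrable_coulomb_mul hu huc (fun x => by positivity) j p
  have i2 : Integrable fun x : Fin N → Plane =>
      Z * ∑ p ∈ P, ∑ j, 1 / ‖x j - p‖ * ‖ψ x‖ ^ 2 :=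
    (integrable_finsetSum _ fun p _ => integrable_finsetSum _ fun j _ => i1 p j).const_mul Z
  have i3 : Integrable fun x : Fin N → Plane => coulombEnergy ∅ 0 x * ‖ψ x‖ ^ 2 -
      Z * ∑ p ∈ P, ∑ j, 1 / ‖x j - p‖ * ‖ψ x‖ ^ 2 := i0.sub i2
  have hpt : ∀ x : Fin N → Plane, coulombEnergy P Z x * ‖ψ x‖ ^ 2 =
      coulombEnergy ∅ 0 x * ‖ψ x‖ ^ 2 - Z * ∑ p ∈ P, ∑ j, 1 / ‖x j - p‖ * ‖ψ x‖ ^ 2 +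
      (1 / 2 * Z ^ 2 * ∑ p ∈ P, ∑ q ∈ P.erase p, 1 / ‖p - q‖) * ‖ψ x‖ ^ 2 := by
    intro x
    simp only [coulombEnergy, ← Finset.sum_mul, Finset.sum_empty]
    rw [Finset.sum_comm (s := P)]
    ring
  simp only [hpt]
  rw [integral_add i3 (iu.const_mul _), integral_sub i0 i2, integral_const_mul,
    integral_const_mul, hnorm, integral_finsetSum _ fun p _ =>
      integrable_finsetSum _ fun j _ => i1 p j]
  simp only [fun p => integral_finsetSum (μ := volume) Finset.univ fun j _ => i1 p j, mul_one]

end Reduction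

/-- **Stability of odd-fractional anyonic matter with 3D Coulomb interactions.** There is
a constant `C > 0` such that for any odd-numerator reduced fraction `α = μ/ν`, mass
`m > 0`, charge `Z ≥ 1`, `N` anyons and `K` distinct static nuclei at `R₁,…,R_K ∈ ℝ²`,
every normalized symmetric wave function `ψ` supported away from the diagonals satisfies
`∫ [(1/(2m))∑_j ‖D_jψ‖² + V_C(x,R)|ψ|²] ≥ -C·ν²·m·Z²·(K+N)`. -/
theorem stability_of_anyonic_matter :
    ∃ C : ℝ, 0 < C ∧
    ∀ (μ : ℤ) (ν : ℕ), Odd μ → 0 < ν → Nat.gcd μ.natAbs ν = 1 →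
    ∀ m Z : ℝ, 0 < m → 1 ≤ Z →
    ∀ N K : ℕ, 1 ≤ N → 1 ≤ K →
    ∀ R : Fin K → EuclideanSpace ℝ (Fin 2), Function.Injective R →
    ∀ ψ : (Fin N → EuclideanSpace ℝ (Fin 2)) → ℂ,
      ContDiff ℝ (⊤ : ℕ∞) ψ → HasCompactSupport ψ →
      (∀ (σ : Equiv.Perm (Fin N)) (x : Fin N → EuclideanSpace ℝ (Fin 2)),
        ψ (x ∘ σ) = ψ x) →
      (∫ x : Fin N → EuclideanSpace ℝ (Fin 2), ‖ψ x‖ ^ 2) = 1 →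
      (∀ x ∈ tsupport ψ, ∀ j k : Fin N, j ≠ k → x j ≠ x k) →
      (∫ x : Fin N → EuclideanSpace ℝ (Fin 2),
          ((1 / (2 * m)) * ∑ j : Fin N, ∑ i : Fin 2,
              ‖anyonD ((μ : ℝ) / (ν : ℝ)) ψ x j i‖ ^ 2
            + ((∑ j : Fin N, ∑ k ∈ Finset.univ.filter (fun k => j < k),
                  1 / ‖x j - x k‖)
                - (∑ j : Fin N, ∑ k : Fin K, Z / ‖x j - R k‖)
                + ∑ j : Fin K, ∑ k ∈ Finset.univ.filter (fun k => j < k),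
                    Z ^ 2 / ‖R j - R k‖) * ‖ψ x‖ ^ 2))
        ≥ -C * (ν : ℝ) ^ 2 * m * Z ^ 2 * ((K : ℝ) + (N : ℝ)) := by
  classical
  obtain ⟨C, Z₀, hC, hZ₀, H⟩ := exists_energy_ge
  refine ⟨C * Z₀ ^ 2, by positivity, ?_⟩
  intro μ ν hμ hν _ m Z hm hZ N K _ _ R hR ψ hψ hc hsym hnorm hd
  have iD : Integrable fun x => 1 / (2 * m) * ∑ j, ∑ i, ‖anyonD ((μ : ℝ) / ν) ψ x j i‖ ^ 2 := by
    have hD := fun l i => continuous_anyonD ((μ : ℝ) / ν) hψ hd l i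
    refine Continuous.integrable_of_hasCompactSupport (by fun_prop)
      (HasCompactSupport.intro hc fun x hx => ?_)
    simp [anyonD_of_notMem_tsupport hx]
  simp only [← coulombEnergy_map hR]
  rw [integral_add iD (integrable_coulombEnergy_mul hψ hc hd _ Z), integral_const_mul,
    integral_coulombEnergy_mul hψ hc hnorm hd, ge_iff_le, ← add_assoc, ← add_sub_assoc]
  refine le_chargeEnergy_of_forall_subset (M := Z * Z₀) _ _ _ (fun p q => 1 / ‖p - q‖)
    (by positivity) (fun S _ => ?_) (by linarith) (by nlinarith)
  have h := H μ ν hμ hν m (Z * Z₀) hm (by nlinarith) N S ψ hψ hc hsym hnorm hd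
  rw [integral_coulombEnergy_mul hψ hc hnorm hd] at h
  have hK : 0 ≤ C * Z₀ ^ 2 * ν ^ 2 * m * Z ^ 2 * K := by positivity
  linarith
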